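/- arXiv:2510.26134 — 4 statements merged into one kernel-verified Lean document; each statement's English description precedes it below -/
import Mathlib

section
/- For every d ≥ 1, every w ≥ 2, and every ε > 0 there exists N such that: every finite convex subset P of ℕ^d (with the induced product order) satisfying 2 ≤ w(P) ≤ w and |P| ≥ N has δ(P) > 1/2 − ε. -/
open Finset

section Defs
variable (α : Type*) [Fintype α] [PartialOrder α]

/-- Linear extensions of a finite poset `α` with `n` elements: order-preserving
bijections to `Fin n` (representing the target `{1,…,n}`). -/
def LinExt : Type _ :=
  {f : α ≃ Fin (Fintype.card α) // ∀ x y : α, x < y → f x < f y}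

instance : Finite (LinExt α) := by unfold LinExt; infer_instance

noncomputable instance : Fintype (LinExt α) := Fintype.ofFinite _

end Defs

section Defs2
variable {α : Type*} [Fintype α] [PartialOrder α]

/-- the uniform probability `ℙ(E)` of an event `E` on linear extensions -/
noncomputable def Pr (E : LinExt α → Prop) : ℝ :=
  (Nat.card {f : LinExt α // E f} : ℝ) / (Nat.card (LinExt α) : ℝ)

/-- the value `f(x) ∈ {1,…,n}` of a linear extension at `x` -/
def val (f : LinExt α) (x : α) : ℕ := (f.1 x : ℕ) + 1

/-- `ℙ(x ≺ y)`, the probability that `x` precedes `y` in a uniform linear extension -/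
noncomputable def prLT (x y : α) : ℝ := Pr (fun f => val f x < val f y)

/-- the expectation `𝔼 f(x)` for `f` uniform on `E(P)` -/
noncomputable def expec (x : α) : ℝ :=
  (∑ f : LinExt α, (val f x : ℝ)) / (Nat.card (LinExt α) : ℝ)

/-- the variance `Var(f(x))` for `f` uniform on `E(P)` -/
noncomputable def variance (x : α) : ℝ :=
  (∑ f : LinExt α, ((val f x : ℝ) - expec x) ^ 2) / (Nat.card (LinExt α) : ℝ)

/-- the standard deviation `σ(x)` of `f(x)` -/
noncomputable def sigma (x : α) : ℝ := Real.sqrt (variance x)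

/-- `π(x)`: the number of elements of the poset incomparable to `x` -/
noncomputable def piVal (x : α) : ℕ := Nat.card {y : α // ¬ x ≤ y ∧ ¬ y ≤ x}

/-- `q(x) = max_{k ∈ {1,…,n}} ℙ(f(x) = k)` -/
noncomputable def qVal (x : α) : ℝ :=
  ⨆ k : Fin (Fintype.card α), Pr (fun f => val f x = (k : ℕ) + 1)

end Defs2

/-- A family of configurations `f`, each described by a `key` and by the number
`mult f ν` of tokens lying in the slot `ν`. -/
structure SlotModel (Ω Γ : Type*) where
  key : Ω → Γ
  mult : Ω → ℕ → ℕ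
  ext : ∀ f f', key f = key f' → mult f = mult f' → f = f'

namespace SlotModel
variable {Ω Γ : Type*} (𝔐 : SlotModel Ω Γ)

/-- `f'` arises from `f` by moving one token from slot `b` to slot `a`. -/
def IsMove (f f' : Ω) (a b : ℕ) : Prop :=
  𝔐.key f' = 𝔐.key f ∧
    ∀ ν, 𝔐.mult f' ν + (if ν = b then 1 else 0) = 𝔐.mult f ν + (if ν = a then 1 else 0)

/-- number of tokens in the slots of `I` -/
def tot (f : Ω) (I : Finset ℕ) : ℕ := ∑ ν ∈ I, 𝔐.mult f ν

variable {𝔐}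

lemma IsMove.tot_eq {f f' : Ω} {a b : ℕ} (h : 𝔐.IsMove f f' a b) (I : Finset ℕ) :
    𝔐.tot f' I + (if b ∈ I then 1 else 0) = 𝔐.tot f I + (if a ∈ I then 1 else 0) := by
  have : ∑ ν ∈ I, (𝔐.mult f' ν + (if ν = b then 1 else 0)) =
      ∑ ν ∈ I, (𝔐.mult f ν + (if ν = a then 1 else 0)) := sum_congr rfl fun ν _ => h.2 ν
  simpa [sum_add_distrib, tot] using this

lemma IsMove.tot_source {f f' : Ω} {a b : ℕ} (h : 𝔐.IsMove f f' a b) {I : Finset ℕ}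
    (hb : b ∈ I) (ha : a ∉ I) : 𝔐.tot f' I + 1 = 𝔐.tot f I := by
  simpa [hb, ha] using h.tot_eq I

lemma IsMove.tot_target {f f' : Ω} {a b : ℕ} (h : 𝔐.IsMove f f' a b) {I : Finset ℕ}
    (hb : b ∉ I) (ha : a ∈ I) : 𝔐.tot f' I = 𝔐.tot f I + 1 := by
  simpa [hb, ha] using h.tot_eq I

lemma IsMove.tot_both {f f' : Ω} {a b : ℕ} (h : 𝔐.IsMove f f' a b) {I : Finset ℕ}
    (hab : a ∈ I ↔ b ∈ I) : 𝔐.tot f' I = 𝔐.tot f I := by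
  have := h.tot_eq I
  by_cases hb : b ∈ I <;> simp_all

variable (𝔐)

/-- The ratio of the weighted number of moves from `B` to `A` out of `f` to the
weighted number of moves into the result. -/
noncomputable def ratio (A B : Γ → Finset ℕ) (f : Ω) : ℝ :=
  (((𝔐.tot f (A (𝔐.key f)) : ℝ) + (A (𝔐.key f)).card) * 𝔐.tot f (B (𝔐.key f))) /
    (((𝔐.tot f (A (𝔐.key f)) : ℝ) + 1) *
      ((𝔐.tot f (B (𝔐.key f)) : ℝ) - 1 + (B (𝔐.key f)).card))

/-- Double counting of moves of one token from the slots in `B` to the slots in `A`. -/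
theorem sum_ratio_le (A B : Γ → Finset ℕ) (hAB : ∀ f, Disjoint (A (𝔐.key f)) (B (𝔐.key f)))
    (F F' : Finset Ω)
    (H : ∀ f ∈ F, ∀ a ∈ A (𝔐.key f), ∀ b ∈ B (𝔐.key f), 1 ≤ 𝔐.mult f b →
      ∃ f' ∈ F', 𝔐.IsMove f f' a b) :
    ∑ f ∈ F, 𝔐.ratio A B f ≤ F'.card := by
  classical
  let T : Finset (Σ _ : Ω, ℕ × ℕ) := F.sigma fun f => A (𝔐.key f) ×ˢ B (𝔐.key f)
  let T₁ := T.filter fun p => 1 ≤ 𝔐.mult p.1 p.2.2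
  let T' : Finset (Σ _ : Ω, ℕ × ℕ) := F'.sigma fun f => A (𝔐.key f) ×ˢ B (𝔐.key f)
  let w : (Σ _ : Ω, ℕ × ℕ) → ℝ := fun p =>
    (((𝔐.mult p.1 p.2.1 : ℝ) + 1) * 𝔐.mult p.1 p.2.2) /
      (((𝔐.tot p.1 (A (𝔐.key p.1)) : ℝ) + 1) *
        ((𝔐.tot p.1 (B (𝔐.key p.1)) : ℝ) - 1 + (B (𝔐.key p.1)).card))
  let w' : (Σ _ : Ω, ℕ × ℕ) → ℝ := fun p =>
    ((𝔐.mult p.1 p.2.1 : ℝ) * ((𝔐.mult p.1 p.2.2 : ℝ) + 1)) /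
      ((𝔐.tot p.1 (A (𝔐.key p.1)) : ℝ) *
        ((𝔐.tot p.1 (B (𝔐.key p.1)) : ℝ) + (B (𝔐.key p.1)).card))
  have hex : ∀ p : (Σ _ : Ω, ℕ × ℕ), ∃ f', p ∈ T₁ →
      f' ∈ F' ∧ 𝔐.IsMove p.1 f' p.2.1 p.2.2 := by
    intro p
    by_cases hp : p ∈ T₁
    · simp only [T₁, T, mem_filter, mem_sigma, mem_product] at hp
      obtain ⟨f', h1, h2⟩ := H p.1 hp.1.1 _ hp.1.2.1 _ hp.1.2.2 hp.2
      exact ⟨f', fun _ => ⟨h1, h2⟩⟩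
    · exact ⟨p.1, fun h => absurd h hp⟩
  choose φ hφ using hex
  let Φ : (Σ _ : Ω, ℕ × ℕ) → (Σ _ : Ω, ℕ × ℕ) := fun p => ⟨φ p, p.2⟩
  have hmem : ∀ p ∈ T₁, p.2.1 ∈ A (𝔐.key p.1) ∧ p.2.2 ∈ B (𝔐.key p.1) := by
    intro p hp
    simp only [T₁, T, mem_filter, mem_sigma, mem_product] at hp
    exact hp.1.2
  have hΦT : ∀ p ∈ T₁, Φ p ∈ T' := by
    intro p hp
    obtain ⟨h1, h2⟩ := hφ p hp
    have := hmem p hp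
    simp only [T', Φ, mem_sigma, mem_product, h2.1]
    exact ⟨h1, this⟩
  have hinj : Set.InjOn Φ T₁ := by
    rintro ⟨f, a, b⟩ hp ⟨g, a', b'⟩ hq h
    have h2 := (hφ _ hp).2
    have h3 := (hφ _ hq).2
    simp only [Φ, Sigma.mk.injEq, heq_eq_eq, Prod.mk.injEq] at h
    obtain ⟨h, rfl, rfl⟩ := h
    rw [h] at h2
    have : f = g := by
      refine 𝔐.ext _ _ (h2.1.symm.trans h3.1) (funext fun ν => ?_)
      have e1 := h2.2 ν
      have e2 := h3.2 ν
      simp only at e1 e2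
      omega
    rw [this]
  have hw : ∀ p ∈ T₁, w p = w' (Φ p) := by
    rintro ⟨f, a, b⟩ hp
    have h2 := (hφ _ hp).2
    obtain ⟨ha, hb⟩ := hmem _ hp
    simp only at ha hb h2
    have hab : a ≠ b := fun h => disjoint_left.1 (hAB f) ha (h ▸ hb)
    have hb' : b ∉ A (𝔐.key f) := fun h => disjoint_left.1 (hAB f) h hb
    have ha' : a ∉ B (𝔐.key f) := fun h => disjoint_left.1 (hAB f) ha h
    have e1 := h2.tot_target hb' ha
    have e2 := h2.tot_source hb ha'
    have e3 := h2.2 a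
    have e4 := h2.2 b
    simp only [hab, hab.symm, if_true, if_false, add_zero] at e3 e4
    simp only [w, w', Φ, h2.1, e1, e3, ← e4, ← e2]
    push_cast
    ring_nf
  have hw'0 : ∀ p ∈ T', 0 ≤ w' p := fun p _ => by positivity
  calc ∑ f ∈ F, 𝔐.ratio A B f = ∑ p ∈ T, w p := by
        rw [sum_sigma]
        refine sum_congr rfl fun f _ => ?_
        simp only [w, ratio]
        rw [← sum_div, sum_product]
        dsimp only
        rw [← sum_mul_sum]
        simp [tot, sum_add_distrib]
    _ = ∑ p ∈ T₁, w p := by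
        rw [sum_filter_of_ne]
        intro p _ hp
        by_contra h
        have : 𝔐.mult p.1 p.2.2 = 0 := by omega
        simp [w, this] at hp
    _ = ∑ p ∈ T₁, w' (Φ p) := sum_congr rfl hw
    _ = ∑ p ∈ T₁.image Φ, w' p := (sum_image hinj).symm
    _ ≤ ∑ p ∈ T', w' p :=
        sum_le_sum_of_subset_of_nonneg (image_subset_iff.2 hΦT) fun p hp _ => hw'0 p hp
    _ ≤ ∑ f ∈ F', (1 : ℝ) := by
        rw [sum_sigma]
        refine sum_le_sum fun f _ => ?_
        simp only [w']
        rw [← sum_div, sum_product]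
        dsimp only
        rw [← sum_mul_sum]
        refine div_le_one_of_le₀ (le_of_eq ?_) (by positivity)
        simp [tot, sum_add_distrib]
    _ = F'.card := by simp

theorem card_mul_le (A B : Γ → Finset ℕ) (hAB : ∀ f, Disjoint (A (𝔐.key f)) (B (𝔐.key f)))
    (F F' : Finset Ω)
    (H : ∀ f ∈ F, ∀ a ∈ A (𝔐.key f), ∀ b ∈ B (𝔐.key f), 1 ≤ 𝔐.mult f b →
      ∃ f' ∈ F', 𝔐.IsMove f f' a b) {c : ℝ} (hc : ∀ f ∈ F, c ≤ 𝔐.ratio A B f) :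
    c * F.card ≤ F'.card := by
  refine le_trans ?_ (𝔐.sum_ratio_le A B hAB F F' H)
  rw [mul_comm, ← nsmul_eq_mul]
  exact card_nsmul_le_sum _ _ _ hc

end SlotModel

lemma pow_mul_card_le {Ω : Type*} [Fintype Ω] (F : ℕ → Finset Ω) {c : ℝ} (hc : 0 ≤ c) (g : ℕ)
    (h : ∀ i < g, c * (F i).card ≤ (F (i + 1)).card) :
    c ^ g * (F 0).card ≤ Fintype.card Ω := by
  suffices c ^ g * (F 0).card ≤ (F g).card from
    this.trans (by exact_mod_cast card_le_univ _)
  induction g with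
  | zero => simp
  | succ g ih =>
    calc c ^ (g + 1) * (F 0).card = c * (c ^ g * (F 0).card) := by ring
      _ ≤ c * (F g).card := by gcongr; exact ih fun i hi => h i (by omega)
      _ ≤ _ := h g (by omega)

/-- the increasing function `s ↦ s / (s + R - 1)` comparing the weights of windows of `R` slots -/
noncomputable def winFrac (R s : ℕ) : ℝ := (s : ℝ) / ((s : ℝ) + R - 1)

lemma winFrac_nonneg {R : ℕ} (hR : 2 ≤ R) (s : ℕ) : 0 ≤ winFrac R s := by
  have : (2 : ℝ) ≤ R := by exact_mod_cast hR
  have : (0 : ℝ) ≤ s := by positivity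
  exact div_nonneg this (by linarith)

lemma winFrac_le_one {R : ℕ} (hR : 2 ≤ R) (s : ℕ) : winFrac R s ≤ 1 := by
  have : (2 : ℝ) ≤ R := by exact_mod_cast hR
  have : (0 : ℝ) ≤ s := by positivity
  rw [winFrac, div_le_one (by linarith)]
  linarith

lemma winFrac_mono {R : ℕ} (hR : 2 ≤ R) : Monotone (winFrac R) := by
  intro s t h
  have h2 : (2 : ℝ) ≤ R := by exact_mod_cast hR
  have h1 : (0 : ℝ) ≤ s := by positivity
  have h3 : (s : ℝ) ≤ t := by exact_mod_cast h
  rw [winFrac, winFrac, div_le_div_iff₀ (by linarith) (by linarith)]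
  nlinarith

lemma winFrac_add_le {R : ℕ} (hR : 2 ≤ R) (s i : ℕ) :
    winFrac R (s + i) ≤ winFrac R s + i / R := by
  induction i with
  | zero => simp
  | succ i ih =>
    have h2 : (2 : ℝ) ≤ R := by exact_mod_cast hR
    have key : ∀ t : ℕ, winFrac R (t + 1) ≤ winFrac R t + 1 / R := by
      intro t
      have h1 : (0 : ℝ) ≤ t := by positivity
      rw [winFrac, winFrac, div_add_div _ _ (by linarith) (by linarith),
        div_le_div_iff₀ (by push_cast; linarith) (by nlinarith)]
      push_cast
      nlinarith [mul_nonneg h1 h1, mul_nonneg h1 (by linarith : (0 : ℝ) ≤ R)]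
    have := key (s + i)
    rw [← add_assoc]
    push_cast
    rw [add_div]
    linarith

namespace SlotModel
variable {Ω Γ : Type*} (𝔐 : SlotModel Ω Γ)

/-- tokens can always be moved to an earlier slot -/
def Advances : Prop :=
  ∀ f a b, a < b → 1 ≤ 𝔐.mult f b → ∃ f', 𝔐.IsMove f f' a b

variable {𝔐}

lemma tot_insert_mono (f : Ω) {I J : Finset ℕ} (h : I ⊆ J) : 𝔐.tot f I ≤ 𝔐.tot f J :=
  sum_le_sum_of_subset h

lemma tot_union (f : Ω) {I J : Finset ℕ} (h : Disjoint I J) :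
    𝔐.tot f (I ∪ J) = 𝔐.tot f I + 𝔐.tot f J := sum_union h

variable (𝔐)

lemma ratio_eq_winFrac {R : ℕ} (hR : 2 ≤ R) {A B : Γ → Finset ℕ}
    (hA : ∀ k, (A k).card = R) (hB : ∀ k, (B k).card = R) (f : Ω) :
    𝔐.ratio A B f =
      winFrac R (𝔐.tot f (B (𝔐.key f))) / winFrac R (𝔐.tot f (A (𝔐.key f)) + 1) := by
  have h2 : (2 : ℝ) ≤ R := by exact_mod_cast hR
  have h0 : (0 : ℝ) ≤ 𝔐.tot f (B (𝔐.key f)) := by positivity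
  have h0' : (0 : ℝ) ≤ 𝔐.tot f (A (𝔐.key f)) := by positivity
  rw [ratio, winFrac, winFrac, hA, hB]
  push_cast
  have e1 : (𝔐.tot f (A (𝔐.key f)) : ℝ) + 1 ≠ 0 := by positivity
  have e2 : (𝔐.tot f (A (𝔐.key f)) : ℝ) + R ≠ 0 := by positivity
  have e3 : (𝔐.tot f (B (𝔐.key f)) : ℝ) + R - 1 ≠ 0 := by linarith
  have e4 : (𝔐.tot f (A (𝔐.key f)) : ℝ) + 1 + R - 1 = 𝔐.tot f (A (𝔐.key f)) + R := by ring
  rw [e4, show (𝔐.tot f (B (𝔐.key f)) : ℝ) - 1 + R = 𝔐.tot f (B (𝔐.key f)) + R - 1 by ring]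
  field_simp

variable [Fintype Ω]

/-- A window is unlikely to carry much more than an earlier one. -/
theorem card_winFrac_jump (hadv : 𝔐.Advances) {R : ℕ} (hR : 2 ≤ R) {A B : Γ → Finset ℕ}
    (hA : ∀ k, (A k).card = R) (hB : ∀ k, (B k).card = R)
    (hAB : ∀ f, ∀ a ∈ A (𝔐.key f), ∀ b ∈ B (𝔐.key f), a < b) {η : ℝ} (hη : 0 < η) {g : ℕ}
    (hg : 2 * (g : ℝ) + 1 ≤ η * R / 2) :
    (1 + η / 2) ^ g *
      (univ.filter fun f => η ≤ winFrac R (𝔐.tot f (B (𝔐.key f))) -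
        winFrac R (𝔐.tot f (A (𝔐.key f)))).card ≤ Fintype.card Ω := by
  classical
  have hd : ∀ f, Disjoint (A (𝔐.key f)) (B (𝔐.key f)) := fun f =>
    disjoint_left.2 fun a ha hb => lt_irrefl _ (hAB f a ha a hb)
  have h2 : (2 : ℝ) ≤ R := by exact_mod_cast hR
  let F : ℕ → Finset Ω := fun i => univ.filter fun f => i ≤ 𝔐.tot f (A (𝔐.key f)) ∧
    η ≤ winFrac R (𝔐.tot f (B (𝔐.key f)) + i) - winFrac R (𝔐.tot f (A (𝔐.key f)) - i)
  have := pow_mul_card_le F (c := 1 + η / 2) (by positivity) g ?_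
  · simpa [F] using this
  intro i hi
  refine 𝔐.card_mul_le A B hd _ _ ?_ ?_
  · intro f hf a ha b hb hm
    obtain ⟨f', hf'⟩ := hadv f a b (hAB _ a ha b hb) hm
    have e1 := hf'.tot_target (fun h => disjoint_left.1 (hd _) h hb) ha
    have e2 := hf'.tot_source hb (disjoint_left.1 (hd _) ha)
    refine ⟨f', ?_, hf'⟩
    simp only [F, mem_filter, mem_univ, true_and] at hf ⊢
    rw [hf'.1, e1]
    refine ⟨by omega, ?_⟩
    rw [Nat.add_sub_add_right, show 𝔐.tot f' (B (𝔐.key f)) + (i + 1) =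
      𝔐.tot f (B (𝔐.key f)) + i by omega]
    exact hf.2
  · intro f hf
    simp only [F, mem_filter, mem_univ, true_and] at hf
    rw [𝔐.ratio_eq_winFrac hR hA hB]
    set s := 𝔐.tot f (A (𝔐.key f))
    set t := 𝔐.tot f (B (𝔐.key f))
    have e1 := winFrac_add_le hR t i
    have e2 := winFrac_add_le hR (s - i) (i + 1)
    rw [show s - i + (i + 1) = s + 1 by omega] at e2
    have e3 := winFrac_le_one hR (s + 1)
    have e4 : 0 < winFrac R (s + 1) := by
      rw [winFrac]; push_cast; apply div_pos <;> [positivity; skip]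
      have : (0 : ℝ) ≤ s := by positivity
      linarith
    have e5 : (i : ℝ) / R + ((i + 1 : ℕ) : ℝ) / R ≤ η / 2 := by
      rw [← add_div, div_le_iff₀ (by linarith)]
      have : (i : ℝ) + 1 ≤ g := by exact_mod_cast hi
      push_cast
      linarith
    rw [le_div_iff₀ e4]
    nlinarith

/-- Few configurations carry `k` tokens up to slot `X` and few tokens in the following window. -/
theorem card_window_light (hadv : 𝔐.Advances) {m L : ℕ}
    (htot : ∀ f, 𝔐.tot f (range (m + 1)) = L) (hvan : ∀ f ν, m < ν → 𝔐.mult f ν = 0)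
    (X : Γ → ℕ) {R : ℕ} {k u : ℕ} {κ : ℝ} (hκ : 0 < κ) (huR : 4 * (u : ℝ) ≤ κ * R)
    (hkL : k < L) (hk : κ * ((L : ℝ) - k + m) ≤ L - k - 2 * u) :
    2 ^ u * ((univ.filter fun f => 𝔐.tot f (range (X (𝔐.key f) + 1)) = k ∧
        𝔐.tot f (Ioc (X (𝔐.key f)) (X (𝔐.key f) + R)) < u).card : ℝ) ≤ Fintype.card Ω := by
  classical
  let A : Γ → Finset ℕ := fun q => Ioc (X q) (X q + R)
  let B : Γ → Finset ℕ := fun q => Ioc (X q + R) (max m (X q + R))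
  have hAB : ∀ f, ∀ a ∈ A (𝔐.key f), ∀ b ∈ B (𝔐.key f), a < b := by
    intro f a ha b hb
    simp only [A, B, mem_Ioc] at ha hb
    omega
  have hd : ∀ f, Disjoint (A (𝔐.key f)) (B (𝔐.key f)) := fun f =>
    disjoint_left.2 fun a ha hb => lt_irrefl _ (hAB f a ha a hb)
  let F : ℕ → Finset Ω := fun i => univ.filter fun f => 𝔐.tot f (range (X (𝔐.key f) + 1)) = k ∧
    i ≤ 𝔐.tot f (A (𝔐.key f)) ∧ 𝔐.tot f (A (𝔐.key f)) < u + i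
  have := pow_mul_card_le F (c := 2) (by positivity) u ?_
  · simpa [F] using this
  have hsum : ∀ f, 𝔐.tot f (range (X (𝔐.key f) + 1)) + 𝔐.tot f (A (𝔐.key f)) +
      𝔐.tot f (B (𝔐.key f)) = L := by
    intro f
    set q := 𝔐.key f
    rw [← htot f, ← tot_union, ← tot_union]
    · have : range (m + 1) ⊆ range (X q + 1) ∪ A q ∪ B q := by
        intro ν
        simp only [A, B, mem_union, mem_Ioc, mem_range]
        omega
      refine (sum_subset this fun ν _ hν => hvan f ν ?_).symm
      simp only [mem_range] at hν
      omega
    · refine disjoint_left.2 fun ν h1 h2 => ?_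
      simp only [A, B, mem_union, mem_Ioc, mem_range] at h1 h2
      omega
    · refine disjoint_left.2 fun ν h1 h2 => ?_
      simp only [A, mem_Ioc, mem_range] at h1 h2
      omega
  intro i hi
  refine 𝔐.card_mul_le A B hd _ _ ?_ ?_
  · intro f hf a ha b hb hm
    obtain ⟨f', hf'⟩ := hadv f a b (hAB _ a ha b hb) hm
    have e1 := hf'.tot_target (fun h => disjoint_left.1 (hd _) h hb) ha
    have e2 : 𝔐.tot f' (range (X (𝔐.key f) + 1)) = 𝔐.tot f (range (X (𝔐.key f) + 1)) := by
      refine hf'.tot_both ?_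
      simp only [A, B, mem_Ioc, mem_range] at ha hb ⊢
      omega
    refine ⟨f', ?_, hf'⟩
    simp only [F, mem_filter, mem_univ, true_and] at hf ⊢
    rw [hf'.1, e1, e2]
    exact ⟨hf.1, by omega, by omega⟩
  · intro f hf
    simp only [F, mem_filter, mem_univ, true_and] at hf
    have hs := hsum f
    have hAc : (A (𝔐.key f)).card = R := by simp [A]
    have hBc : (B (𝔐.key f)).card ≤ m := by simp [B]
    rw [ratio, hAc]
    set s := 𝔐.tot f (A (𝔐.key f))
    set t := 𝔐.tot f (B (𝔐.key f))
    have hs2 : (k : ℝ) + s + t = L := by rw [← hf.1]; exact_mod_cast hs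
    have hBc' : ((B (𝔐.key f)).card : ℝ) ≤ m := by exact_mod_cast hBc
    have hsu : (s : ℝ) + 1 ≤ 2 * u := by
      have : s + 1 ≤ 2 * u := by omega
      exact_mod_cast this
    have hkL' : (k : ℝ) < L := by exact_mod_cast hkL
    have hs0 : (0 : ℝ) ≤ s := by positivity
    have hm0 : (0 : ℝ) ≤ m := by positivity
    have hb0 : (0 : ℝ) ≤ (B (𝔐.key f)).card := by positivity
    have ht0 : 0 < t := by
      have : (0 : ℝ) < t := by
        have : 0 < κ * ((L : ℝ) - k + m) := mul_pos hκ (by linarith)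
        linarith
      exact_mod_cast this
    have ht1 : (1 : ℝ) ≤ t := by exact_mod_cast ht0
    have ht : κ * (t + m) ≤ t := by
      have : κ * (t + m) ≤ κ * ((L : ℝ) - k + m) :=
        mul_le_mul_of_nonneg_left (by linarith) hκ.le
      linarith
    rcases hb0.eq_or_lt with hb | hb
    · exfalso
      have : B (𝔐.key f) = ∅ := by rw [← card_eq_zero]; exact_mod_cast hb.symm
      simp [t, this, tot] at ht0
    have hb1 : (1 : ℝ) ≤ (B (𝔐.key f)).card := by
      have : 0 < (B (𝔐.key f)).card := by exact_mod_cast hb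
      exact_mod_cast this
    rw [le_div_iff₀ (by apply mul_pos <;> linarith)]
    have h3 : 2 * ((s : ℝ) + 1) ≤ κ * (s + R) := by nlinarith
    calc (2 : ℝ) * ((s + 1) * (t - 1 + (B (𝔐.key f)).card))
        = (2 * (s + 1)) * (t - 1 + (B (𝔐.key f)).card) := by ring
      _ ≤ (κ * (s + R)) * (t + m) := by
          apply mul_le_mul h3 (by linarith) (by linarith) (by positivity)
      _ = (s + R) * (κ * (t + m)) := by ring
      _ ≤ (s + R) * t := by gcongr

/-- One more token before `X`: the loss is controlled by light windows and by the difference of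
two adjacent windows. -/
theorem card_level_succ (hadv : 𝔐.Advances) {R : ℕ} (hR : 2 ≤ R) (X Y : Γ → ℕ)
    (hXY : ∀ f, Y (𝔐.key f) + R ≤ X (𝔐.key f)) {u : ℕ} (hu : 1 ≤ u) (k : ℕ) :
    ((univ.filter fun f => 𝔐.tot f (range (X (𝔐.key f) + 1)) = k).card : ℝ) -
      (univ.filter fun f => 𝔐.tot f (range (X (𝔐.key f) + 1)) = k ∧
        𝔐.tot f (Ioc (X (𝔐.key f)) (X (𝔐.key f) + R)) < u).card -
      (1 + R / u) * ∑ f, max 0 (winFrac R (𝔐.tot f (Ioc (Y (𝔐.key f)) (Y (𝔐.key f) + R)) + 1) -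
        winFrac R (𝔐.tot f (Ioc (X (𝔐.key f)) (X (𝔐.key f) + R))))
      ≤ (univ.filter fun f => 𝔐.tot f (range (X (𝔐.key f) + 1)) = k + 1).card := by
  classical
  let A : Γ → Finset ℕ := fun q => Ioc (Y q) (Y q + R)
  let B : Γ → Finset ℕ := fun q => Ioc (X q) (X q + R)
  have hAB : ∀ f, ∀ a ∈ A (𝔐.key f), ∀ b ∈ B (𝔐.key f), a < b := by
    intro f a ha b hb
    have := hXY f
    simp only [A, B, mem_Ioc] at ha hb
    omega
  have hd : ∀ f, Disjoint (A (𝔐.key f)) (B (𝔐.key f)) := fun f =>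
    disjoint_left.2 fun a ha hb => lt_irrefl _ (hAB f a ha a hb)
  change _ - (1 + R / u) * ∑ f, max 0 (winFrac R (𝔐.tot f (A (𝔐.key f)) + 1) -
    winFrac R (𝔐.tot f (B (𝔐.key f)))) ≤ _
  set F := univ.filter fun f => 𝔐.tot f (range (X (𝔐.key f) + 1)) = k with hF
  have key := 𝔐.sum_ratio_le A B hd F
    (univ.filter fun f => 𝔐.tot f (range (X (𝔐.key f) + 1)) = k + 1) ?_
  swap
  · intro f hf a ha b hb hm
    obtain ⟨f', hf'⟩ := hadv f a b (hAB _ a ha b hb) hm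
    refine ⟨f', ?_, hf'⟩
    have := hXY f
    simp only [A, B, F, mem_filter, mem_univ, true_and, mem_Ioc] at hf ha hb ⊢
    rw [hf'.1, hf'.tot_target, hf] <;> simp only [mem_range] <;> omega
  refine le_trans ?_ key
  have hR' : (2 : ℝ) ≤ R := by exact_mod_cast hR
  have hu' : (1 : ℝ) ≤ u := by exact_mod_cast hu
  have point : ∀ f : Ω, 1 - (if 𝔐.tot f (B (𝔐.key f)) < u then (1 : ℝ) else 0) -
      (1 + R / u) * max 0 (winFrac R (𝔐.tot f (A (𝔐.key f)) + 1) -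
        winFrac R (𝔐.tot f (B (𝔐.key f)))) ≤ 𝔐.ratio A B f := by
    intro f
    rw [𝔐.ratio_eq_winFrac hR (fun k => by simp [A]) (fun k => by simp [B])]
    set s := 𝔐.tot f (A (𝔐.key f))
    set t := 𝔐.tot f (B (𝔐.key f))
    have e4 : 0 < winFrac R (s + 1) := by
      rw [winFrac]; push_cast; apply div_pos <;> [positivity; skip]
      have : (0 : ℝ) ≤ s := by positivity
      linarith
    have h0 := winFrac_nonneg hR t
    have h1 : 0 ≤ (1 + (R : ℝ) / u) *
      max 0 (winFrac R (s + 1) - winFrac R t) := by positivity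
    have h2 : 0 ≤ winFrac R t / winFrac R (s + 1) := by positivity
    split_ifs with htu
    · linarith
    rw [le_div_iff₀ e4]
    rcases le_total (winFrac R (s + 1)) (winFrac R t) with h | h
    · nlinarith
    have hst : t ≤ s + 1 := by
      by_contra hlt
      have h5 : s + 1 + 1 ≤ t := by omega
      have : winFrac R (s + 1) < winFrac R (s + 1 + 1) := by
        have hs0 : (0 : ℝ) ≤ s := by positivity
        rw [winFrac, winFrac, div_lt_div_iff₀] <;> push_cast <;> nlinarith
      have := winFrac_mono hR h5
      linarith
    rw [max_eq_right (by linarith)]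
    have h3 : 1 ≤ (1 + (R : ℝ) / u) * winFrac R (s + 1) := by
      have hs1 : (u : ℝ) ≤ ((s + 1 : ℕ) : ℝ) := by
        have : u ≤ s + 1 := by omega
        exact_mod_cast this
      have : winFrac R (s + 1) ≥ u / (u + R) := by
        rw [winFrac, ge_iff_le, div_le_div_iff₀ (by linarith) (by linarith)]
        nlinarith
      calc (1 : ℝ) = (1 + R / u) * (u / (u + R)) := by field_simp
        _ ≤ _ := by gcongr
    nlinarith
  calc _ ≤ ∑ f ∈ F, (1 - (if 𝔐.tot f (B (𝔐.key f)) < u then (1 : ℝ) else 0) -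
      (1 + R / u) * max 0 (winFrac R (𝔐.tot f (A (𝔐.key f)) + 1) -
        winFrac R (𝔐.tot f (B (𝔐.key f))))) := by
        rw [sum_sub_distrib, sum_sub_distrib, ← mul_sum, sum_boole, hF, filter_filter]
        simp only [sum_const, nsmul_eq_mul, mul_one]
        gcongr
        exact subset_univ _
    _ ≤ _ := sum_le_sum fun f _ => point f

end SlotModel

namespace SlotModel
variable {Ω Γ : Type*} [Fintype Ω] (𝔐 : SlotModel Ω Γ)

/-- Among many consecutive windows there are two neighbours between which the average weight
hardly decreases. -/
theorem exists_sum_winFrac_le (hadv : 𝔐.Advances) {R g J : ℕ} {σ : ℝ} (hσ0 : 0 < σ)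
    (hR2 : 2 ≤ R) (hJ0 : 0 < J) (hg : 1 / σ < (1 + σ / 2) ^ g)
    (hgR : 2 * (g : ℝ) + 1 ≤ σ * R / 2) (hσR : (1 : ℝ) / R ≤ σ) (hJ : 1 ≤ J * σ)
    {X : ℕ → Γ → ℕ} (hX : ∀ j < J, ∀ f, X j (𝔐.key f) + R ≤ X (j + 1) (𝔐.key f)) :
    ∃ j < J, ∑ f, max 0
      (winFrac R (𝔐.tot f (Ioc (X j (𝔐.key f)) (X j (𝔐.key f) + R)) + 1) -
        winFrac R (𝔐.tot f (Ioc (X (j + 1) (𝔐.key f)) (X (j + 1) (𝔐.key f) + R)))) ≤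
      4 * σ * Fintype.card Ω := by
  have hR0 : (0 : ℝ) < R := by
    have : (2 : ℝ) ≤ R := by exact_mod_cast hR2
    linarith
  let s : ℕ → Ω → ℕ := fun j f => 𝔐.tot f (Ioc (X j (𝔐.key f)) (X j (𝔐.key f) + R))
  have hjump : ∀ j < J, ((univ.filter fun f => σ ≤ winFrac R (s (j + 1) f) -
      winFrac R (s j f)).card : ℝ) ≤ σ * Fintype.card Ω := by
    intro j hj
    have := 𝔐.card_winFrac_jump hadv hR2
      (A := fun q => Ioc (X j q) (X j q + R)) (B := fun q => Ioc (X (j + 1) q) (X (j + 1) q + R))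
      (by simp) (by simp) (by
        intro f a ha b hb
        have := hX j hj f
        simp only [mem_Ioc] at ha hb
        omega) hσ0 hgR
    have h1 := mul_le_mul_of_nonneg_right hg.le (Nat.cast_nonneg (α := ℝ)
      (univ.filter fun f => σ ≤ winFrac R (s (j + 1) f) - winFrac R (s j f)).card)
    have h2 := h1.trans this
    rwa [div_mul_eq_mul_div, one_mul, div_le_iff₀ hσ0, mul_comm] at h2
  let E : ℕ → ℝ := fun j => ∑ f, max 0 (winFrac R (s j f + 1) - winFrac R (s (j + 1) f))
  have hE : ∀ j < J, E j ≤ (1 / R + σ) * Fintype.card Ω + σ * Fintype.card Ω +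
      (∑ f, winFrac R (s j f) - ∑ f, winFrac R (s (j + 1) f)) := by
    intro j hj
    have point : ∀ f : Ω, max 0 (winFrac R (s j f + 1) - winFrac R (s (j + 1) f)) ≤
        (1 / R + σ) + (if σ ≤ winFrac R (s (j + 1) f) - winFrac R (s j f) then (1 : ℝ) else 0) +
          (winFrac R (s j f) - winFrac R (s (j + 1) f)) := by
      intro f
      have e1 := winFrac_add_le hR2 (s j f) 1
      have e2 := winFrac_nonneg hR2 (s j f)
      have e3 := winFrac_le_one hR2 (s (j + 1) f)
      have e4 : (0 : ℝ) < 1 / R := by positivity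
      push_cast at e1
      refine max_le ?_ ?_ <;> split_ifs <;> linarith
    calc E j ≤ _ := sum_le_sum fun f _ => point f
      _ ≤ _ := by
        rw [sum_add_distrib, sum_add_distrib, sum_boole, sum_sub_distrib]
        have := hjump j hj
        simp only [sum_const, nsmul_eq_mul, card_univ]
        linarith
  have hsum : ∑ j ∈ range J, E j ≤
      J * ((1 / R + σ) * Fintype.card Ω + σ * Fintype.card Ω) + Fintype.card Ω := by
    calc ∑ j ∈ range J, E j ≤ _ := sum_le_sum fun j hj => hE j (mem_range.1 hj)
      _ ≤ _ := by
        rw [sum_add_distrib, sum_range_sub']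
        simp only [sum_const, nsmul_eq_mul, card_range]
        have h1 : ∑ f, winFrac R (s 0 f) ≤ Fintype.card Ω := by
          calc _ ≤ ∑ f : Ω, (1 : ℝ) := sum_le_sum fun f _ => winFrac_le_one hR2 _
            _ = _ := by simp
        have h2 : 0 ≤ ∑ f, winFrac R (s J f) := sum_nonneg fun f _ => winFrac_nonneg hR2 _
        linarith
  obtain ⟨j, hj, hjE⟩ : ∃ j ∈ range J, E j ≤ 4 * σ * Fintype.card Ω := by
    have hne : (range J).Nonempty := ⟨0, mem_range.2 hJ0⟩
    refine exists_le_of_sum_le hne (hsum.trans ?_)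
    simp only [sum_const, nsmul_eq_mul, card_range]
    have h3 : (0 : ℝ) ≤ Fintype.card Ω := by positivity
    have h4 := mul_le_mul_of_nonneg_right hJ h3
    have h5 : (J : ℝ) * (1 / R * Fintype.card Ω) ≤ J * (σ * Fintype.card Ω) := by gcongr
    linarith
  exact ⟨j, mem_range.1 hj, hjE⟩


/-- Among many well separated positions, for at least one the number of configurations with
`k` tokens before it hardly drops as `k` grows by one. -/
theorem exists_level_step {κ τ : ℝ} (hκ : 0 < κ) (hκ1 : κ ≤ 1) (hτ : 0 < τ) :
    ∃ R u J : ℕ, 1 ≤ J ∧ ∀ {Ω Γ : Type} [Fintype Ω] (𝔐 : SlotModel Ω Γ),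
      𝔐.Advances → ∀ m L : ℕ, (∀ f, 𝔐.tot f (range (m + 1)) = L) →
      (∀ f ν, m < ν → 𝔐.mult f ν = 0) → ∀ X : ℕ → Γ → ℕ,
      (∀ j < J, ∀ f, X j (𝔐.key f) + R ≤ X (j + 1) (𝔐.key f)) →
      ∃ j ≤ J, ∀ k < L, κ * ((L : ℝ) - k + m) ≤ L - k - 2 * u →
        ((univ.filter fun f => 𝔐.tot f (range (X j (𝔐.key f) + 1)) = k).card : ℝ) -
            τ * Fintype.card Ω ≤
          (univ.filter fun f => 𝔐.tot f (range (X j (𝔐.key f) + 1)) = k + 1).card := by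
  set C : ℝ := 4 / κ + 2 with hC
  have hC0 : 0 < C := by positivity
  set σ : ℝ := τ / (8 * C) with hσ
  have hσ0 : 0 < σ := by positivity
  obtain ⟨g, hg⟩ := pow_unbounded_of_one_lt (1 / σ) (by linarith : (1 : ℝ) < 1 + σ / 2)
  obtain ⟨u, hu⟩ := exists_nat_ge (1 / σ + 2 * (2 * g + 1) / σ + 2 / τ + 1)
  obtain ⟨J, hJ⟩ := exists_nat_ge (1 / σ)
  have p1 : 0 < 1 / σ := by positivity
  have p2 : 0 < 2 * (2 * (g : ℝ) + 1) / σ := by positivity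
  have p3 : 0 < 2 / τ := by positivity
  have hu1 : (1 : ℝ) ≤ u := by linarith
  set R := ⌈4 * (u : ℝ) / κ⌉₊ with hR
  have hR4 : 4 * (u : ℝ) / κ ≤ R := Nat.le_ceil _
  have hRu' : (u : ℝ) ≤ 4 * u / κ := by
    rw [le_div_iff₀ hκ]; nlinarith
  have hRu : 4 * (u : ℝ) ≤ R := by
    refine le_trans ?_ hR4
    rw [le_div_iff₀ hκ]; nlinarith
  have hRle : (R : ℝ) ≤ 4 * u / κ + 1 := (Nat.ceil_lt_add_one (by positivity)).le
  have hR0 : (0 : ℝ) < R := by linarith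
  have hR2 : 2 ≤ R := by
    have : (2 : ℝ) ≤ R := by linarith
    exact_mod_cast this
  have hJ0 : 0 < J := by
    have : (0 : ℝ) < J := by linarith
    exact_mod_cast this
  have hJR : (0 : ℝ) < J := by exact_mod_cast hJ0
  refine ⟨R, u, J, hJ0, ?_⟩
  intro Ω Γ _ 𝔐 hadv m L htot hvan X hX
  obtain ⟨j, hj, hjE⟩ := 𝔐.exists_sum_winFrac_le hadv hσ0 hR2 hJ0 hg (by
    rw [le_div_iff₀ two_pos, ← div_le_iff₀' hσ0]
    have : (2 * (g : ℝ) + 1) * 2 / σ = 2 * (2 * g + 1) / σ := by ring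
    linarith) (by rw [div_le_iff₀ hR0, ← div_le_iff₀' hσ0]; linarith)
    (by rwa [div_le_iff₀ hσ0] at hJ) hX
  set E := ∑ f, max 0
      (winFrac R (𝔐.tot f (Ioc (X j (𝔐.key f)) (X j (𝔐.key f) + R)) + 1) -
        winFrac R (𝔐.tot f (Ioc (X (j + 1) (𝔐.key f)) (X (j + 1) (𝔐.key f) + R)))) with hE
  refine ⟨j + 1, hj, fun k hkL hk => ?_⟩
  have h1 := 𝔐.card_level_succ hadv hR2 (X (j + 1)) (X j) (hX j hj)
    (u := u) (by exact_mod_cast hu1) k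
  have h2 := 𝔐.card_window_light hadv htot hvan (X (j + 1)) (R := R) (u := u) hκ
    (by rwa [div_le_iff₀' hκ] at hR4) hkL hk
  rw [← hE] at h1
  have h3 : ((univ.filter fun f => 𝔐.tot f (range (X (j + 1) (𝔐.key f) + 1)) = k ∧
        𝔐.tot f (Ioc (X (j + 1) (𝔐.key f)) (X (j + 1) (𝔐.key f) + R)) < u).card : ℝ) ≤
        τ / 2 * Fintype.card Ω := by
    have h2u : (2 : ℝ) / τ ≤ 2 ^ u := by
      have : (u : ℝ) ≤ 2 ^ u := by exact_mod_cast Nat.lt_two_pow_self.le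
      linarith
    have := (mul_le_mul_of_nonneg_right h2u (Nat.cast_nonneg (α := ℝ) _)).trans h2
    rw [div_mul_eq_mul_div, div_le_iff₀ hτ] at this
    linarith
  have h4 : (1 + (R : ℝ) / u) ≤ C := by
    have : (R : ℝ) / u ≤ 4 / κ + 1 := by
      rw [div_le_iff₀ (by linarith)]
      calc (R : ℝ) ≤ 4 * u / κ + 1 := hRle
        _ ≤ 4 * u / κ + u := by linarith
        _ = _ := by ring
    linarith
  have h5 : 0 ≤ E := sum_nonneg fun f _ => le_max_left _ _
  have h6 : (1 + (R : ℝ) / u) * E ≤ C * (4 * σ * Fintype.card Ω) := by gcongr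
  have h7 : C * (4 * σ * Fintype.card Ω) = τ / 2 * Fintype.card Ω := by
    rw [hσ]; field_simp; ring
  linarith

/-- If there are few slots, then the number of configurations with `k` tokens before a
position hardly drops as `k` grows by one. -/
theorem level_step_of_few_slots (hadv : 𝔐.Advances) {m L : ℕ}
    (htot : ∀ f, 𝔐.tot f (range (m + 1)) = L) (X : Γ → ℕ) {τ : ℝ} {k : ℕ} (hkL : k < L)
    (hk : (m : ℝ) ≤ τ * ((L : ℝ) - k)) :
    ((univ.filter fun f => 𝔐.tot f (range (X (𝔐.key f) + 1)) = k).card : ℝ) -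
        τ * Fintype.card Ω ≤
      (univ.filter fun f => 𝔐.tot f (range (X (𝔐.key f) + 1)) = k + 1).card := by
  classical
  let A : Γ → Finset ℕ := fun q => range (X q + 1)
  let B : Γ → Finset ℕ := fun q => Ioc (X q) m
  have hAB : ∀ f, ∀ a ∈ A (𝔐.key f), ∀ b ∈ B (𝔐.key f), a < b := by
    intro f a ha b hb
    simp only [A, B, mem_Ioc, mem_range] at ha hb
    omega
  have hd : ∀ f, Disjoint (A (𝔐.key f)) (B (𝔐.key f)) := fun f =>
    disjoint_left.2 fun a ha hb => lt_irrefl _ (hAB f a ha a hb)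
  set F := univ.filter fun f => 𝔐.tot f (range (X (𝔐.key f) + 1)) = k
  have hLk : (0 : ℝ) < L - k := by
    have : (k : ℝ) < L := by exact_mod_cast hkL
    linarith
  have hm0 : (0 : ℝ) ≤ m := by positivity
  have key := 𝔐.card_mul_le A B hd F
    (univ.filter fun f => 𝔐.tot f (range (X (𝔐.key f) + 1)) = k + 1) ?_ (c := 1 - τ) ?_
  · have h1 : (F.card : ℝ) ≤ Fintype.card Ω := by exact_mod_cast card_le_univ _
    have h2 : 0 ≤ τ := by
      by_contra h
      push Not at h
      nlinarith
    nlinarith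
  · intro f hf a ha b hb hm
    obtain ⟨f', hf'⟩ := hadv f a b (hAB _ a ha b hb) hm
    refine ⟨f', ?_, hf'⟩
    simp only [A, B, F, mem_filter, mem_univ, true_and, mem_Ioc, mem_range] at hf ha hb ⊢
    rw [hf'.1, hf'.tot_target, hf] <;> simp only [mem_range] <;> omega
  · intro f hf
    simp only [F, mem_filter, mem_univ, true_and] at hf
    have hXm : X (𝔐.key f) < m := by
      by_contra h
      push Not at h
      have h1 : range (m + 1) ⊆ range (X (𝔐.key f) + 1) := range_subset_range.2 (by omega)
      have := 𝔐.tot_insert_mono f h1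
      rw [htot, hf] at this
      omega
    have hs : 𝔐.tot f (A (𝔐.key f)) + 𝔐.tot f (B (𝔐.key f)) = L := by
      rw [← htot f, ← tot_union _ (hd f)]
      congr 1
      ext ν
      simp only [A, B, mem_union, mem_Ioc, mem_range]
      omega
    change 𝔐.tot f (A (𝔐.key f)) = k at hf
    rw [hf] at hs
    have hs' : (𝔐.tot f (B (𝔐.key f)) : ℝ) = L - k := by
      rw [← hs]; push_cast; ring
    have hA1 : (1 : ℝ) ≤ (A (𝔐.key f)).card := by simp [A]
    have hB1 : (1 : ℝ) ≤ (B (𝔐.key f)).card := by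
      have : 1 ≤ (B (𝔐.key f)).card := by simp [B]; omega
      exact_mod_cast this
    have hBm : ((B (𝔐.key f)).card : ℝ) ≤ m := by
      have : (B (𝔐.key f)).card ≤ m := by simp [B]
      exact_mod_cast this
    rw [ratio, hs', hf]
    rw [mul_div_mul_comm]
    have h1 : 1 ≤ ((k : ℝ) + (A (𝔐.key f)).card) / (k + 1) := by
      rw [one_le_div (by positivity)]; linarith
    have h2 : 1 - τ ≤ ((L : ℝ) - k) / (L - k - 1 + (B (𝔐.key f)).card) := by
      rw [le_div_iff₀ (by linarith)]
      rcases le_total 1 τ with h | h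
      · nlinarith
      · have : (1 - τ) * (L - k - 1 + (B (𝔐.key f)).card) ≤ (1 - τ) * ((L : ℝ) - k + m) := by
          apply mul_le_mul_of_nonneg_left <;> linarith
        nlinarith
    have h3 : 0 ≤ ((L : ℝ) - k) / (L - k - 1 + (B (𝔐.key f)).card) := by
      apply div_nonneg <;> linarith
    nlinarith

/-- A token may be moved to a later slot if enough tokens stay behind. -/
def Delays (m : ℕ) : Prop :=
  ∀ f a b, a < b → b ≤ m → b < 𝔐.mult f a → ∃ f', 𝔐.IsMove f f' b a

theorem card_slot_heavy {m : ℕ} (hdel : 𝔐.Delays m) {N r ℓ v a : ℕ}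
    (htot : ∀ f I, 𝔐.tot f I ≤ N) (ha : a < r) (hm : r + ℓ ≤ m + 1) (hℓ : 1 ≤ ℓ)
    (hv : r + ℓ ≤ v) :
    (1 + ((ℓ : ℝ) - 1) / (N + 1)) ^ v * (univ.filter fun f => 2 * v ≤ 𝔐.mult f a).card ≤
      Fintype.card Ω := by
  classical
  let F : ℕ → Finset Ω := fun i => univ.filter fun f => 2 * v ≤ 𝔐.mult f a + i
  have hℓ' : (1 : ℝ) ≤ ℓ := by exact_mod_cast hℓ
  have hc : (0 : ℝ) ≤ ((ℓ : ℝ) - 1) / (N + 1) := div_nonneg (by linarith) (by positivity)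
  have := pow_mul_card_le F (c := 1 + ((ℓ : ℝ) - 1) / (N + 1)) (by positivity) v ?_
  · simpa [F] using this
  intro i hi
  refine 𝔐.card_mul_le (fun _ => Ico r (r + ℓ)) (fun _ => {a}) ?_ _ _ ?_ ?_
  · intro f
    simp only [disjoint_singleton_right, mem_Ico]
    omega
  · intro f hf b hb a' ha' _
    simp only [mem_singleton, F, mem_filter, mem_univ, true_and, mem_Ico] at ha' hf hb
    subst ha'
    obtain ⟨f', hf'⟩ := hdel f a' b (by omega) (by omega) (by omega)
    refine ⟨f', ?_, hf'⟩
    have := hf'.2 a'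
    rw [if_pos rfl, if_neg (by omega)] at this
    simp only [F, mem_filter, mem_univ, true_and]
    omega
  · intro f hf
    simp only [F, mem_filter, mem_univ, true_and] at hf
    have hma : (0 : ℝ) < 𝔐.mult f a := by
      have : 0 < 𝔐.mult f a := by omega
      exact_mod_cast this
    have hT : (𝔐.tot f (Ico r (r + ℓ)) : ℝ) ≤ N := by exact_mod_cast htot f _
    have hT0 : (0 : ℝ) ≤ 𝔐.tot f (Ico r (r + ℓ)) := by positivity
    have h1 : 𝔐.tot f {a} = 𝔐.mult f a := by simp [tot]
    rw [ratio, h1]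
    simp only [card_singleton, Nat.card_Ico, add_tsub_cancel_left]
    push_cast
    rw [sub_add_cancel, mul_div_mul_right _ _ hma.ne',
      show (𝔐.tot f (Ico r (r + ℓ)) : ℝ) + ℓ = (𝔐.tot f (Ico r (r + ℓ)) + 1) + (ℓ - 1) by ring,
      add_div _ _ ((𝔐.tot f (Ico r (r + ℓ)) : ℝ) + 1), div_self (by positivity)]
    gcongr

/-- It is unlikely that many tokens lie in the first `r` slots. -/
theorem card_front_heavy {m : ℕ} (hdel : 𝔐.Delays m) {N r ℓ v : ℕ}
    (htot : ∀ f I, 𝔐.tot f I ≤ N) (hm : r + ℓ ≤ m + 1) (hℓ : 1 ≤ ℓ) (hv : r + ℓ ≤ v) :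
    (1 + v * (((ℓ : ℝ) - 1) / (N + 1))) *
        (univ.filter fun f => r * (2 * v) < 𝔐.tot f (range r)).card ≤ r * Fintype.card Ω := by
  classical
  have hℓ' : (1 : ℝ) ≤ ℓ := by exact_mod_cast hℓ
  have hc : (0 : ℝ) ≤ ((ℓ : ℝ) - 1) / (N + 1) := div_nonneg (by linarith) (by positivity)
  have hsub : (univ.filter fun f => r * (2 * v) < 𝔐.tot f (range r)) ⊆
      (range r).biUnion fun a => univ.filter fun f => 2 * v ≤ 𝔐.mult f a := by
    intro f hf
    simp only [mem_filter, mem_univ, true_and, mem_biUnion, mem_range] at hf ⊢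
    by_contra! h
    have : 𝔐.tot f (range r) ≤ ∑ a ∈ range r, 2 * v :=
      sum_le_sum fun a ha => (h a (mem_range.1 ha)).le
    simp at this
    omega
  have hb := one_add_mul_le_pow (a := ((ℓ : ℝ) - 1) / (N + 1)) (by linarith) v
  calc _ ≤ (1 + v * (((ℓ : ℝ) - 1) / (N + 1))) *
        ∑ a ∈ range r, ((univ.filter fun f => 2 * v ≤ 𝔐.mult f a).card : ℝ) := by
        gcongr
        exact_mod_cast (card_le_card hsub).trans card_biUnion_le
    _ = ∑ a ∈ range r, (1 + v * (((ℓ : ℝ) - 1) / (N + 1))) *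
        ((univ.filter fun f => 2 * v ≤ 𝔐.mult f a).card : ℝ) := mul_sum _ _ _
    _ ≤ ∑ a ∈ range r, (Fintype.card Ω : ℝ) := by
        refine sum_le_sum fun a ha => le_trans ?_
          (𝔐.card_slot_heavy hdel htot (mem_range.1 ha) hm hℓ hv)
        gcongr
    _ = _ := by simp

/-- It is unlikely that nearly all of the tokens that can lie in the first slot do. -/
theorem card_first_slot_heavy {m : ℕ} (hdel : 𝔐.Delays m) (hm : 1 ≤ m) {K L : ℕ} (hLK : K ≤ L)
    (hL : ∀ f, 𝔐.mult f 0 ≤ L) :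
    ((K : ℝ) - 1) * (univ.filter fun f => K < 𝔐.mult f 0).card ≤
      ((L : ℝ) - K) * Fintype.card Ω := by
  classical
  let n : ℕ → ℕ := fun s => (univ.filter fun f => 𝔐.mult f 0 = s).card
  have hstep : ∀ s, 2 ≤ s → n s ≤ n (s - 1) := by
    intro s hs
    have := 𝔐.card_mul_le (fun _ => {1}) (fun _ => {0}) (by simp)
      (univ.filter fun f => 𝔐.mult f 0 = s) (univ.filter fun f => 𝔐.mult f 0 = s - 1)
      (c := 1) ?_ ?_
    · rw [one_mul] at this
      exact_mod_cast this
    · intro f hf a ha b hb _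
      simp only [mem_singleton, mem_filter, mem_univ, true_and] at hf ha hb ⊢
      subst ha hb
      obtain ⟨f', hf'⟩ := hdel f 0 1 (by omega) hm (by omega)
      refine ⟨f', ?_, hf'⟩
      have := hf'.2 0
      simp at this
      omega
    · intro f hf
      simp only [mem_filter, mem_univ, true_and] at hf
      have : (0 : ℝ) < 𝔐.mult f 0 := by
        have : 0 < 𝔐.mult f 0 := by omega
        exact_mod_cast this
      simp only [ratio, tot, sum_singleton, card_singleton]
      push_cast
      rw [sub_add_cancel, div_self (by positivity)]
  have hanti : ∀ s t, 1 ≤ s → s ≤ t → n t ≤ n s := by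
    intro s t hs hst
    induction t, hst using Nat.le_induction with
    | base => rfl
    | succ t ht ih => exact (hstep (t + 1) (by omega)).trans ih
  have hlow : (K - 1) * n K ≤ Fintype.card Ω := by
    calc (K - 1) * n K = ∑ s ∈ Ico 1 K, n K := by simp
      _ ≤ ∑ s ∈ Ico 1 K, n s := sum_le_sum fun s hs => by
          rw [mem_Ico] at hs; exact hanti _ _ hs.1 hs.2.le
      _ ≤ Fintype.card Ω := by
          rw [← card_biUnion]
          · exact card_le_univ _
          · intro s _ t _ hst
            exact disjoint_filter.2 fun f _ h1 h2 => hst (h1.symm.trans h2)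
  rcases Nat.eq_zero_or_pos K with rfl | hK
  · have : (0 : ℝ) ≤ (univ.filter fun f => 0 < 𝔐.mult f 0).card := by positivity
    have : (0 : ℝ) ≤ (L : ℝ) * Fintype.card Ω := by positivity
    push_cast
    linarith
  have hup : (univ.filter fun f => K < 𝔐.mult f 0).card ≤ (L - K) * n K := by
    calc _ ≤ ((Ioc K L).biUnion fun s => univ.filter fun f => 𝔐.mult f 0 = s).card := by
          refine card_le_card fun f hf => ?_
          simp only [mem_filter, mem_univ, true_and, mem_biUnion, mem_Ioc] at hf ⊢
          exact ⟨_, ⟨hf, hL f⟩, rfl⟩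
      _ ≤ ∑ s ∈ Ioc K L, n s := card_biUnion_le
      _ ≤ ∑ s ∈ Ioc K L, n K := sum_le_sum fun s hs => by
          rw [mem_Ioc] at hs; exact hanti _ _ hK hs.1.le
      _ = _ := by simp
  have hlow' : ((K : ℝ) - 1) * n K ≤ Fintype.card Ω := by
    have : ((K - 1 : ℕ) : ℝ) * n K ≤ Fintype.card Ω := by exact_mod_cast hlow
    rwa [Nat.cast_sub hK, Nat.cast_one] at this
  have hup' : ((univ.filter fun f => K < 𝔐.mult f 0).card : ℝ) ≤ ((L : ℝ) - K) * n K := by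
    have : ((univ.filter fun f => K < 𝔐.mult f 0).card : ℝ) ≤ ((L - K : ℕ) : ℝ) * n K := by
      exact_mod_cast hup
    rwa [Nat.cast_sub hLK] at this
  have hK1 : (0 : ℝ) ≤ (K : ℝ) - 1 := by
    have : (1 : ℝ) ≤ K := by exact_mod_cast hK
    linarith
  have hLK' : (0 : ℝ) ≤ (L : ℝ) - K := by
    have : (K : ℝ) ≤ L := by exact_mod_cast hLK
    linarith
  calc _ ≤ ((K : ℝ) - 1) * (((L : ℝ) - K) * n K) := by gcongr
    _ = ((L : ℝ) - K) * (((K : ℝ) - 1) * n K) := by ring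
    _ ≤ _ := by gcongr

end SlotModel

namespace LinExt
variable {α : Type*} [Fintype α] [PartialOrder α]

lemma ext_of_lt_iff {f f' : LinExt α} (h : ∀ x y, f.1 x < f.1 y ↔ f'.1 x < f'.1 y) : f = f' := by
  let e : Fin (Fintype.card α) ≃o Fin (Fintype.card α) :=
    { toEquiv := f.1.symm.trans f'.1
      map_rel_iff' := by
        intro a b
        have := h (f.1.symm b) (f.1.symm a)
        simp only [Equiv.apply_symm_apply] at this
        simp only [Equiv.trans_apply]
        rw [← not_lt, ← not_lt, this] }
  have he : e = OrderIso.refl _ := Subsingleton.elim _ _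
  refine Subtype.ext (Equiv.ext fun x => ?_)
  have := DFunLike.congr_fun he (f.1 x)
  simpa [e] using this.symm

/-- A strictly monotone injection into a linear order induces a linear extension. -/
lemma exists_of_key {β : Type*} [LinearOrder β] (k : α → β) (hk : Function.Injective k)
    (hm : StrictMono k) : ∃ f : LinExt α, ∀ x y, f.1 x < f.1 y ↔ k x < k y := by
  classical
  have hc : (univ.image k).card = Fintype.card α := by
    rw [card_image_of_injective _ hk, card_univ]
  let e := (univ.image k).orderIsoOfFin hc
  let g : α ≃ (univ.image k : Finset β) :=
    Equiv.ofBijective (fun x => ⟨k x, mem_image_of_mem k (mem_univ x)⟩)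
      ⟨fun x y h => hk (congrArg Subtype.val h), fun ⟨y, hy⟩ => by
        obtain ⟨x, -, rfl⟩ := mem_image.1 hy
        exact ⟨x, rfl⟩⟩
  have key : ∀ x y, (g.trans e.symm.toEquiv) x < (g.trans e.symm.toEquiv) y ↔ k x < k y := by
    intro x y
    change e.symm (g x) < e.symm (g y) ↔ _
    rw [e.symm.lt_iff_lt]
    rfl
  exact ⟨⟨g.trans e.symm.toEquiv, fun x y h => (key x y).2 (hm h)⟩, key⟩

instance : Nonempty (LinExt α) := by
  obtain ⟨f, -⟩ := exists_of_key (α := α) (β := LinearExtension α) toLinearExtension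
    (fun _ _ h => h) (toLinearExtension.monotone.strictMono_of_injective fun _ _ h => h)
  exact ⟨f⟩

end LinExt

lemma Fin.lt_card_filter_iff {L : ℕ} (p : Fin L → Prop) [DecidablePred p]
    (hp : ∀ i j, i ≤ j → p j → p i) (l : Fin L) : (l : ℕ) < (univ.filter p).card ↔ p l := by
  constructor
  · intro h
    by_contra hl
    have : univ.filter p ⊆ Iio l := by
      intro i hi
      simp only [mem_filter, mem_univ, true_and, mem_Iio] at hi ⊢
      by_contra hil
      exact hl (hp _ _ (not_lt.1 hil) hi)
    have := card_le_card this
    rw [Fin.card_Iio] at this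
    omega
  · intro h
    have : Iic l ⊆ univ.filter p := by
      intro i hi
      simp only [mem_filter, mem_univ, true_and, mem_Iic] at hi ⊢
      exact hp _ _ hi h
    have := card_le_card this
    rw [Fin.card_Iic] at this
    omega

section ChainModel
variable {α : Type*} [Fintype α] {L : ℕ} (c : Fin L → α)

open Classical in
/-- the elements off the chain `c` -/
noncomputable def offChain : Finset α := univ.filter fun q => q ∉ Set.range c

lemma mem_offChain {q : α} : q ∈ offChain c ↔ ∀ l, c l ≠ q := by
  simp [offChain]

lemma mem_offChain_or {c : Fin L → α} (x : α) : x ∈ offChain c ∨ ∃ l, c l = x := by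
  rw [mem_offChain]
  by_cases h : ∃ l, c l = x
  · exact Or.inr h
  · exact Or.inl fun l hl => h ⟨l, hl⟩

variable [PartialOrder α]

/-- the number of off-chain elements preceding `x` -/
noncomputable def offRank (f : LinExt α) (x : α) : ℕ :=
  ((offChain c).filter fun q => f.1 q < f.1 x).card

/-- the number of chain elements preceding `x` -/
def chainRank (f : LinExt α) (x : α) : ℕ := (univ.filter fun l => f.1 (c l) < f.1 x).card

variable {c}

lemma offRank_lt_iff {f : LinExt α} {q x : α} (hq : q ∈ offChain c) :
    offRank c f q < offRank c f x ↔ f.1 q < f.1 x := by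
  constructor
  · intro h
    by_contra hqx
    refine absurd h (not_lt.2 (card_le_card fun y hy => ?_))
    simp only [mem_filter] at hy ⊢
    exact ⟨hy.1, hy.2.trans_le (not_lt.1 hqx)⟩
  · intro h
    refine card_lt_card ⟨fun y hy => ?_, fun hs => ?_⟩
    · simp only [mem_filter] at hy ⊢
      exact ⟨hy.1, hy.2.trans h⟩
    · have := hs (mem_filter.2 ⟨hq, h⟩)
      simp at this

lemma offRank_le_iff {f : LinExt α} {q : α} (hq : q ∈ offChain c) (l : Fin L) :
    offRank c f (c l) ≤ offRank c f q ↔ f.1 (c l) < f.1 q := by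
  rw [← not_lt, offRank_lt_iff hq, not_lt, lt_iff_le_and_ne, and_iff_left]
  exact fun h => (mem_offChain c).1 hq l (f.1.injective h)

lemma offRank_injOn (f : LinExt α) : Set.InjOn (offRank c f) (offChain c) := by
  intro x hx y hy h
  by_contra hxy
  rcases lt_or_gt_of_ne (fun h => hxy (f.1.injective h) : f.1 x ≠ f.1 y) with h1 | h1
  · exact absurd h ((offRank_lt_iff hx).2 h1).ne
  · exact absurd h ((offRank_lt_iff hy).2 h1).ne'

lemma offRank_le (f : LinExt α) (x : α) : offRank c f x ≤ (offChain c).card :=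
  card_filter_le _ _

lemma offRank_lt_card (f : LinExt α) {q : α} (hq : q ∈ offChain c) :
    offRank c f q < (offChain c).card :=
  card_lt_card (filter_ssubset.2 ⟨q, hq, lt_irrefl _⟩)

lemma exists_offRank_eq (f : LinExt α) {ν : ℕ} (hν : ν < (offChain c).card) :
    ∃ q ∈ offChain c, offRank c f q = ν := by
  have := surjOn_of_injOn_of_card_le (s := offChain c) (t := range (offChain c).card) (offRank c f)
    (fun q hq => by simpa using offRank_lt_card f hq) (offRank_injOn f) (by simp)
  obtain ⟨q, hq, h⟩ := this (by simpa using hν : ν ∈ (range (offChain c).card : Set ℕ))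
  exact ⟨q, hq, h⟩

lemma LinExt.monotone_comp (hc : StrictMono c) (f : LinExt α) : StrictMono fun l => f.1 (c l) :=
  fun _ _ h => f.2 _ _ (hc h)

lemma lt_chainRank_iff (hc : StrictMono c) (f : LinExt α) (x : α) (l : Fin L) :
    (l : ℕ) < chainRank c f x ↔ f.1 (c l) < f.1 x :=
  Fin.lt_card_filter_iff _ (fun _ _ hij h => ((f.monotone_comp hc).monotone hij).trans_lt h) l

variable (c) in
/-- the number of chain elements preceded by exactly `ν` off-chain elements -/
noncomputable def slotMult (f : LinExt α) (ν : ℕ) : ℕ :=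
  (univ.filter fun l => offRank c f (c l) = ν).card

lemma sum_slotMult (f : LinExt α) (ν : ℕ) :
    ∑ μ ∈ range (ν + 1), slotMult c f μ = (univ.filter fun l => offRank c f (c l) ≤ ν).card := by
  have := card_eq_sum_card_fiberwise (s := univ.filter fun l => offRank c f (c l) ≤ ν)
    (t := range (ν + 1)) (f := fun l => offRank c f (c l)) (by
      intro l hl
      simp at hl ⊢
      omega)
  rw [this]
  refine sum_congr rfl fun μ hμ => ?_
  rw [slotMult, filter_filter]
  congr 1
  ext l
  simp at hμ ⊢
  omega

lemma sum_slotMult_offRank (f : LinExt α) {q : α} (hq : q ∈ offChain c) :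
    ∑ μ ∈ range (offRank c f q + 1), slotMult c f μ = chainRank c f q := by
  rw [sum_slotMult, chainRank]
  simp only [offRank_le_iff hq]

lemma sum_slotMult_card (f : LinExt α) :
    ∑ μ ∈ range ((offChain c).card + 1), slotMult c f μ = L := by
  rw [sum_slotMult, filter_true_of_mem fun l _ => offRank_le f _]
  simp

lemma slotMult_eq_zero (f : LinExt α) {ν : ℕ} (hν : (offChain c).card < ν) :
    slotMult c f ν = 0 := by
  rw [slotMult, card_eq_zero, filter_eq_empty_iff]
  intro l _
  have := offRank_le (c := c) f (c l)
  omega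

open Classical in
/-- The tokens of the slot model of linear extensions are the elements of a chain, the slots
are the gaps between the off-chain elements. -/
noncomputable def chainModel (hc : StrictMono c) : SlotModel (LinExt α) (α → ℕ) where
  key f := fun q => if q ∈ offChain c then offRank c f q else 0
  mult := slotMult c
  ext := by
    intro f f' hkey hmult
    have hr : ∀ q ∈ offChain c, offRank c f q = offRank c f' q := by
      intro q hq
      simpa [hq] using congrFun hkey q
    have h1 : ∀ q ∈ offChain c, ∀ l, f.1 (c l) < f.1 q ↔ f'.1 (c l) < f'.1 q := by
      intro q hq l
      rw [← lt_chainRank_iff hc, ← lt_chainRank_iff hc, ← sum_slotMult_offRank f hq,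
        ← sum_slotMult_offRank f' hq, hr q hq, hmult]
    refine LinExt.ext_of_lt_iff fun x y => ?_
    rcases mem_offChain_or (c := c) x with hx | ⟨l, rfl⟩ <;>
      rcases mem_offChain_or (c := c) y with hy | ⟨l', rfl⟩
    · rw [← offRank_lt_iff hx, ← offRank_lt_iff hx, hr x hx, hr y hy]
    · have h2 : ∀ f : LinExt α, f.1 x < f.1 (c l') ↔ ¬ f.1 (c l') < f.1 x := fun f => by
        rw [not_lt, lt_iff_le_and_ne, and_iff_left]
        exact fun h => (mem_offChain c).1 hx l' (f.1.injective h).symm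
      rw [h2, h2, h1 x hx]
    · exact h1 y hy l
    · rw [(f.monotone_comp hc).lt_iff_lt, (f'.monotone_comp hc).lt_iff_lt]

lemma chainModel_key (hc : StrictMono c) (f : LinExt α) {q : α} (hq : q ∈ offChain c) :
    (chainModel hc).key f q = offRank c f q := by
  simp [chainModel, hq]

lemma chainModel_tot_key (hc : StrictMono c) (f : LinExt α) {q : α} (hq : q ∈ offChain c) :
    (chainModel hc).tot f (range ((chainModel hc).key f q + 1)) = chainRank c f q := by
  rw [chainModel_key hc f hq]
  exact sum_slotMult_offRank f hq

lemma chainModel_tot_card (hc : StrictMono c) (f : LinExt α) :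
    (chainModel hc).tot f (range ((offChain c).card + 1)) = L :=
  sum_slotMult_card f

/-- The chain can be redistributed among the slots as long as the order relations between
chain and off-chain elements are respected. -/
lemma exists_linExt_of_slots (hc : StrictMono c) (f : LinExt α) (m : ℕ → ℕ)
    (hm : ∀ ν, (offChain c).card < ν → m ν = 0)
    (hL : ∑ ν ∈ range ((offChain c).card + 1), m ν = L)
    (hlow : ∀ q ∈ offChain c, ∀ l, c l < q → (l : ℕ) < ∑ ν ∈ range (offRank c f q + 1), m ν)
    (hup : ∀ q ∈ offChain c, ∀ l, q < c l → ∑ ν ∈ range (offRank c f q + 1), m ν ≤ l) :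
    ∃ f', (chainModel hc).key f' = (chainModel hc).key f ∧ (chainModel hc).mult f' = m := by
  classical
  set S : ℕ → ℕ := fun ν => ∑ μ ∈ range (ν + 1), m μ with hS
  have hSm : Monotone S := fun a b h => sum_le_sum_of_subset (range_subset_range.2 (by omega))
  let k : α → ℕ ×ₗ ℕ := fun x => if h : ∃ l, c l = x then toLex (2 * (h.choose : ℕ) + 1, 0)
    else toLex (2 * S (offRank c f x), offRank c f x)
  have kc : ∀ l, k (c l) = toLex (2 * (l : ℕ) + 1, 0) := by
    intro l
    have h : ∃ l', c l' = c l := ⟨l, rfl⟩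
    simp only [k, dif_pos h, hc.injective h.choose_spec]
  have kq : ∀ q ∈ offChain c, k q = toLex (2 * S (offRank c f q), offRank c f q) := by
    intro q hq
    have h : ¬ ∃ l, c l = q := fun ⟨l, hl⟩ => (mem_offChain c).1 hq l hl
    simp only [k, dif_neg h]
  have hcq : ∀ q ∈ offChain c, ∀ l, k (c l) < k q ↔ (l : ℕ) < S (offRank c f q) := by
    intro q hq l
    rw [kc, kq q hq, Prod.Lex.toLex_lt_toLex]
    simp only
    omega
  have hqc : ∀ q ∈ offChain c, ∀ l, k q < k (c l) ↔ S (offRank c f q) ≤ l := by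
    intro q hq l
    rw [kc, kq q hq, Prod.Lex.toLex_lt_toLex]
    simp only
    omega
  have hqq : ∀ q ∈ offChain c, ∀ q' ∈ offChain c,
      k q < k q' ↔ offRank c f q < offRank c f q' := by
    intro q hq q' hq'
    rw [kq q hq, kq q' hq', Prod.Lex.toLex_lt_toLex]
    simp only
    constructor
    · rintro (h | h)
      · by_contra h'
        have := hSm (not_lt.1 h')
        omega
      · exact h.2
    · intro h
      have := hSm h.le
      omega
  have hcc : ∀ l l', k (c l) < k (c l') ↔ l < l' := by
    intro l l'
    rw [kc, kc, Prod.Lex.toLex_lt_toLex]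
    simp only [Fin.lt_def]
    omega
  have hinj : Function.Injective k := by
    intro x y h
    have h1 := h.not_lt
    have h2 := h.symm.not_lt
    rcases mem_offChain_or (c := c) x with hx | ⟨l, rfl⟩ <;>
      rcases mem_offChain_or (c := c) y with hy | ⟨l', rfl⟩
    · rw [hqq x hx y hy] at h1
      rw [hqq y hy x hx] at h2
      exact offRank_injOn f hx hy (by omega)
    · rw [hqc x hx] at h1
      rw [hcq x hx] at h2
      omega
    · rw [hcq y hy] at h1
      rw [hqc y hy] at h2
      omega
    · rw [hcc] at h1
      rw [hcc] at h2
      rw [le_antisymm (not_lt.1 h2) (not_lt.1 h1)]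
  have hmono : StrictMono k := by
    intro x y h
    rcases mem_offChain_or (c := c) x with hx | ⟨l, rfl⟩ <;>
      rcases mem_offChain_or (c := c) y with hy | ⟨l', rfl⟩
    · rw [hqq x hx y hy, offRank_lt_iff hx]
      exact f.2 _ _ h
    · exact (hqc x hx l').2 (hup x hx l' h)
    · exact (hcq y hy l).2 (hlow y hy l h)
    · exact (hcc l l').2 (hc.lt_iff_lt.1 h)
  obtain ⟨f', hf'⟩ := LinExt.exists_of_key k hinj hmono
  have hrank : ∀ q ∈ offChain c, offRank c f' q = offRank c f q := by
    intro q hq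
    refine congrArg card (filter_congr fun q' hq' => ?_)
    rw [hf', hqq q' hq' q hq, offRank_lt_iff hq']
  refine ⟨f', ?_, ?_⟩
  · funext q
    simp only [chainModel]
    split_ifs with hq
    · exact hrank q hq
    · rfl
  have htot : ∀ ν, ∑ μ ∈ range (ν + 1), slotMult c f' μ = S ν := by
    intro ν
    rcases lt_or_ge ν (offChain c).card with hν | hν
    · obtain ⟨q, hq, rfl⟩ := exists_offRank_eq f' hν
      rw [sum_slotMult_offRank f' hq, chainRank, hrank q hq]
      simp only [hf', hcq q hq]
      rw [Fin.card_filter_val_lt, min_eq_right]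
      refine le_trans (hSm ?_) hL.le
      have := hrank q hq
      omega
    · have h0 : range ((offChain c).card + 1) ⊆ range (ν + 1) := range_subset_range.2 (by omega)
      rw [hS]
      simp only
      rw [← sum_subset h0, ← sum_subset h0, hL, sum_slotMult_card]
      · intro μ _ hμ
        exact hm μ (by simpa using hμ)
      · intro μ _ hμ
        exact slotMult_eq_zero f' (by simpa using hμ)
  funext ν
  change slotMult c f' ν = m ν
  cases ν with
  | zero => simpa [S] using htot 0
  | succ ν =>
    have h1 := htot (ν + 1)
    have h2 := htot ν
    simp only [S] at h1 h2
    rw [sum_range_succ, h2, sum_range_succ _ (ν + 1)] at h1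
    omega

lemma exists_isMove (hc : StrictMono c) (f : LinExt α) {a b : ℕ} (hab : a ≠ b)
    (ha : a ≤ (offChain c).card) (hb : 1 ≤ slotMult c f b)
    (hlow : ∀ q ∈ offChain c, ∀ l, c l < q →
      (l : ℕ) + (if b ≤ offRank c f q then 1 else 0) <
        chainRank c f q + (if a ≤ offRank c f q then 1 else 0))
    (hup : ∀ q ∈ offChain c, ∀ l, q < c l →
      chainRank c f q + (if a ≤ offRank c f q then 1 else 0) ≤
        l + (if b ≤ offRank c f q then 1 else 0)) :
    ∃ f', (chainModel hc).IsMove f f' a b := by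
  have hbM : b ≤ (offChain c).card := by
    by_contra h
    rw [slotMult_eq_zero f (not_le.1 h)] at hb
    omega
  let m : ℕ → ℕ := fun ν => slotMult c f ν + (if ν = a then 1 else 0) - (if ν = b then 1 else 0)
  have hm : ∀ ν, m ν + (if ν = b then 1 else 0) = slotMult c f ν + (if ν = a then 1 else 0) := by
    intro ν
    simp only [m]
    split_ifs with h1 h2 <;> subst_vars <;> omega
  have hsum : ∀ N, ∑ ν ∈ range (N + 1), m ν + (if b ≤ N then 1 else 0) =
      ∑ ν ∈ range (N + 1), slotMult c f ν + (if a ≤ N then 1 else 0) := by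
    intro N
    have : ∑ ν ∈ range (N + 1), (m ν + (if ν = b then 1 else 0)) =
      ∑ ν ∈ range (N + 1), (slotMult c f ν + (if ν = a then 1 else 0)) :=
      sum_congr rfl fun ν _ => hm ν
    simpa [sum_add_distrib, Nat.lt_succ_iff] using this
  suffices h : ∃ f', (chainModel hc).key f' = (chainModel hc).key f ∧
      (chainModel hc).mult f' = m by
    obtain ⟨f', h1, h2⟩ := h
    exact ⟨f', h1, fun ν => by rw [h2]; exact hm ν⟩
  refine exists_linExt_of_slots hc f m ?_ ?_ ?_ ?_
  · intro ν hν
    have := hm ν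
    simpa [slotMult_eq_zero f hν, show ν ≠ a by omega, show ν ≠ b by omega] using this
  · have := hsum (offChain c).card
    rw [if_pos hbM, if_pos ha, sum_slotMult_card] at this
    omega
  · intro q hq l hl
    have h1 := hsum (offRank c f q)
    have h2 := hlow q hq l hl
    rw [sum_slotMult_offRank f hq] at h1
    omega
  · intro q hq l hl
    have h1 := hsum (offRank c f q)
    have h2 := hup q hq l hl
    rw [sum_slotMult_offRank f hq] at h1
    omega

lemma chainModel_advances (hc : StrictMono c) (hfree : ∀ y l, y < c l → ∃ l', c l' = y) :
    (chainModel hc).Advances := by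
  intro f a b hab hb
  have hbM : b ≤ (offChain c).card := by
    by_contra h
    have : slotMult c f b = 0 := slotMult_eq_zero f (not_le.1 h)
    change 1 ≤ slotMult c f b at hb
    omega
  refine exists_isMove hc f hab.ne (by omega) hb ?_ ?_
  · intro q hq l hl
    have := (lt_chainRank_iff hc f q l).2 (f.2 _ _ hl)
    split_ifs <;> omega
  · intro q hq l hl
    obtain ⟨l', hl'⟩ := hfree q l hl
    exact absurd hl' ((mem_offChain c).1 hq l')

lemma chainModel_delays [DecidableLT α] [DecidableLE α] (hc : StrictMono c)
    (hlow : ∀ q ∈ offChain c, (univ.filter fun l => c l < q).card ≤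
      ((offChain c).filter fun q' => q' ≤ q).card) :
    (chainModel hc).Delays (offChain c).card := by
  classical
  intro f a b hab hb hba
  change b < slotMult c f a at hba
  refine exists_isMove hc f hab.ne' hb (by omega) ?_ ?_
  · intro q hq l hl
    have h1 := (lt_chainRank_iff hc f q l).2 (f.2 _ _ hl)
    rcases lt_or_ge (offRank c f q) a with h2 | h2
    · split_ifs <;> omega
    rcases le_or_gt b (offRank c f q) with h3 | h3
    · split_ifs <;> omega
    rw [if_pos h2, if_neg (by omega)]
    have h4 : slotMult c f a ≤ chainRank c f q := by
      rw [← sum_slotMult_offRank f hq]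
      exact single_le_sum (f := slotMult c f) (fun _ _ => Nat.zero_le _) (by simp; omega)
    have h5 : (l : ℕ) < (univ.filter fun l => c l < q).card :=
      (Fin.lt_card_filter_iff _ (fun i j hij h => (hc.monotone hij).trans_lt h) l).2 hl
    have h6 : ((offChain c).filter fun q' => q' ≤ q).card ≤ offRank c f q + 1 := by
      rw [offRank, ← card_insert_of_notMem (a := q)]
      · refine card_le_card fun y hy => ?_
        simp only [mem_filter, mem_insert] at hy ⊢
        rcases hy.2.eq_or_lt with h | h
        · exact Or.inl h
        · exact Or.inr ⟨hy.1, f.2 _ _ h⟩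
      · simp
    have := hlow q hq
    omega
  · intro q hq l hl
    have h1 : chainRank c f q ≤ l := by
      by_contra h
      exact lt_asymm ((lt_chainRank_iff hc f q l).1 (not_le.1 h)) (f.2 _ _ hl)
    split_ifs <;> omega

end ChainModel

lemma exists_mul_pow_sub_descFactorial_lt (n C : ℕ) :
    ∃ M : ℕ, C * (M ^ n - M.descFactorial n) < M.choose n := by
  set D : ℕ := C * n.factorial with hD
  set M : ℕ := (D + 1) * n ^ 2 + n + 1 with hM
  refine ⟨M, ?_⟩
  have hnM : n < M := by omega
  have hM0 : (0 : ℝ) < M := by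
    have : 0 < M := by omega
    exact_mod_cast this
  have hle : M.descFactorial n ≤ M ^ n := Nat.descFactorial_le_pow M n
  have h1 : (M : ℝ) ^ n * (1 - n * (n / M)) ≤ M.descFactorial n := by
    have h2 : ((M + 1 - n : ℕ) : ℝ) ^ n ≤ M.descFactorial n := by
      exact_mod_cast Nat.pow_sub_le_descFactorial M n
    have h3 : ((M : ℝ) - n) ^ n ≤ ((M + 1 - n : ℕ) : ℝ) ^ n := by
      have : (n : ℝ) < M := by exact_mod_cast hnM
      refine pow_le_pow_left₀ (by linarith) ?_ n
      rw [Nat.cast_sub (by omega)]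
      push_cast
      linarith
    have h4 := one_add_mul_le_pow (a := -((n : ℝ) / M)) (by
      have : (n : ℝ) / M ≤ 1 := by
        rw [div_le_one hM0]
        exact_mod_cast hnM.le
      linarith) n
    calc (M : ℝ) ^ n * (1 - n * (n / M)) = M ^ n * (1 + n * -((n : ℝ) / M)) := by ring
      _ ≤ M ^ n * (1 + -((n : ℝ) / M)) ^ n := by gcongr
      _ = ((M : ℝ) - n) ^ n := by
        rw [← mul_pow]
        congr 1
        field_simp
        ring
      _ ≤ _ := h3.trans h2
  have h5 : (D : ℝ) * ((M : ℝ) ^ n - M.descFactorial n) < M.descFactorial n := by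
    have h6 : ((D : ℝ) + 1) * (n * (n / M)) < 1 := by
      rw [← mul_div_assoc, ← mul_div_assoc, div_lt_one hM0]
      have : ((D + 1) * n ^ 2 : ℕ) < M := by omega
      have : (((D + 1) * n ^ 2 : ℕ) : ℝ) < M := by exact_mod_cast this
      push_cast at this
      linarith
    have h7 : (0 : ℝ) < (M : ℝ) ^ n := by positivity
    have h8 : (0 : ℝ) ≤ D := by positivity
    nlinarith [mul_lt_mul_of_pos_left h6 h7]
  have h9 : D * (M ^ n - M.descFactorial n) < M.descFactorial n := by
    have : (D : ℝ) * ((M ^ n - M.descFactorial n : ℕ) : ℝ) < M.descFactorial n := by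
      rw [Nat.cast_sub hle]
      exact_mod_cast h5
    exact_mod_cast this
  rw [Nat.descFactorial_eq_factorial_mul_choose, ← Nat.descFactorial_eq_factorial_mul_choose, hD,
    mul_comm C, mul_assoc] at h9
  exact Nat.lt_of_mul_lt_mul_left (h9.trans_eq (Nat.descFactorial_eq_factorial_mul_choose M n))

section Correlation
variable {α : Type*} [Fintype α] [PartialOrder α]

open Classical in
/-- the order-preserving maps to `Fin M` taking a larger value on `S` than at `z` -/
noncomputable def monotoneAbove (M : ℕ) (z : α) (S : Finset α) : Finset (α → Fin M) :=
  univ.filter fun h => Monotone h ∧ ∀ t ∈ S, h z < h t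

lemma card_monotoneAbove_mul_le [DecidableEq α] (M : ℕ) (z : α) (S T : Finset α) :
    (monotoneAbove M z S).card * (monotoneAbove M z T).card ≤
      (monotoneAbove M z ∅).card * (monotoneAbove M z (S ∪ T)).card := by
  classical
  let φ : (α → Fin M) → (α → ℤ) := fun h t => if t = z then -(h z : ℤ) else (h t : ℤ) - h z
  have hφz : ∀ h, φ h z = -(h z : ℤ) := fun h => by simp [φ]
  have hφ : ∀ h t, t ≠ z → φ h t = (h t : ℤ) - h z := fun h t ht => by simp [φ, ht]
  have hinj : Function.Injective φ := by
    intro h h' e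
    have ez := congrFun e z
    rw [hφz, hφz] at ez
    funext t
    by_cases ht : t = z
    · subst ht
      exact Fin.ext (by omega)
    · have et := congrFun e t
      rw [hφ h t ht, hφ h' t ht] at et
      exact Fin.ext (by omega)
  have lift : ∀ a : α → ℤ, (∀ t, 0 ≤ a t ∧ a t < M) → ∃ h : α → Fin M, ∀ t, (h t : ℤ) = a t := by
    intro a ha
    refine ⟨fun t => ⟨(a t).toNat, by have := ha t; omega⟩, fun t => ?_⟩
    have := ha t
    simp [this.1]
  rw [← card_image_of_injective _ hinj, ← card_image_of_injective _ hinj,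
    ← card_image_of_injective _ hinj, ← card_image_of_injective _ hinj]
  refine (le_card_infs_mul_card_sups _ _).trans (Nat.mul_le_mul (card_le_card ?_) (card_le_card ?_))
  · intro x hx
    obtain ⟨_, ha, _, hb, rfl⟩ := mem_infs.1 hx
    obtain ⟨h, hh, rfl⟩ := mem_image.1 ha
    obtain ⟨h', hh', rfl⟩ := mem_image.1 hb
    simp only [monotoneAbove, mem_filter, mem_univ, true_and] at hh hh'
    obtain ⟨k, hk⟩ := lift (fun t => max (h z : ℤ) (h' z) +
      min ((h t : ℤ) - h z) ((h' t : ℤ) - h' z)) (fun t => by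
        have := (h t).2; have := (h' t).2; have := (h z).2; have := (h' z).2
        omega)
    refine mem_image.2 ⟨k, ?_, ?_⟩
    · simp only [monotoneAbove, mem_filter, mem_univ, true_and]
      refine ⟨fun x y hxy => ?_, by simp⟩
      have h1 : (h x : ℕ) ≤ h y := hh.1 hxy
      have h2 : (h' x : ℕ) ≤ h' y := hh'.1 hxy
      have h3 := hk x
      have h4 := hk y
      exact Fin.le_def.2 (by omega)
    · funext t
      have h3 := hk z
      rw [Pi.inf_apply]
      by_cases ht : t = z
      · subst ht
        rw [hφz, hφz, hφz]
        omega
      · have h4 := hk t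
        rw [hφ _ _ ht, hφ _ _ ht, hφ _ _ ht]
        omega
  · intro x hx
    obtain ⟨_, ha, _, hb, rfl⟩ := mem_sups.1 hx
    obtain ⟨h, hh, rfl⟩ := mem_image.1 ha
    obtain ⟨h', hh', rfl⟩ := mem_image.1 hb
    simp only [monotoneAbove, mem_filter, mem_univ, true_and] at hh hh'
    obtain ⟨k, hk⟩ := lift (fun t => min (h z : ℤ) (h' z) +
      max ((h t : ℤ) - h z) ((h' t : ℤ) - h' z)) (fun t => by
        have := (h t).2; have := (h' t).2; have := (h z).2; have := (h' z).2
        omega)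
    refine mem_image.2 ⟨k, ?_, ?_⟩
    · simp only [monotoneAbove, mem_filter, mem_univ, true_and]
      refine ⟨fun x y hxy => ?_, fun t ht => ?_⟩
      · have h1 : (h x : ℕ) ≤ h y := hh.1 hxy
        have h2 : (h' x : ℕ) ≤ h' y := hh'.1 hxy
        have h3 := hk x
        have h4 := hk y
        exact Fin.le_def.2 (by omega)
      · have h3 := hk z
        have h4 := hk t
        rcases mem_union.1 ht with ht | ht
        · have h5 : (h z : ℕ) < h t := hh.2 t ht
          exact Fin.lt_def.2 (by omega)
        · have h5 : (h' z : ℕ) < h' t := hh'.2 t ht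
          exact Fin.lt_def.2 (by omega)
    · funext t
      have h3 := hk z
      rw [Pi.sup_apply]
      by_cases ht : t = z
      · subst ht
        rw [hφz, hφz, hφz]
        omega
      · have h4 := hk t
        rw [hφ _ _ ht, hφ _ _ ht, hφ _ _ ht]
        omega

lemma card_injective_monotoneAbove [DecidablePred (Function.Injective (α := α) (β := Fin M))]
    (z : α) (S : Finset α) :
    ((monotoneAbove M z S).filter Function.Injective).card =
      (univ.filter fun f : LinExt α => ∀ t ∈ S, f.1 z < f.1 t).card *
        M.choose (Fintype.card α) := by
  have hN : M.choose (Fintype.card α) =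
      Fintype.card {A : Finset (Fin M) // A.card = Fintype.card α} := by
    rw [Fintype.card_finset_len, Fintype.card_fin]
  suffices key : ((univ.filter fun f : LinExt α => ∀ t ∈ S, f.1 z < f.1 t) ×ˢ
      (univ : Finset {A : Finset (Fin M) // A.card = Fintype.card α})).card =
      ((monotoneAbove M z S).filter Function.Injective).card from
    key.symm.trans ((card_product _ _).trans (congrArg _ (card_univ.trans hN.symm)))
  classical
  let Φ : LinExt α × {A : Finset (Fin M) // A.card = Fintype.card α} → (α → Fin M) :=
    fun p x => p.2.1.orderEmbOfFin p.2.2 (p.1.1 x)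
  refine card_bij (fun p _ => Φ p) ?_ ?_ ?_
  · rintro ⟨f, A, hA⟩ hp
    simp only [mem_product, mem_filter, mem_univ, true_and, and_true] at hp
    simp only [monotoneAbove, mem_filter, mem_univ, true_and, Φ]
    refine ⟨⟨fun x y hxy => ?_, fun t ht => ?_⟩, fun x y hxy => ?_⟩
    · rcases hxy.eq_or_lt with rfl | h
      · exact le_rfl
      · exact (A.orderEmbOfFin hA).monotone (f.2 _ _ h).le
    · exact (A.orderEmbOfFin hA).strictMono (hp t ht)
    · exact f.1.injective ((A.orderEmbOfFin hA).injective hxy)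
  · rintro ⟨f, A, hA⟩ _ ⟨g, B, hB⟩ _ h
    have hr : ∀ (f : LinExt α) (A : Finset (Fin M)) (hA : A.card = Fintype.card α),
        (Set.range (Φ (f, ⟨A, hA⟩))) = A := by
      intro f A hA
      rw [← range_orderEmbOfFin A hA]
      exact f.1.surjective.range_comp (A.orderEmbOfFin hA)
    have hAB : A = B := by
      have h1 := hr f A hA
      have h2 := hr g B hB
      rw [h, h2] at h1
      exact (coe_injective h1).symm
    subst hAB
    have : f = g := Subtype.ext (Equiv.ext fun x =>
      (A.orderEmbOfFin hA).injective (congrFun h x))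
    rw [this]
  · intro h hh
    simp only [monotoneAbove, mem_filter, mem_univ, true_and] at hh
    obtain ⟨⟨hm, hS⟩, hi⟩ := hh
    obtain ⟨f, hf⟩ := LinExt.exists_of_key h hi (hm.strictMono_of_injective hi)
    have hA : (univ.image h).card = Fintype.card α := by
      rw [card_image_of_injective _ hi, card_univ]
    refine ⟨(f, ⟨univ.image h, hA⟩), ?_, ?_⟩
    · simp only [mem_product, mem_filter, mem_univ, true_and, and_true]
      exact fun t ht => (hf z t).2 (hS t ht)
    · have := orderEmbOfFin_unique hA (f := h ∘ f.1.symm) (fun x => by simp)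
        (fun a b hab => by
          have := (hf (f.1.symm a) (f.1.symm b)).1 (by simpa using hab)
          simpa using this)
      funext x
      have := congrFun this (f.1 x)
      simpa [Φ] using this.symm

lemma card_not_injective_monotoneAbove [DecidablePred (Function.Injective (α := α) (β := Fin M))]
    (z : α) (S : Finset α) :
    ((monotoneAbove M z S).filter fun h => ¬ Function.Injective h).card ≤
      M ^ Fintype.card α - M.descFactorial (Fintype.card α) := by
  classical
  have h1 : (univ.filter fun h : α → Fin M => Function.Injective h).card =
      M.descFactorial (Fintype.card α) := by
    rw [← Fintype.card_subtype, ← Fintype.card_congr (Equiv.subtypeInjectiveEquivEmbedding _ _).symm,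
      Fintype.card_embedding_eq, Fintype.card_fin]
  have h2 := card_filter_add_card_filter_not (s := (univ : Finset (α → Fin M))) Function.Injective
  rw [h1, card_univ, Fintype.card_fun, Fintype.card_fin] at h2
  have h3 : ((monotoneAbove M z S).filter fun h => ¬ Function.Injective h).card ≤
      (univ.filter fun h : α → Fin M => ¬ Function.Injective h).card :=
    card_le_card (filter_subset_filter _ (subset_univ _))
  omega

/-- The events that `z` precedes the elements of given sets are positively correlated. -/
theorem LinExt.card_precedes_mul_le [DecidableEq α] (z : α) (S T : Finset α) :
    (univ.filter fun f : LinExt α => ∀ t ∈ S, f.1 z < f.1 t).card *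
        (univ.filter fun f : LinExt α => ∀ t ∈ T, f.1 z < f.1 t).card ≤
      Fintype.card (LinExt α) *
        (univ.filter fun f : LinExt α => ∀ t ∈ S ∪ T, f.1 z < f.1 t).card := by
  obtain ⟨F, hF⟩ : ∃ F : Finset α → ℕ, ∀ U,
      (univ.filter fun f : LinExt α => ∀ t ∈ U, f.1 z < f.1 t).card = F U := ⟨_, fun _ => rfl⟩
  have h0 : Fintype.card (LinExt α) = F ∅ := by simp [← hF]
  simp only [hF, h0]
  obtain ⟨M, hM⟩ := exists_mul_pow_sub_descFactorial_lt (Fintype.card α) (F ∅ + F (S ∪ T) + 1)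
  have hlow : ∀ U, F U * M.choose (Fintype.card α) ≤ (monotoneAbove M z U).card := by
    classical
    intro U
    have : ((monotoneAbove M z U).filter Function.Injective).card =
        F U * M.choose (Fintype.card α) := by
      rw [← hF]
      convert card_injective_monotoneAbove (M := M) z U
    rw [← this]
    exact card_filter_le _ _
  have hupp : ∀ U, (monotoneAbove M z U).card ≤ F U * M.choose (Fintype.card α) +
      (M ^ Fintype.card α - M.descFactorial (Fintype.card α)) := by
    classical
    intro U
    have : ((monotoneAbove M z U).filter Function.Injective).card =
        F U * M.choose (Fintype.card α) := by
      rw [← hF]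
      convert card_injective_monotoneAbove (M := M) z U
    rw [← this, ← card_filter_add_card_filter_not (s := monotoneAbove M z U) Function.Injective]
    exact Nat.add_le_add_left (card_not_injective_monotoneAbove z U) _
  have h2 := (Nat.mul_le_mul (hlow S) (hlow T)).trans
    ((card_monotoneAbove_mul_le M z S T).trans (Nat.mul_le_mul (hupp ∅) (hupp (S ∪ T))))
  generalize F ∅ = e at *
  generalize F S = a at *
  generalize F T = b at *
  generalize F (S ∪ T) = e' at *
  generalize M.choose (Fintype.card α) = x at *
  generalize M ^ Fintype.card α - M.descFactorial (Fintype.card α) = y at *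
  by_contra! h
  have h3 : (e * e' + 1) * (x * x) ≤ a * b * (x * x) := Nat.mul_le_mul_right _ h
  have hyx : y ≤ x := by nlinarith
  nlinarith [Nat.mul_le_mul_right x hM.le, Nat.mul_le_mul_left y hyx]

theorem LinExt.card_le_two_pow_mul [DecidableEq α] (z : α) (T : Finset α)
    (h : ∀ t ∈ T, Fintype.card (LinExt α) ≤
      2 * (univ.filter fun f : LinExt α => f.1 z < f.1 t).card) :
    Fintype.card (LinExt α) ≤
      2 ^ T.card * (univ.filter fun f : LinExt α => ∀ t ∈ T, f.1 z < f.1 t).card := by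
  induction T using Finset.induction_on with
  | empty => simp
  | insert t T ht ih =>
    have h1 := ih fun s hs => h s (mem_insert_of_mem hs)
    have h2 := h t (mem_insert_self t T)
    have h3 := LinExt.card_precedes_mul_le z {t} T
    simp only [mem_singleton, forall_eq] at h3
    rw [singleton_union] at h3
    have h4 : 0 < Fintype.card (LinExt α) := Fintype.card_pos
    rw [card_insert_of_notMem ht, pow_succ]
    refine Nat.le_of_mul_le_mul_left ?_ h4
    calc _ ≤ _ := Nat.mul_le_mul h2 h1
      _ = 2 ^ T.card * 2 * ((univ.filter fun f : LinExt α => f.1 z < f.1 t).card *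
          (univ.filter fun f : LinExt α => ∀ t ∈ T, f.1 z < f.1 t).card) := by ring
      _ ≤ _ := Nat.mul_le_mul_left _ h3
      _ = _ := by ring

end Correlation

lemma exists_balanced_level {Ω : Type*} [Fintype Ω] [Nonempty Ω] (D : Ω → ℕ) {ε τ : ℝ} {K A : ℕ}
    (hε : 0 < ε) (hA : 2 ≤ A * ε) (hτ : A * τ ≤ ε / 2)
    (hK : Fintype.card Ω ≤ 2 * (univ.filter fun f => D f ≤ K).card)
    (hstep : ∀ k ≤ K + A, ((univ.filter fun f => D f = k).card : ℝ) - τ * Fintype.card Ω ≤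
      (univ.filter fun f => D f = k + 1).card) :
    ∃ k ≤ K, (1 / 2 - ε) * Fintype.card Ω < (univ.filter fun f => D f ≤ k).card ∧
      ((univ.filter fun f => D f ≤ k).card : ℝ) < (1 / 2 + ε) * Fintype.card Ω := by
  classical
  have hex : ∃ k, Fintype.card Ω ≤ 2 * (univ.filter fun f => D f ≤ k).card := ⟨K, hK⟩
  set k := Nat.find hex with hk
  have hkK : k ≤ K := Nat.find_min' hex hK
  have hΩ : (0 : ℝ) < Fintype.card Ω := by exact_mod_cast Fintype.card_pos
  have h1 : (Fintype.card Ω : ℝ) ≤ 2 * (univ.filter fun f => D f ≤ k).card := by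
    exact_mod_cast Nat.find_spec hex
  refine ⟨k, hkK, by nlinarith, ?_⟩
  by_contra! h2
  have h3 : ε * Fintype.card Ω ≤ (univ.filter fun f => D f = k).card := by
    rcases Nat.eq_zero_or_pos k with h0 | h0
    · rw [h0] at h2 ⊢
      simp only [Nat.le_zero] at h2
      nlinarith
    · have h4 := Nat.find_min hex (Nat.sub_lt h0 one_pos)
      have h5 : ((2 * (univ.filter fun f => D f ≤ k - 1).card : ℕ) : ℝ) < Fintype.card Ω := by
        exact_mod_cast not_le.1 h4
      have h6 : (univ.filter fun f => D f ≤ k).card ≤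
          (univ.filter fun f => D f ≤ k - 1).card + (univ.filter fun f => D f = k).card := by
        rw [← card_union_of_disjoint (disjoint_filter.2 fun f _ _ _ => by omega)]
        refine card_le_card fun f => ?_
        simp only [mem_union, mem_filter, mem_univ, true_and]
        omega
      have h7 : ((univ.filter fun f => D f ≤ k).card : ℝ) ≤
          (univ.filter fun f => D f ≤ k - 1).card + (univ.filter fun f => D f = k).card := by
        exact_mod_cast h6
      push_cast at h5
      nlinarith
  have h8 : ∀ i : ℕ, i ≤ A → (ε - i * τ) * Fintype.card Ω ≤
      (univ.filter fun f => D f = k + i).card := by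
    intro i
    induction i with
    | zero => intro _; simpa using h3
    | succ i ih =>
      intro hi
      have h9 := ih (by omega)
      have h10 := hstep (k + i) (by omega)
      rw [← add_assoc]
      push_cast
      linarith
  have hτ' : ∀ i : ℕ, i ≤ A → (i : ℝ) * τ ≤ ε / 2 := by
    intro i hi
    rcases le_total 0 τ with h | h
    · exact (mul_le_mul_of_nonneg_right (by exact_mod_cast hi) h).trans hτ
    · exact (mul_nonpos_of_nonneg_of_nonpos (by positivity) h).trans (by positivity)
  have h11 : ∀ j ∈ Ico k (k + A + 1), ε / 2 * Fintype.card Ω ≤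
      (univ.filter fun f => D f = j).card := by
    intro j hj
    obtain ⟨hj1, hj2⟩ := mem_Ico.1 hj
    obtain ⟨i, rfl⟩ := Nat.exists_eq_add_of_le hj1
    have := hτ' i (by omega)
    refine le_trans ?_ (h8 i (by omega))
    gcongr
    linarith
  have h12 := sum_le_sum h11
  have h13 : ∑ j ∈ Ico k (k + A + 1), (univ.filter fun f => D f = j).card ≤ Fintype.card Ω := by
    rw [sum_card_fiberwise_eq_card_filter]
    exact card_filter_le _ _
  have h14 : ∑ j ∈ Ico k (k + A + 1), ((univ.filter fun f => D f = j).card : ℝ) ≤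
      Fintype.card Ω := by exact_mod_cast h13
  rw [sum_const, Nat.card_Ico, nsmul_eq_mul, show k + A + 1 - k = A + 1 by omega] at h12
  push_cast at h12
  nlinarith [mul_pos hε hΩ]

section Probability
variable {α : Type} [Fintype α] [PartialOrder α]

lemma prLT_eq (x y : α) :
    prLT x y = (univ.filter fun f : LinExt α => f.1 x < f.1 y).card / Fintype.card (LinExt α) := by
  unfold prLT Pr _root_.val
  rw [Nat.card_eq_fintype_card, Nat.card_eq_fintype_card, Fintype.card_subtype]
  simp only [add_lt_add_iff_right, Fin.val_fin_lt]

lemma prLT_add_prLT {x y : α} (h : x ≠ y) : prLT x y + prLT y x = 1 := by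
  have h0 : (0 : ℝ) < Fintype.card (LinExt α) := by exact_mod_cast Fintype.card_pos
  rw [prLT_eq, prLT_eq, ← add_div, div_eq_one_iff_eq h0.ne']
  have h1 := card_filter_add_card_filter_not (s := (univ : Finset (LinExt α)))
    (fun f => f.1 x < f.1 y)
  have h2 : (univ.filter fun f : LinExt α => ¬ f.1 x < f.1 y) =
      univ.filter fun f : LinExt α => f.1 y < f.1 x := by
    refine filter_congr fun f _ => ?_
    have := f.1.injective.ne h
    rw [not_lt]
    exact ⟨fun h => lt_of_le_of_ne h this.symm, le_of_lt⟩
  rw [h2, card_univ] at h1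
  exact_mod_cast h1

lemma lt_min_prLT {x y : α} (h : x ≠ y) {ε : ℝ}
    (h1 : (1 / 2 - ε) * Fintype.card (LinExt α) <
      (univ.filter fun f : LinExt α => f.1 x < f.1 y).card)
    (h2 : ((univ.filter fun f : LinExt α => f.1 x < f.1 y).card : ℝ) <
      (1 / 2 + ε) * Fintype.card (LinExt α)) :
    1 / 2 - ε < min (prLT x y) (prLT y x) := by
  have h0 : (0 : ℝ) < Fintype.card (LinExt α) := by exact_mod_cast Fintype.card_pos
  have h3 := prLT_add_prLT h
  rw [← lt_div_iff₀ h0, ← prLT_eq] at h1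
  rw [← div_lt_iff₀ h0, ← prLT_eq] at h2
  exact lt_min h1 (by linarith)

lemma exists_balanced_of_level_step {L : ℕ} {c : Fin L → α} (hc : StrictMono c) {x : α}
    (hx : x ∈ offChain c) {ε τ : ℝ} {K A : ℕ} (hKL : K < L)
    (hε : 0 < ε) (hA : 2 ≤ A * ε) (hτ : A * τ ≤ ε / 2)
    (hK : Fintype.card (LinExt α) ≤
      2 * (univ.filter fun f : LinExt α => f.1 x < f.1 (c ⟨K, hKL⟩)).card)
    (hstep : ∀ k ≤ K + A,
      ((univ.filter fun f : LinExt α => chainRank c f x = k).card : ℝ) -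
        τ * Fintype.card (LinExt α) ≤
      (univ.filter fun f : LinExt α => chainRank c f x = k + 1).card) :
    ∃ x y : α, x ≠ y ∧ 1 / 2 - ε < min (prLT x y) (prLT y x) := by
  have hiff : ∀ k (hk : k < L) (f : LinExt α), chainRank c f x ≤ k ↔ f.1 x < f.1 (c ⟨k, hk⟩) := by
    intro k hk f
    have h1 := lt_chainRank_iff hc f x ⟨k, hk⟩
    have h2 := f.1.injective.ne ((mem_offChain c).1 hx ⟨k, hk⟩)
    rw [← not_lt, h1, not_lt]
    exact ⟨fun h => lt_of_le_of_ne h h2.symm, le_of_lt⟩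
  obtain ⟨k, hk, h1, h2⟩ := exists_balanced_level (fun f : LinExt α => chainRank c f x) hε hA hτ
    (by simpa only [hiff K hKL] using hK) hstep
  simp only [hiff k (by omega)] at h1 h2
  exact ⟨x, c ⟨k, by omega⟩, ((mem_offChain c).1 hx _).symm, lt_min_prLT
    ((mem_offChain c).1 hx _).symm h1 h2⟩

end Probability

section ChainPoset
variable {α : Type} [PartialOrder α]

lemma exists_rank_function (Q : Finset α) :
    ∃ g : α → ℕ, (∀ x ∈ Q, ∀ y ∈ Q, x < y → g x < g y) ∧
      ∀ x ∈ Q, ∀ n < g x, ∃ y ∈ Q, y < x ∧ g y = n := by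
  classical
  let g : α → ℕ := fun x => if h : x ∈ Q then (Order.height (⟨x, h⟩ : Q)).toNat else 0
  have hfin : ∀ x : Q, Order.height x < ⊤ := by
    intro x
    refine lt_of_le_of_lt (b := (Fintype.card Q : ℕ∞)) (Order.height_le fun p _ => ?_)
      (ENat.natCast_lt_top _)
    exact_mod_cast p.length_lt_card.le
  have hg : ∀ x (h : x ∈ Q), (g x : ℕ∞) = Order.height (⟨x, h⟩ : Q) := by
    intro x h
    simp only [g, dif_pos h]
    exact ENat.natCast_toNat (hfin _).ne
  refine ⟨g, fun x hx y hy hxy => ?_, fun x hx n hn => ?_⟩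
  · have := Order.height_strictMono (show (⟨x, hx⟩ : Q) < ⟨y, hy⟩ from hxy) (hfin _)
    rw [← hg, ← hg] at this
    exact_mod_cast this
  · have hn' : (n : ℕ∞) < Order.height (⟨x, hx⟩ : Q) := by
      rw [← hg]
      exact_mod_cast hn
    obtain ⟨⟨y, hy⟩, hyx, h⟩ := (Order.coe_lt_height_iff (hfin _)).1 hn'
    refine ⟨y, hy, hyx, ?_⟩
    rw [← hg] at h
    exact_mod_cast h

lemma exists_chain_of_rank {Q : Finset α} {g : α → ℕ}
    (hg : ∀ x ∈ Q, ∀ n < g x, ∃ y ∈ Q, y < x ∧ g y = n) (n : ℕ) :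
    ∀ x ∈ Q, g x = n →
      ∃ p : ℕ → α, p n = x ∧ (∀ i ≤ n, p i ∈ Q) ∧ ∀ i < n, p i < p (i + 1) := by
  induction n with
  | zero =>
    intro x hx _
    exact ⟨fun _ => x, rfl, fun _ _ => hx, fun _ h => absurd h (by omega)⟩
  | succ n ih =>
    intro x hx hgx
    obtain ⟨y, hy, hyx, hgy⟩ := hg x hx n (by omega)
    obtain ⟨p, hpn, hpQ, hp⟩ := ih y hy hgy
    refine ⟨fun i => if i ≤ n then p i else x, by simp, fun i _ => ?_, fun i hi => ?_⟩
    · dsimp only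
      split_ifs with h
      exacts [hpQ i h, hx]
    · dsimp only
      rcases Nat.lt_succ_iff_lt_or_eq.1 hi with h | rfl
      · rw [if_pos h.le, if_pos (Nat.succ_le_of_lt h)]
        exact hp i h
      · rw [if_pos le_rfl, if_neg (by omega), hpn]
        exact hyx

lemma card_rank_lt_le {Q : Finset α} {g : α → ℕ} (hg : ∀ x ∈ Q, ∀ y ∈ Q, x < y → g x < g y)
    {w : ℕ} (hw : ∀ A : Finset α, IsAntichain (· ≤ ·) (A : Set α) → A.card ≤ w) (h : ℕ) :
    (Q.filter fun x => g x < h).card ≤ w * h := by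
  have h1 : (Q.filter fun x => g x < h).card = ∑ i ∈ range h, (Q.filter fun x => g x = i).card := by
    rw [sum_card_fiberwise_eq_card_filter]
    simp only [mem_range]
  rw [h1, mul_comm]
  refine (sum_le_card_nsmul _ _ w fun i _ => hw _ ?_).trans (by simp)
  intro x hx y hy hne hle
  simp only [coe_filter, Set.mem_ofPred_eq] at hx hy
  have := hg x hx.1 y hy.1 (lt_of_le_of_ne hle hne)
  omega

variable [Fintype α] {Lt : ℕ} {c : Fin Lt → α}

/-- If a chain element precedes all off-chain elements of rank `h`, then many chain elements
occupy the first few slots. -/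
lemma lt_tot_front (hc : StrictMono c) {g : α → ℕ}
    (hg : ∀ x ∈ offChain c, ∀ y ∈ offChain c, x < y → g x < g y)
    (hg' : ∀ x ∈ offChain c, ∀ n < g x, ∃ y ∈ offChain c, y < x ∧ g y = n)
    {w : ℕ} (hw : ∀ A : Finset α, IsAntichain (· ≤ ·) (A : Set α) → A.card ≤ w) {h : ℕ}
    (hcard : w * h < (offChain c).card) (f : LinExt α) (K : Fin Lt)
    (hf : ∀ t ∈ offChain c, g t = h → f.1 (c K) < f.1 t) :
    (K : ℕ) < (chainModel hc).tot f (range (w * h + 1)) := by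
  classical
  have hlt := card_rank_lt_le hg hw h
  have hne : ((offChain c).filter fun x => h ≤ g x).Nonempty := by
    rw [← card_pos]
    have := card_filter_add_card_filter_not (s := offChain c) (fun x => g x < h)
    simp only [not_lt] at this
    omega
  obtain ⟨q, hq, hmin⟩ := exists_min_image _ (fun x => f.1 x) hne
  simp only [mem_filter, and_imp] at hq hmin
  have hgq : g q = h := by
    by_contra hgq
    obtain ⟨y, hy, hyq, hgy⟩ := hg' q hq.1 h (by omega)
    exact absurd (hmin y hy hgy.ge) (not_le.2 (f.2 _ _ hyq))
  have hrank : offRank c f q ≤ w * h := by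
    refine le_trans (card_le_card fun x hx => ?_) hlt
    simp only [mem_filter] at hx ⊢
    refine ⟨hx.1, ?_⟩
    by_contra hgx
    exact absurd (hmin x hx.1 (by omega)) (not_le.2 hx.2)
  have h1 := (lt_chainRank_iff hc f q K).2 (hf q hq.1 hgq)
  rw [← chainModel_tot_key hc f hq.1, chainModel_key hc f hq.1] at h1
  refine h1.trans_le (sum_le_sum_of_subset (range_subset_range.2 (by omega)))

lemma exists_precedes {w : ℕ} (z : α) (T : Finset α) (hT : T.card ≤ w) (hz : z ∉ T)
    (h : 2 ^ w * (univ.filter fun f : LinExt α => ∀ t ∈ T, f.1 z < f.1 t).card <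
      Fintype.card (LinExt α)) :
    ∃ t ∈ T, Fintype.card (LinExt α) ≤
      2 * (univ.filter fun f : LinExt α => f.1 t < f.1 z).card := by
  classical
  by_contra! hcon
  have h1 := LinExt.card_le_two_pow_mul z T fun t ht => by
    have h2 := hcon t ht
    have h3 := card_filter_add_card_filter_not (s := (univ : Finset (LinExt α)))
      (fun f => f.1 t < f.1 z)
    have h4 : (univ.filter fun f : LinExt α => ¬ f.1 t < f.1 z) =
        univ.filter fun f : LinExt α => f.1 z < f.1 t := by
      refine filter_congr fun f _ => ?_
      have := f.1.injective.ne (show t ≠ z by rintro rfl; exact hz ht)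
      rw [not_lt]
      exact ⟨fun h => lt_of_le_of_ne h this.symm, le_of_lt⟩
    rw [h4, card_univ] at h3
    omega
  have h5 := Nat.mul_le_mul_right
    (univ.filter fun f : LinExt α => ∀ t ∈ T, f.1 z < f.1 t).card
    (Nat.pow_le_pow_right (n := 2) (by norm_num) hT)
  refine not_le.2 h ((h1.trans h5).trans_eq ?_)
  congr!

lemma exists_rank_precedes (hc : StrictMono c) {g : α → ℕ}
    (hg : ∀ x ∈ offChain c, ∀ y ∈ offChain c, x < y → g x < g y)
    (hg' : ∀ x ∈ offChain c, ∀ n < g x, ∃ y ∈ offChain c, y < x ∧ g y = n)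
    {w : ℕ} (hw : ∀ A : Finset α, IsAntichain (· ≤ ·) (A : Set α) → A.card ≤ w) {h : ℕ}
    (hcard : w * h < (offChain c).card) (K : Fin Lt)
    (hK : 2 ^ w * (univ.filter fun f : LinExt α =>
      (K : ℕ) < (chainModel hc).tot f (range (w * h + 1))).card < Fintype.card (LinExt α)) :
    ∃ t ∈ offChain c, g t = h ∧ Fintype.card (LinExt α) ≤
      2 * (univ.filter fun f : LinExt α => f.1 t < f.1 (c K)).card := by
  have hT : ((offChain c).filter fun x => g x = h).card ≤ w := by
    refine hw _ fun x hx y hy hne hle => ?_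
    simp only [coe_filter, Set.mem_ofPred_eq] at hx hy
    have := hg x hx.1 y hy.1 (lt_of_le_of_ne hle hne)
    omega
  obtain ⟨t, ht, h1⟩ := exists_precedes (c K) _ hT
    (fun h => (mem_offChain c).1 (mem_filter.1 h).1 K rfl) (by
      refine lt_of_le_of_lt (Nat.mul_le_mul_left _ (card_le_card fun f hf => ?_)) hK
      simp only [mem_filter, mem_univ, true_and] at hf ⊢
      exact lt_tot_front hc hg hg' hw hcard f K fun t ht hgt => hf t ⟨ht, hgt⟩)
  exact ⟨t, (mem_filter.1 ht).1, (mem_filter.1 ht).2, h1⟩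

end ChainPoset

section ChainTheorem

open Classical in
lemma exists_rank_precedes_of_many (w h : ℕ) {κ₀ : ℝ} (hκ₀ : 0 < κ₀) :
    ∃ M N : ℕ, ∀ {α : Type} [Fintype α] [PartialOrder α] {Lt : ℕ} {c : Fin Lt → α},
      StrictMono c →
      (∀ q ∈ offChain c, (univ.filter fun l => c l < q).card ≤
        ((offChain c).filter fun q' => q' ≤ q).card) →
      (∀ A : Finset α, IsAntichain (· ≤ ·) (A : Set α) → A.card ≤ w) →
      ∀ g : α → ℕ, (∀ x ∈ offChain c, ∀ y ∈ offChain c, x < y → g x < g y) →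
      (∀ x ∈ offChain c, ∀ n < g x, ∃ y ∈ offChain c, y < x ∧ g y = n) →
      M ≤ (offChain c).card → ∀ K : Fin Lt, N ≤ (K : ℕ) → κ₀ * Lt ≤ 2 * (K : ℕ) →
      ∃ t ∈ offChain c, g t = h ∧ Fintype.card (LinExt α) ≤
        2 * (univ.filter fun f : LinExt α => f.1 t < f.1 (c K)).card := by
  set r : ℕ := w * h + 1 with hr
  obtain ⟨l, hl⟩ := exists_nat_ge (4 * r * (2 / κ₀ + 1) * (r * 2 ^ w))
  refine ⟨r + l + 1, 4 * r * (r + l + 1), ?_⟩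
  intro α _ _ Lt c hc hlow hw g hg hg' hM K hN hκK
  refine exists_rank_precedes hc hg hg' hw (by omega) K ?_
  set v : ℕ := (K : ℕ) / (2 * r) with hv
  have hr0 : 0 < r := Nat.succ_pos _
  have hvK : r * (2 * v) ≤ K := by
    rw [← mul_assoc, mul_comm r 2]
    exact Nat.mul_div_le _ _
  have hKv : (K : ℕ) < 2 * r * (v + 1) := Nat.lt_mul_div_succ _ (by omega)
  have hrv : r + (l + 1) ≤ v := by
    rw [hv, Nat.le_div_iff_mul_le (by omega)]
    nlinarith
  have h1 := SlotModel.card_front_heavy (chainModel hc) (chainModel_delays hc hlow) (N := Lt)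
    (r := r) (ℓ := l + 1) (v := v) (fun f I => by
      refine le_trans ?_ (chainModel_tot_card hc f).le
      refine (sum_le_sum_of_ne_zero fun ν _ hν => ?_)
      by_contra hν'
      exact hν (slotMult_eq_zero f (by simpa using hν'))) (by omega) (by omega) hrv
  have h2 : (univ.filter fun f : LinExt α =>
      (K : ℕ) < (chainModel hc).tot f (range (w * h + 1))).card ≤
      (univ.filter fun f : LinExt α => r * (2 * v) < (chainModel hc).tot f (range r)).card :=
    card_le_card fun f hf => by
      simp only [mem_filter, mem_univ, true_and] at hf ⊢
      exact hvK.trans_lt hf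
  refine lt_of_le_of_lt (Nat.mul_le_mul_left _ h2) ?_
  generalize (univ.filter fun f : LinExt α =>
    r * (2 * v) < (chainModel hc).tot f (range r)).card = S at h1
  have hΩ : 0 < Fintype.card (LinExt α) := Fintype.card_pos
  have hrR : (1 : ℝ) ≤ r := by exact_mod_cast hr0
  have hK0 : (1 : ℝ) ≤ (K : ℕ) := by
    have : 1 ≤ (K : ℕ) := by nlinarith
    exact_mod_cast this
  have hLt : (Lt : ℝ) + 1 ≤ (2 / κ₀ + 1) * (K : ℕ) := by
    have : (Lt : ℝ) ≤ 2 / κ₀ * (K : ℕ) := by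
      rw [div_mul_eq_mul_div, le_div_iff₀ hκ₀]
      linarith
    linarith
  have hKv' : ((K : ℕ) : ℝ) ≤ 4 * r * v := by
    have : (K : ℕ) ≤ 4 * r * v := by nlinarith
    exact_mod_cast this
  have h3 : (r : ℝ) * 2 ^ w ≤ v * (((l + 1 : ℕ) - 1) / (Lt + 1)) := by
    rw [← mul_div_assoc, le_div_iff₀ (by positivity)]
    push_cast
    rw [add_sub_cancel_right]
    have hp : (0 : ℝ) ≤ r * 2 ^ w := by positivity
    have hq : (0 : ℝ) < 2 / κ₀ + 1 := by positivity
    calc (r : ℝ) * 2 ^ w * (Lt + 1) ≤ r * 2 ^ w * ((2 / κ₀ + 1) * (4 * r * v)) := by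
          refine mul_le_mul_of_nonneg_left (hLt.trans ?_) hp
          exact mul_le_mul_of_nonneg_left hKv' hq.le
      _ = v * (4 * r * (2 / κ₀ + 1) * (r * 2 ^ w)) := by ring
      _ ≤ v * l := mul_le_mul_of_nonneg_left hl (by positivity)
  have h4 : (r : ℝ) * (2 ^ w * S) + S ≤ r * Fintype.card (LinExt α) := by
    have := mul_le_mul_of_nonneg_right h3 (Nat.cast_nonneg (α := ℝ) S)
    linarith
  rcases Nat.eq_zero_or_pos S with h5 | h5
  · simpa [h5] using hΩ
  · have h6 : r * (2 ^ w * S) + S ≤ r * Fintype.card (LinExt α) := by exact_mod_cast h4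
    exact Nat.lt_of_mul_lt_mul_left (a := r) (by omega)

variable {α : Type} [Fintype α] [PartialOrder α] {Lt : ℕ} {c : Fin Lt → α}

open Classical in
lemma exists_rank_zero_precedes (hc : StrictMono c)
    (hlow : ∀ q ∈ offChain c, (univ.filter fun l => c l < q).card ≤
      ((offChain c).filter fun q' => q' ≤ q).card)
    {w : ℕ} (hw : ∀ A : Finset α, IsAntichain (· ≤ ·) (A : Set α) → A.card ≤ w)
    {g : α → ℕ} (hg : ∀ x ∈ offChain c, ∀ y ∈ offChain c, x < y → g x < g y)
    (hg' : ∀ x ∈ offChain c, ∀ n < g x, ∃ y ∈ offChain c, y < x ∧ g y = n)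
    (hne : (offChain c).Nonempty) {L : ℕ}
    (hL : ∀ h : L < Lt, ∃ y ∈ offChain c, y < c ⟨L, h⟩) (K : Fin Lt) (hKL : (K : ℕ) ≤ L)
    (hK : 2 ^ w * (L - K) + 1 < (K : ℕ)) :
    ∃ t ∈ offChain c, g t = 0 ∧ Fintype.card (LinExt α) ≤
      2 * (univ.filter fun f : LinExt α => f.1 t < f.1 (c K)).card := by
  have hΩ : 0 < Fintype.card (LinExt α) := Fintype.card_pos
  refine exists_rank_precedes hc hg hg' hw (by simpa using hne) K ?_
  have h1 := SlotModel.card_first_slot_heavy (chainModel hc) (chainModel_delays hc hlow)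
    (card_pos.2 hne) hKL (fun f => by
      change (univ.filter fun l => offRank c f (c l) = 0).card ≤ L
      refine (card_le_card_of_injOn (t := range L) (fun l : Fin Lt => (l : ℕ)) (fun l hl => ?_)
        Fin.val_injective.injOn).trans_eq (card_range L)
      simp only [coe_filter, mem_univ, true_and, Set.mem_ofPred_eq] at hl
      rw [coe_range, Set.mem_Iio]
      by_contra! hlL
      obtain ⟨y, hy, hyc⟩ := hL (hlL.trans_lt l.2)
      have h2 : y < c l := hyc.trans_le (hc.monotone (Fin.le_def.2 hlL))
      rw [offRank, card_eq_zero] at hl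
      exact notMem_empty y (hl ▸ mem_filter.2 ⟨hy, f.2 _ _ h2⟩))
  have h3 : ∀ f, (chainModel hc).tot f (range (w * 0 + 1)) = (chainModel hc).mult f 0 := fun f => by
    simp [SlotModel.tot]
  simp only [h3]
  generalize (univ.filter fun f : LinExt α => (K : ℕ) < (chainModel hc).mult f 0).card = S at *
  by_contra! h4
  have h5 : ((K : ℕ) - 1) * S ≤ (L - K) * Fintype.card (LinExt α) := by
    have : (((K : ℕ) - 1 : ℕ) : ℝ) * S ≤ ((L - K : ℕ) : ℝ) * Fintype.card (LinExt α) := by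
      rw [Nat.cast_sub hKL, Nat.cast_sub (by omega)]
      simpa using h1
    exact_mod_cast this
  have h6 := Nat.mul_le_mul_left ((K : ℕ) - 1) h4
  have h7 := Nat.mul_le_mul_left (2 ^ w) h5
  have h8 : (2 ^ w * (L - K) + 1) * Fintype.card (LinExt α) ≤
      ((K : ℕ) - 1) * Fintype.card (LinExt α) := Nat.mul_le_mul_right _ (by omega)
  nlinarith

lemma chainModel_castLE_tot (hc : StrictMono c) {L : ℕ} (hL : L ≤ Lt)
    (hc' : StrictMono fun l : Fin L => c (Fin.castLE hL l)) (f : LinExt α) :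
    (chainModel hc').tot f (range ((offChain c).card + 1)) = L := by
  have h1 := sum_slotMult (c := fun l : Fin L => c (Fin.castLE hL l)) f (offChain c).card
  refine Eq.trans h1 ?_
  rw [filter_true_of_mem, card_univ, Fintype.card_fin]
  intro l _
  refine card_le_card fun q hq => ?_
  simp only [mem_filter, mem_offChain] at hq ⊢
  intro l' hl'
  subst hl'
  have h2 := (f.monotone_comp hc).lt_iff_lt.1 hq.2
  exact hq.1 ⟨l', (Fin.lt_def.1 h2).trans l.2⟩ rfl

set_option maxHeartbeats 800000 in
open Classical in
/-- A poset of bounded width with a long chain that is free at the bottom has an almost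
balanced pair. -/
theorem exists_balanced_of_chain (w : ℕ) {κ₀ ε : ℝ} (hκ₀ : 0 < κ₀) (hε : 0 < ε) :
    ∃ N : ℕ, ∀ {α : Type} [Fintype α] [PartialOrder α] {Lt L : ℕ} {c : Fin Lt → α},
      StrictMono c → L ≤ Lt →
      (∀ (y : α) (l : Fin Lt), (l : ℕ) < L → y < c l → ∃ l', c l' = y) →
      (∀ q ∈ offChain c, (univ.filter fun l => c l < q).card ≤
        ((offChain c).filter fun q' => q' ≤ q).card) →
      (∀ h : L < Lt, ∃ y ∈ offChain c, y < c ⟨L, h⟩) →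
      (offChain c).Nonempty →
      (∀ A : Finset α, IsAntichain (· ≤ ·) (A : Set α) → A.card ≤ w) →
      N ≤ Fintype.card α → κ₀ * Fintype.card α ≤ L →
      ∃ x y : α, x ≠ y ∧ 1 / 2 - ε < min (prLT x y) (prLT y x) := by
  obtain ⟨A, hA⟩ := exists_nat_ge (2 / ε)
  have hA0 : (0 : ℝ) < A := lt_of_lt_of_le (by positivity) hA
  set τ : ℝ := ε / (2 * A) with hτ
  have hτ0 : 0 < τ := by positivity
  have hAε : 2 ≤ A * ε := by rwa [div_le_iff₀ hε] at hA
  have hAτ : A * τ ≤ ε / 2 := by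
    rw [hτ]
    apply le_of_eq
    field_simp
  set θ : ℝ := 1 / 2 ^ (w + 5) with hθ
  have hθ0 : 0 < θ := by positivity
  set κ : ℝ := 1 / 2 / (1 + 1 / (θ * κ₀)) with hκ
  have hκ0 : 0 < κ := by positivity
  have hκ1 : κ ≤ 1 := by
    have : 0 < 1 / (θ * κ₀) := by positivity
    rw [hκ, div_le_one (by positivity)]
    linarith
  obtain ⟨R, u, J, hJ, hlevel⟩ := SlotModel.exists_level_step hκ0 hκ1 hτ0
  obtain ⟨M, N₁, hmany⟩ := exists_rank_precedes_of_many w (R * J) hκ₀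
  obtain ⟨B, hB⟩ := exists_nat_ge ((M : ℝ) / τ)
  set S : ℕ := 2 * A + 8 * u + 2 * B + N₁ + 2 with hS
  obtain ⟨N, hN⟩ := exists_nat_ge (((2 ^ (w + 3) * S : ℕ) : ℝ) / κ₀)
  refine ⟨N, ?_⟩
  intro α _ _ Lt L c hc hL hfree hlow hnext hne hw hcard hκL
  have hLS : 2 ^ (w + 3) * S ≤ L := by
    rw [div_le_iff₀ hκ₀] at hN
    have h1 : (N : ℝ) ≤ Fintype.card α := by exact_mod_cast hcard
    have : ((2 ^ (w + 3) * S : ℕ) : ℝ) ≤ L :=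
      hN.trans ((mul_le_mul_of_nonneg_right h1 hκ₀.le).trans (by linarith))
    exact_mod_cast this
  set s : ℕ := L / 2 ^ (w + 3) with hs
  have hSs : S ≤ s := by
    rw [hs, Nat.le_div_iff_mul_le (by positivity), mul_comm]
    exact hLS
  have hsL : 2 ^ (w + 3) * s ≤ L := Nat.mul_div_le _ _
  have hLs : L < 2 ^ (w + 3) * (s + 1) := Nat.lt_mul_div_succ _ (by positivity)
  have hpw : 1 ≤ 2 ^ w := Nat.one_le_two_pow
  have hpow : 2 ^ (w + 3) = 8 * 2 ^ w := by ring
  rw [hpow] at hsL hLs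
  have h8s : 8 * s ≤ L := by nlinarith
  obtain ⟨K, hK⟩ : ∃ K, K + s = L := ⟨L - s, by omega⟩
  have hKL : K < L := by omega
  have hKLt : K < Lt := by omega
  have hc' : StrictMono fun l : Fin L => c (Fin.castLE hL l) :=
    hc.comp (Fin.strictMono_castLE hL)
  have hsub : ∀ q ∈ offChain c, q ∈ offChain fun l : Fin L => c (Fin.castLE hL l) :=
    fun q hq => (mem_offChain _).2 fun l => (mem_offChain c).1 hq _
  have hadv : (chainModel hc').Advances := chainModel_advances hc' fun y l hy => by
    obtain ⟨l', rfl⟩ := hfree y (Fin.castLE hL l) l.2 hy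
    exact ⟨⟨l', (Fin.lt_def.1 (hc.lt_iff_lt.1 hy)).trans l.2⟩, rfl⟩
  obtain ⟨g, hg, hg'⟩ := exists_rank_function (offChain c)
  have hgap : ∀ k ≤ K + A, k < L ∧ (s : ℝ) ≤ 2 * ((L : ℝ) - k) := by
    intro k hk
    refine ⟨by omega, ?_⟩
    have : s + 2 * k ≤ 2 * L := by omega
    have : ((s + 2 * k : ℕ) : ℝ) ≤ (2 * L : ℕ) := by exact_mod_cast this
    push_cast at this
    linarith
  have hLtα : Lt ≤ Fintype.card α := by
    simpa using Fintype.card_le_of_injective c hc.injective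
  by_cases hM : M ≤ (offChain c).card
  · obtain ⟨t, ht, hgt, h1⟩ := hmany hc hlow hw g hg hg' hM ⟨K, hKLt⟩ (by
      change N₁ ≤ K
      omega) (by
      have h2 : (Lt : ℝ) ≤ Fintype.card α := by exact_mod_cast hLtα
      have h3 : (L : ℝ) ≤ 2 * K := by
        have : L ≤ 2 * K := by omega
        exact_mod_cast this
      exact (mul_le_mul_of_nonneg_left h2 hκ₀.le).trans (hκL.trans h3))
    obtain ⟨p, hpt, hpQ, hp⟩ := exists_chain_of_rank hg' _ t ht hgt
    have hpmono : ∀ i j, i ≤ j → j ≤ R * J → p i ≤ p j := by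
      intro i j hij
      induction j, hij using Nat.le_induction with
      | base => intro _; exact le_rfl
      | succ j hij ih => intro hj; exact (ih (by omega)).trans (hp j (by omega)).le
    have hkey : ∀ (f : LinExt α) i j, i + j ≤ R * J →
        (chainModel hc').key f (p i) + j ≤ (chainModel hc').key f (p (i + j)) := by
      intro f i j
      induction j with
      | zero => intro _; exact le_rfl
      | succ j ih =>
        intro hj
        have h2 := ih (by omega)
        have h3 := f.2 _ _ (hp (i + j) (by omega))
        rw [← offRank_lt_iff (hsub _ (hpQ (i + j) (by omega))),
          ← chainModel_key hc' f (hsub _ (hpQ _ (by omega))),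
          ← chainModel_key hc' f (hsub _ (hpQ _ (by omega)))] at h3
        rw [← add_assoc i]
        omega
    obtain ⟨j, hj, hstep⟩ := hlevel (chainModel hc') hadv _ L (chainModel_tot_card hc')
      (fun f ν hν => slotMult_eq_zero f hν) (fun j γ => γ (p (R * j))) (fun j hj f => by
        have : R * (j + 1) ≤ R * J := Nat.mul_le_mul_left _ hj
        exact hkey f (R * j) R this)
    have hRj : R * j ≤ R * J := Nat.mul_le_mul_left _ hj
    have hx := hsub _ (hpQ _ hRj)
    refine exists_balanced_of_level_step hc' hx hKL hε hAε hAτ (h1.trans ?_) fun k hk => ?_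
    · refine Nat.mul_le_mul_left _ (card_le_card fun f hf => ?_)
      simp only [mem_filter, mem_univ, true_and] at hf ⊢
      refine lt_of_le_of_lt ?_ hf
      rw [← hpt]
      rcases (hpmono _ _ hRj le_rfl).eq_or_lt with h | h
      · rw [h]
      · exact (f.2 _ _ h).le
    · obtain ⟨hkL, hks⟩ := hgap k hk
      have h2 := hstep k hkL (by
        set y : ℝ := (L : ℝ) - k with hy
        have h3 : (8 * u : ℝ) ≤ s := by
          have : 8 * u ≤ s := by omega
          exact_mod_cast this
        have h4 : θ * L ≤ y := by
          have : L ≤ 2 ^ (w + 4) * s := by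
            have : 2 ^ (w + 4) = 16 * 2 ^ w := by ring
            nlinarith
          have : (L : ℝ) ≤ 2 ^ (w + 4) * s := by exact_mod_cast this
          rw [hθ, one_div_mul_eq_div, div_le_iff₀ (by positivity)]
          have h5 : (2 : ℝ) ^ (w + 5) = 2 * 2 ^ (w + 4) := by ring
          rw [h5]
          nlinarith [pow_pos (two_pos (α := ℝ)) (w + 4)]
        have h5 : ((offChain fun l : Fin L => c (Fin.castLE hL l)).card : ℝ) ≤
            1 / (θ * κ₀) * y := by
          rw [one_div_mul_eq_div, le_div_iff₀ (by positivity)]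
          have h6 : ((offChain fun l : Fin L => c (Fin.castLE hL l)).card : ℝ) ≤
            Fintype.card α := by exact_mod_cast card_le_univ _
          calc _ ≤ (Fintype.card α : ℝ) * (θ * κ₀) :=
                mul_le_mul_of_nonneg_right h6 (by positivity)
            _ = θ * (κ₀ * Fintype.card α) := by ring
            _ ≤ θ * L := mul_le_mul_of_nonneg_left hκL hθ0.le
            _ ≤ y := h4
        calc _ ≤ κ * (y + 1 / (θ * κ₀) * y) := by gcongr
          _ = y / 2 := by
            rw [hκ]
            field_simp
          _ ≤ y - 2 * u := by linarith)
      have h3 : ∀ f : LinExt α, (chainModel hc').tot f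
          (range ((chainModel hc').key f (p (R * j)) + 1)) =
          chainRank (fun l : Fin L => c (Fin.castLE hL l)) f (p (R * j)) :=
        fun f => chainModel_tot_key hc' f hx
      simpa only [h3] using h2
  · obtain ⟨t, ht, -, h1⟩ := exists_rank_zero_precedes hc hlow hw hg hg' hne hnext ⟨K, hKLt⟩
      hKL.le (by
        change 2 ^ w * (L - K) + 1 < K
        rw [show L - K = s by omega]
        nlinarith)
    refine exists_balanced_of_level_step hc' (hsub t ht) hKL hε hAε hAτ h1 fun k hk => ?_
    obtain ⟨hkL, hks⟩ := hgap k hk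
    have h2 := SlotModel.level_step_of_few_slots (chainModel hc') hadv
      (chainModel_castLE_tot hc hL hc') (fun γ => γ t) (τ := τ) hkL (by
        rw [div_le_iff₀ hτ0] at hB
        have h3 : ((offChain c).card : ℝ) ≤ M := by exact_mod_cast (not_le.1 hM).le
        have h4 : (2 * B : ℝ) ≤ s := by
          have : 2 * B ≤ s := by omega
          exact_mod_cast this
        nlinarith)
    have h3 : ∀ f : LinExt α, (chainModel hc').tot f
        (range ((chainModel hc').key f t + 1)) =
        chainRank (fun l : Fin L => c (Fin.castLE hL l)) f t :=
      fun f => chainModel_tot_key hc' f (hsub t ht)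
    simpa only [h3] using h2

end ChainTheorem

section Lattice

variable {d : ℕ} {P : Finset (Fin d → ℕ)}

/-- Convexity of a finite set of lattice points, with weak inequalities. -/
lemma mem_of_le_of_le (hP : ∀ x ∈ P, ∀ z ∈ P, ∀ y, x < y → y < z → y ∈ P) {x y z : Fin d → ℕ}
    (hx : x ∈ P) (hz : z ∈ P) (hxy : x ≤ y) (hyz : y ≤ z) : y ∈ P := by
  rcases hxy.eq_or_lt with rfl | hxy
  · exact hx
  rcases hyz.eq_or_lt with rfl | hyz
  · exact hz
  exact hP x hx z hz y hxy hyz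

lemma lt_add_of_width (hP : ∀ x ∈ P, ∀ z ∈ P, ∀ y, x < y → y < z → y ∈ P) {w : ℕ}
    (hw : ∀ A : Finset ↥P, IsAntichain (· ≤ ·) (A : Set ↥P) → A.card ≤ w)
    {a b : Fin d → ℕ} (ha : a ∈ P) (hb : b ∈ P) (hab : a ≤ b) {i j : Fin d} (hij : j ≠ i)
    (hi : a i + w ≤ b i) : b j < a j + w := by
  by_contra! hj
  have hmem : ∀ p : Fin (w + 1),
      Function.update (Function.update a i (a i + (w - p))) j (a j + p) ∈ P := by
    intro p
    have hp : (p : ℕ) ≤ w := Nat.lt_succ_iff.1 p.2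
    refine mem_of_le_of_le hP ha hb (fun k => ?_) (fun k => ?_)
    · by_cases hk : k = j
      · subst hk; simp
      by_cases hk' : k = i
      · subst hk'; simp [hk]
      · simp [hk, hk']
    · by_cases hk : k = j
      · subst hk; simp; omega
      by_cases hk' : k = i
      · subst hk'; simp [hk]; omega
      · simpa [hk, hk'] using hab k
  have hle : ∀ p q : Fin (w + 1),
      (⟨_, hmem p⟩ : ↥P) ≤ ⟨_, hmem q⟩ → p = q := by
    intro p q h
    have hi := (Subtype.mk_le_mk.1 h) i
    have hj := (Subtype.mk_le_mk.1 h) j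
    simp [hij.symm] at hi hj
    have := p.2
    have := q.2
    ext
    omega
  have hinj : Function.Injective fun p : Fin (w + 1) => (⟨_, hmem p⟩ : ↥P) :=
    fun p q h => hle p q (le_of_eq h)
  have := hw (univ.map ⟨_, hinj⟩) (by
    intro x hx y hy hne hxy
    simp only [coe_map, Function.Embedding.coeFn_mk, coe_univ, Set.image_univ,
      Set.mem_range] at hx hy
    obtain ⟨p, rfl⟩ := hx
    obtain ⟨q, rfl⟩ := hy
    exact hne (by rw [hle p q hxy]))
  simp at this

lemma exists_free_segment (hP : ∀ x ∈ P, ∀ z ∈ P, ∀ y, x < y → y < z → y ∈ P) {w : ℕ} (hw0 : 0 < w)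
    (hw : ∀ A : Finset ↥P, IsAntichain (· ≤ ·) (A : Set ↥P) → A.card ≤ w)
    {b : Fin d → ℕ} (hb : b ∈ P) (i : Fin d) (r : ℕ) :
    ∀ (a : Fin d → ℕ) (m : ℕ), a ∈ P → a ≤ b → a i + m = b i → 2 ^ r * w ≤ m →
      d * w ≤ r + ∑ j ∈ univ.erase i, (b j - a j) →
      ∃ a' n, a' ∈ P ∧ Function.update a' i (a' i + n) ∈ P ∧ m ≤ 2 ^ (r + 1) * (n + 1) ∧
        ∀ y ∈ P, y ≤ Function.update a' i (a' i + n) → ∀ j ≠ i, y j = a' j := by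
  induction r with
  | zero =>
    intro a m ha hab hm hwm hsum
    exfalso
    have h1 : ∀ j ∈ univ.erase i, b j - a j ≤ w := fun j hj => by
      have := lt_add_of_width hP hw ha hb hab (ne_of_mem_erase hj) (by omega)
      omega
    have h2 := sum_le_card_nsmul _ _ _ h1
    rw [card_erase_of_mem (mem_univ i), card_univ, Fintype.card_fin, smul_eq_mul] at h2
    have hd : 0 < d := i.pos
    have h3 : (d - 1) * w < d * w := Nat.mul_lt_mul_of_pos_right (by omega) hw0
    omega
  | succ r ih =>
    intro a m ha hab hm hwm hsum
    by_cases hfree : ∀ y ∈ P, y ≤ Function.update a i (a i + m / 2) → ∀ j ≠ i, y j = a j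
    · refine ⟨a, m / 2, ha, mem_of_le_of_le hP ha hb ?_ ?_, ?_, hfree⟩
      · exact le_update_self_iff.2 (by omega)
      · exact update_le_iff.2 ⟨by omega, fun j _ => hab j⟩
      · have h1 : m ≤ 2 * (m / 2 + 1) := by omega
        refine h1.trans (Nat.mul_le_mul_right _ ?_)
        rw [pow_succ 2 (r + 1)]
        have := Nat.one_le_two_pow (n := r + 1)
        omega
    · push Not at hfree
      obtain ⟨y, hy, hyle, j, hji, hyj⟩ := hfree
      have h1 := (le_update_iff.1 hyle)
      have h2 : y j < a j := lt_of_le_of_ne (h1.2 j hji) hyj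
      set a' := Function.update (Function.update a i (a i + m / 2)) j (a j - 1) with ha'
      have hmem : Function.update a i (a i + m / 2) ∈ P :=
        mem_of_le_of_le hP ha hb (le_update_self_iff.2 (by omega))
          (update_le_iff.2 ⟨by omega, fun j _ => hab j⟩)
      have ha'P : a' ∈ P := mem_of_le_of_le hP hy hmem
        (le_update_iff.2 ⟨by omega, fun k _ => hyle k⟩)
        (update_le_self_iff.2 (by rw [Function.update_of_ne hji]; omega))
      have ha'i : a' i = a i + m / 2 := by simp [ha', hji.symm]
      have ha'j : a' j = a j - 1 := by simp [ha']
      have ha'k : ∀ k, k ≠ i → k ≠ j → a' k = a k := fun k h3 h4 => by simp [ha', h3, h4]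
      have ha'b : a' ≤ b := by
        intro k
        have : a k ≤ b k := hab k
        change a' k ≤ b k
        by_cases h3 : k = i
        · subst h3; omega
        by_cases h4 : k = j
        · subst h4; omega
        · rwa [ha'k k h3 h4]
      obtain ⟨a'', n, h3, h4, h5, h6⟩ := ih a' (m - m / 2) ha'P ha'b (by omega) (by
        rw [pow_succ] at hwm
        have : 2 ^ r * 2 * w = 2 * (2 ^ r * w) := by ring
        omega) (by
        have h3 : ∑ k ∈ univ.erase i, (b k - a k) < ∑ k ∈ univ.erase i, (b k - a' k) := by
          refine sum_lt_sum (fun k hk => ?_) ⟨j, mem_erase.2 ⟨hji, mem_univ j⟩, ?_⟩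
          · by_cases h4 : k = j
            · subst h4; omega
            · rw [ha'k k (ne_of_mem_erase hk) h4]
          · have : a j ≤ b j := hab j
            omega
        omega)
      refine ⟨a'', n, h3, h4, ?_, h6⟩
      rw [pow_succ]
      have : 2 ^ (r + 1) * 2 * (n + 1) = 2 * (2 ^ (r + 1) * (n + 1)) := by ring
      omega

lemma exists_long_coordinate {w : ℕ} (hne : P.Nonempty)
    (hw : ∀ A : Finset ↥P, IsAntichain (· ≤ ·) (A : Set ↥P) → A.card ≤ w) (hd : 0 < d) :
    ∃ a ∈ P, ∃ b ∈ P, a ≤ b ∧ ∃ i m, a i + m = b i ∧ P.card ≤ w * (d * m + 1) := by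
  obtain ⟨g, hg, hg'⟩ := exists_rank_function (univ : Finset ↥P)
  have hcard : 0 < P.card := card_pos.2 hne
  have h1 := card_rank_lt_le hg hw ((P.card - 1) / w)
  have h2 : w * ((P.card - 1) / w) ≤ P.card - 1 := Nat.mul_div_le _ _
  obtain ⟨x, hx⟩ : ∃ x : ↥P, (P.card - 1) / w ≤ g x := by
    by_contra! h
    rw [filter_true_of_mem (fun x _ => h x), card_univ, Fintype.card_coe] at h1
    omega
  obtain ⟨p, hpx, -, hp⟩ := exists_chain_of_rank hg' (g x) x (mem_univ x) rfl
  have h3 : ∀ n ≤ g x, p 0 ≤ p n ∧ ∑ i, (p 0).1 i + n ≤ ∑ i, (p n).1 i := by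
    intro n
    induction n with
    | zero => intro _; exact ⟨le_rfl, le_rfl⟩
    | succ n ih =>
      intro hn
      obtain ⟨h3, h4⟩ := ih (by omega)
      have h5 := hp n (by omega)
      have h6 : ∑ i, (p n).1 i < ∑ i, (p (n + 1)).1 i := by
        obtain ⟨h6, i, h7⟩ := Pi.lt_def.1 (Subtype.coe_lt_coe.2 h5)
        exact sum_lt_sum (fun i _ => h6 i) ⟨i, mem_univ i, h7⟩
      exact ⟨h3.trans h5.le, by omega⟩
  obtain ⟨h4, h5⟩ := h3 (g x) le_rfl
  have : Nonempty (Fin d) := ⟨⟨0, hd⟩⟩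
  obtain ⟨i, -, hi⟩ := exists_max_image univ (fun i => (p (g x)).1 i - (p 0).1 i) univ_nonempty
  refine ⟨(p 0).1, (p 0).2, (p (g x)).1, (p (g x)).2, h4, i, _, Nat.add_sub_of_le (h4 i), ?_⟩
  have h6 : ∑ j, (p (g x)).1 j ≤ ∑ j, ((p 0).1 j + ((p (g x)).1 i - (p 0).1 i)) :=
    sum_le_sum fun j _ => by
      have := hi j (mem_univ j)
      omega
  rw [sum_add_distrib, sum_const, card_univ, Fintype.card_fin, smul_eq_mul] at h6
  have hw0 : 0 < w := by
    have := hw {x} (by simp)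
    rw [card_singleton] at this
    omega
  have h7 : P.card - 1 < w * ((P.card - 1) / w + 1) := Nat.lt_mul_div_succ _ hw0
  have h8 := Nat.mul_le_mul_left w
    (show (P.card - 1) / w + 1 ≤ d * ((p (g x)).1 i - (p 0).1 i) + 1 by omega)
  omega

lemma orderEmbOfFin_mem_filter_iff (S : Finset ℕ) (p : ℕ → Prop) [DecidablePred p]
    (hp : ∀ s ∈ S, ∀ t ∈ S, s ≤ t → p t → p s) (l : Fin S.card) :
    p (S.orderEmbOfFin rfl l) ↔ (l : ℕ) < (S.filter p).card := by
  have himg : univ.image (S.orderEmbOfFin rfl) = S := by simp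
  have hcard : (S.filter p).card = (univ.filter fun l => p (S.orderEmbOfFin rfl l)).card := by
    conv_lhs => rw [← himg]
    rw [filter_image, card_image_of_injective _ (S.orderEmbOfFin rfl).injective]
  rw [hcard]
  constructor
  · intro h
    refine lt_of_lt_of_le ?_ (card_le_card (s := Iic l) fun k hk => ?_)
    · simp
    · exact mem_filter.2 ⟨mem_univ _, hp _ (orderEmbOfFin_mem _ _ _) _ (orderEmbOfFin_mem _ _ _)
        ((S.orderEmbOfFin rfl).monotone (mem_Iic.1 hk)) h⟩
  · intro h
    by_contra hl
    refine absurd h (not_lt.2 ((card_le_card (t := Iio l) fun k hk => ?_).trans ?_))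
    · rw [mem_Iio]
      by_contra! hlk
      exact hl (hp _ (orderEmbOfFin_mem _ _ _) _ (orderEmbOfFin_mem _ _ _)
        ((S.orderEmbOfFin rfl).monotone hlk) (mem_filter.1 hk).2)
    · simp

open Classical in
lemma exists_free_chain (hP : ∀ x ∈ P, ∀ z ∈ P, ∀ y, x < y → y < z → y ∈ P)
    {a : Fin d → ℕ} {i : Fin d} {n : ℕ} (ha : a ∈ P) (hn : Function.update a i (a i + n) ∈ P)
    (hfree : ∀ y ∈ P, y ≤ Function.update a i (a i + n) → ∀ j ≠ i, y j = a j) :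
    ∃ (Lt L : ℕ) (c : Fin Lt → ↥P), StrictMono c ∧ L ≤ Lt ∧ n < L ∧
      (∀ (y : ↥P) (l : Fin Lt), (l : ℕ) < L → y < c l → ∃ l', c l' = y) ∧
      (∀ q ∈ offChain c, (univ.filter fun l => c l < q).card ≤
        ((offChain c).filter fun q' => q' ≤ q).card) ∧
      ∀ h : L < Lt, ∃ y ∈ offChain c, y < c ⟨L, h⟩ := by
  have hai : ∀ y ∈ P, (∀ j ≠ i, y j = a j) → Function.update a i (y i) = y := fun y _ h =>
    Function.update_eq_iff.2 ⟨rfl, fun j hj => (h j hj).symm⟩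
  set S : Finset ℕ := (P.image fun y => y i).filter fun t => Function.update a i t ∈ P with hS
  have hmemS : ∀ t, t ∈ S ↔ Function.update a i t ∈ P := fun t => by
    simp only [hS, mem_filter, mem_image, and_iff_right_iff_imp]
    exact fun h => ⟨_, h, by simp⟩
  set c : Fin S.card → ↥P := fun l =>
    ⟨Function.update a i (S.orderEmbOfFin rfl l), (hmemS _).1 (orderEmbOfFin_mem _ _ _)⟩ with hc
  have hcmono : StrictMono c := fun l l' h => Subtype.mk_lt_mk.2
    (update_lt_update_iff.2 ((S.orderEmbOfFin rfl).strictMono h))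
  have hline : ∀ y : ↥P, (∃ l, c l = y) ↔ ∀ j ≠ i, y.1 j = a j := by
    intro y
    constructor
    · rintro ⟨l, rfl⟩ j hj
      simp [hc, hj]
    · intro h
      have h1 := hai y.1 y.2 h
      have h2 : y.1 i ∈ S := (hmemS _).2 (h1.symm ▸ y.2)
      rw [← mem_coe, ← range_orderEmbOfFin S rfl] at h2
      obtain ⟨l, hl⟩ := h2
      exact ⟨l, Subtype.ext (by rw [← h1, ← hl])⟩
  set p : ℕ → Prop := fun t => ∀ y ∈ P, y ≤ Function.update a i t → ∀ j ≠ i, y j = a j with hp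
  have hpmono : ∀ s t, s ≤ t → p t → p s := fun s t hst h y hy hys =>
    h y hy (hys.trans (update_le_update_iff.2 ⟨hst, fun _ _ => le_rfl⟩))
  have hpl := orderEmbOfFin_mem_filter_iff S p fun s _ t _ => hpmono s t
  refine ⟨S.card, (S.filter p).card, c, hcmono, card_filter_le _ _, ?_, ?_, ?_, ?_⟩
  · have h1 : (Icc (a i) (a i + n)).card ≤ (S.filter p).card := card_le_card fun t ht => by
      rw [mem_Icc] at ht
      refine mem_filter.2 ⟨(hmemS t).2 (mem_of_le_of_le hP ha hn ?_ ?_), hpmono _ _ ht.2 hfree⟩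
      · exact le_update_self_iff.2 ht.1
      · exact update_le_update_iff.2 ⟨ht.2, fun _ _ => le_rfl⟩
    rw [Nat.card_Icc] at h1
    omega
  · intro y l hl hy
    exact (hline y).2 ((hpl l).2 hl y.1 y.2 (Subtype.coe_le_coe.2 hy.le))
  · intro q hq
    have h1 : ¬ ∀ j ≠ i, q.1 j = a j := fun h => by
      obtain ⟨l, hl⟩ := (hline q).2 h
      exact (mem_offChain c).1 hq l hl
    push Not at h1
    obtain ⟨j, hji, hqj⟩ := h1
    have h2 : ∀ l, c l < q → Function.update (c l).1 j (a j + 1) ∈ P ∧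
        Function.update (c l).1 j (a j + 1) ≤ q.1 := by
      intro l hl
      have h3 : (c l).1 ≤ q.1 := Subtype.coe_le_coe.2 hl.le
      have h4 : (c l).1 j = a j := (hline _).1 ⟨l, rfl⟩ j hji
      have h5 : (c l).1 j ≤ q.1 j := h3 j
      have h6 : Function.update (c l).1 j (a j + 1) ≤ q.1 :=
        update_le_iff.2 ⟨by omega, fun k _ => h3 k⟩
      exact ⟨mem_of_le_of_le hP (c l).2 q.2 (le_update_self_iff.2 (by omega)) h6, h6⟩
    refine card_le_card_of_injOn
      (fun l => if h : c l < q then ⟨_, (h2 l h).1⟩ else q) (fun l hl => ?_) fun l hl l' hl' h => ?_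
    · have hl' : c l < q := by simpa using hl
      simp only [hl', dite_true, coe_filter, Set.mem_ofPred_eq]
      refine ⟨(mem_offChain c).2 fun k hk => ?_, (h2 l hl').2⟩
      have := (hline _).1 ⟨k, hk⟩ j hji
      simp at this
    · have hl : c l < q := by simpa using hl
      have hl' : c l' < q := by simpa using hl'
      simp only [hl, hl', dite_true, Subtype.mk.injEq] at h
      have := congr_fun h i
      simp only [Function.update_of_ne hji.symm, hc, Function.update_self] at this
      exact (S.orderEmbOfFin rfl).injective this
  · intro h
    have h1 : ¬ p (S.orderEmbOfFin rfl ⟨_, h⟩) := fun h' => lt_irrefl _ ((hpl _).1 h')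
    simp only [hp] at h1
    push Not at h1
    obtain ⟨y, hy, hyle, j, hji, hyj⟩ := h1
    have h2 : (⟨y, hy⟩ : ↥P) ∈ offChain c := (mem_offChain c).2 fun l hl =>
      hyj ((hline _).1 ⟨l, hl⟩ j hji)
    exact ⟨⟨y, hy⟩, h2, lt_of_le_of_ne hyle fun h => (mem_offChain c).1 h2 _ h.symm⟩

end Lattice

/-- for fixed `d ≥ 1`, `w ≥ 2` and `ε > 0` there is `N` such that every finite
convex `P ⊆ ℕ^d` with `2 ≤ w(P) ≤ w` and `|P| ≥ N` has `δ(P) > 1/2 - ε`. -/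
theorem stmt_4 (d w : ℕ) (hd : 1 ≤ d) (hw : 2 ≤ w) (ε : ℝ) (hε : 0 < ε) :
    ∃ N : ℕ,
      ∀ P : Finset (Fin d → ℕ),
        (∀ x ∈ P, ∀ z ∈ P, ∀ y : Fin d → ℕ, x < y → y < z → y ∈ P) →
        (∃ A : Finset ↥P, IsAntichain (· ≤ ·) (A : Set ↥P) ∧ A.card = 2) →
        (∀ A : Finset ↥P, IsAntichain (· ≤ ·) (A : Set ↥P) → A.card ≤ w) →
        N ≤ P.card →
        ∃ x y : ↥P, x ≠ y ∧ 1 / 2 - ε < min (prLT x y) (prLT y x) := by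
  classical
  set D : ℕ := w * (d * 2 ^ (d * w + 1) + 1) with hD
  have hD0 : 0 < D := by positivity
  obtain ⟨N, hN⟩ := exists_balanced_of_chain w (κ₀ := 1 / D) (by positivity) hε
  refine ⟨N + w * (d * (2 ^ (d * w) * w) + 1) + 1, fun P hP hA hPw hcard => ?_⟩
  obtain ⟨a, ha, b, hb, hab, i, m, him, hm⟩ :=
    exists_long_coordinate (card_pos.1 (by omega : 0 < P.card)) hPw (by omega)
  have hwm : 2 ^ (d * w) * w ≤ m := by
    by_contra! h
    have := Nat.mul_le_mul_left w (Nat.succ_le_succ (Nat.mul_le_mul_left d h.le))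
    simp only [Nat.succ_eq_add_one] at this
    omega
  obtain ⟨a', n, ha', hn, hmn, hfree⟩ := exists_free_segment hP (by omega) hPw hb i (d * w) a m ha
    hab him hwm (by omega)
  obtain ⟨Lt, L, c, hc, hL, hnL, hfree', hlow, hnext⟩ := exists_free_chain hP ha' hn hfree
  refine hN hc hL hfree' hlow hnext ?_ hPw (by rw [Fintype.card_coe]; omega) ?_
  · by_contra hempty
    rw [not_nonempty_iff_eq_empty, eq_empty_iff_forall_notMem] at hempty
    obtain ⟨A, hA, hA2⟩ := hA
    obtain ⟨x, y, hxy, rfl⟩ := card_eq_two.1 hA2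
    have h1 := hempty x
    have h2 := hempty y
    simp only [mem_offChain, not_forall, not_not] at h1 h2
    obtain ⟨k, rfl⟩ := h1
    obtain ⟨l, rfl⟩ := h2
    rcases le_total k l with h | h
    · exact hA (by simp) (by simp) hxy (hc.monotone h)
    · exact hA (by simp) (by simp) hxy.symm (hc.monotone h)
  · rw [one_div_mul_eq_div, div_le_iff₀ (by positivity), Fintype.card_coe]
    have h1 : m ≤ 2 ^ (d * w + 1) * L := hmn.trans (Nat.mul_le_mul_left _ hnL)
    have h2 : P.card ≤ L * D := by
      calc P.card ≤ w * (d * m + 1) := hm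
        _ ≤ w * (d * (2 ^ (d * w + 1) * L) + L) := by
          refine Nat.mul_le_mul_left _ (Nat.add_le_add (Nat.mul_le_mul_left _ h1) (by omega))
        _ = L * D := by rw [hD]; ring
    exact_mod_cast h2
end

section
/- For every d ≥ 1, any finite convex subset P of ℕ^d (with the induced product order) that is not a chain satisfies π(P) ≥ |P|/2 − 1. -/
open Finset

/-- If `x` and `y` are incomparable and have at most one common upper bound and at most one common
lower bound, then all but at most two elements are incomparable to `x` or to `y`. -/
theorem card_le_piVal_add_piVal {α : Type*} [Fintype α] [PartialOrder α] {x y : α}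
    (hxy : ¬ x ≤ y) (hyx : ¬ y ≤ x)
    (hub : {z : α | x ≤ z ∧ y ≤ z}.Subsingleton) (hlb : {z : α | z ≤ x ∧ z ≤ y}.Subsingleton) :
    Fintype.card α ≤ piVal x + piVal y + 2 := by
  classical
  have hcover : (univ : Finset α) ⊆
      (({z | ¬ x ≤ z ∧ ¬ z ≤ x} : Finset α) ∪ ({z | ¬ y ≤ z ∧ ¬ z ≤ y} : Finset α)) ∪
      (({z | x ≤ z ∧ y ≤ z} : Finset α) ∪ ({z | z ≤ x ∧ z ≤ y} : Finset α)) := by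
    intro z _
    have h₁ : x ≤ z → ¬ z ≤ y := fun h h' => hxy (h.trans h')
    have h₂ : y ≤ z → ¬ z ≤ x := fun h h' => hyx (h.trans h')
    simp only [mem_union, mem_filter, mem_univ, true_and]
    tauto
  have hu : #({z | x ≤ z ∧ y ≤ z} : Finset α) ≤ 1 :=
    card_le_one.2 fun a ha b hb => hub (by simpa using ha) (by simpa using hb)
  have hl : #({z | z ≤ x ∧ z ≤ y} : Finset α) ≤ 1 :=
    card_le_one.2 fun a ha b hb => hlb (by simpa using ha) (by simpa using hb)
  have hpi (w : α) : piVal w = #({z | ¬ w ≤ z ∧ ¬ z ≤ w} : Finset α) := by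
    rw [piVal, Nat.card_eq_fintype_card, Fintype.card_subtype]
  have h := card_le_card hcover
  rw [card_univ] at h
  have h₁ := card_union_le (({z | ¬ x ≤ z ∧ ¬ z ≤ x} : Finset α) ∪
    ({z | ¬ y ≤ z ∧ ¬ z ≤ y} : Finset α))
    (({z | x ≤ z ∧ y ≤ z} : Finset α) ∪ ({z | z ≤ x ∧ z ≤ y} : Finset α))
  have h₂ := card_union_le ({z | ¬ x ≤ z ∧ ¬ z ≤ x} : Finset α) {z | ¬ y ≤ z ∧ ¬ z ≤ y}
  have h₃ := card_union_le ({z | x ≤ z ∧ y ≤ z} : Finset α) {z | z ≤ x ∧ z ≤ y}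
  rw [hpi, hpi]
  omega

/-- A finite convex set of tuples that is not a chain contains two incomparable elements with at
most one common upper bound and at most one common lower bound. -/
theorem exists_incomparable_subsingleton_bounds {ι : Type*} {P : Finset (ι → ℕ)}
    (hconv : (P : Set (ι → ℕ)).OrdConnected) {u v : ι → ℕ} (hu : u ∈ P) (hv : v ∈ P)
    (huv : ¬ u ≤ v) (hvu : ¬ v ≤ u) :
    ∃ x ∈ P, ∃ y ∈ P, ¬ x ≤ y ∧ ¬ y ≤ x ∧ {z | z ∈ P ∧ x ≤ z ∧ y ≤ z}.Subsingleton ∧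
      {z | z ∈ P ∧ z ≤ x ∧ z ≤ y}.Subsingleton := by
  classical
  by_cases hmm : ∃ a b, Minimal (· ∈ P) a ∧ Maximal (· ∈ P) b ∧ ¬ a ≤ b
  · obtain ⟨a, b, ha, hb, hab⟩ := hmm
    refine ⟨a, ha.prop, b, hb.prop, hab, fun h => hab (ha.le_of_le hb.prop h), ?_, ?_⟩
    · rintro z ⟨hz, haz, hbz⟩
      exact absurd (haz.trans (hb.le_of_ge hz hbz)) hab
    · rintro z ⟨hz, hza, hzb⟩
      exact absurd ((ha.le_of_le hz hza).trans hzb) hab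
  push Not at hmm
  obtain ⟨j, hj⟩ : ∃ j, v j < u j := by simpa [Pi.le_def] using huv
  obtain ⟨c, hc⟩ : ∃ c, u c < v c := by simpa [Pi.le_def] using hvu
  have hjc : j ≠ c := by rintro rfl; omega
  obtain ⟨m, hm, hmin⟩ := P.exists_min_image (· c) ⟨u, hu⟩
  obtain ⟨t, ht, hmax⟩ := P.exists_max_image (· c) ⟨u, hu⟩
  obtain ⟨a, hav, ha⟩ := P.exists_le_minimal hv
  obtain ⟨a', ham, ha'⟩ := P.exists_le_minimal hm
  obtain ⟨b, hbt, hb⟩ := P.exists_le_maximal ht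
  obtain ⟨b', hbu, hb'⟩ := P.exists_le_maximal hu
  have hmin' : ∀ z ∈ P, a' c ≤ z c := fun z hz => (ham c).trans (hmin z hz)
  have hmax' : ∀ z ∈ P, z c ≤ b c := fun z hz => (hmax z hz).trans (hbt c)
  have hab := hmm a b ha hb
  have hab' := hmm a' b' ha' hb'
  refine ⟨Function.update a c (b c), hconv.out ha.prop hb.prop ⟨?_, ?_⟩,
    Function.update b' c (a' c), hconv.out ha'.prop hb'.prop ⟨?_, ?_⟩, ?_, ?_, ?_, ?_⟩
  · exact le_update_iff.2 ⟨hab c, fun _ _ => le_rfl⟩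
  · exact update_le_iff.2 ⟨le_rfl, fun i _ => hab i⟩
  · exact le_update_iff.2 ⟨le_rfl, fun i _ => hab' i⟩
  · exact update_le_iff.2 ⟨hab' c, fun _ _ => le_rfl⟩
  · intro h
    have h₁ := h c
    have h₂ := hmin' u hu
    have h₃ := hmax' v hv
    simp only [Function.update_self] at h₁
    omega
  · intro h
    have h₁ : b' j ≤ a j := by simpa [hjc] using h j
    have h₂ : a j ≤ v j := hav j
    have h₃ : u j ≤ b' j := hbu j
    omega
  · have key : ∀ z ∈ P, Function.update a c (b c) ≤ z → Function.update b' c (a' c) ≤ z →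
        z = b' := fun z hz hx hy =>
      (hb'.eq_of_le hz fun i => by
        by_cases hi : i = c
        · subst hi
          exact (hmax' b' hb'.prop).trans (update_le_iff.1 hx).1
        · exact (update_le_iff.1 hy).2 i hi).symm
    rintro z ⟨hz, hx, hy⟩ w ⟨hw, hx', hy'⟩
    rw [key z hz hx hy, key w hw hx' hy']
  · have key : ∀ z ∈ P, z ≤ Function.update a c (b c) → z ≤ Function.update b' c (a' c) →
        z = a := fun z hz hx hy =>
      (ha.eq_of_ge hz fun i => by
        by_cases hi : i = c
        · subst hi
          exact (le_update_iff.1 hy).1.trans (hmin' a ha.prop)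
        · exact (le_update_iff.1 hx).2 i hi).symm
    rintro z ⟨hz, hx, hy⟩ w ⟨hw, hx', hy'⟩
    rw [key z hz hx hy, key w hw hx' hy']

/-- any finite convex subset of `ℕ^d` that is not a chain satisfies
`π(P) ≥ |P|/2 - 1`. -/
theorem stmt_5 (d : ℕ) (hd : 1 ≤ d) (P : Finset (Fin d → ℕ))
    (hconv : ∀ x ∈ P, ∀ z ∈ P, ∀ y : Fin d → ℕ, x < y → y < z → y ∈ P)
    (hnotchain : ¬ ∀ x y : ↥P, x ≤ y ∨ y ≤ x) :
    ∃ x : ↥P, (P.card : ℝ) / 2 - 1 ≤ (piVal x : ℝ) := by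
  obtain ⟨u, v, huv, hvu⟩ : ∃ u v : ↥P, ¬ u ≤ v ∧ ¬ v ≤ u := by
    push Not at hnotchain
    exact hnotchain
  have hP : (P : Set (Fin d → ℕ)).OrdConnected := ⟨fun x hx z hz y hy => by
    rcases hy.1.eq_or_lt with rfl | hxy
    · exact hx
    rcases hy.2.eq_or_lt with rfl | hyz
    · exact hz
    exact hconv x hx z hz y hxy hyz⟩
  obtain ⟨x, hx, y, hy, hxy, hyx, hub, hlb⟩ :=
    exists_incomparable_subsingleton_bounds hP u.2 v.2 huv hvu
  have h := card_le_piVal_add_piVal (x := (⟨x, hx⟩ : ↥P)) (y := ⟨y, hy⟩) hxy hyx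
    (fun z hz w hw => Subtype.ext (hub ⟨z.2, hz⟩ ⟨w.2, hw⟩))
    (fun z hz w hw => Subtype.ext (hlb ⟨z.2, hz⟩ ⟨w.2, hw⟩))
  rw [Fintype.card_coe] at h
  have h' : (P.card : ℝ) ≤ piVal (⟨x, hx⟩ : ↥P) + piVal (⟨y, hy⟩ : ↥P) + 2 := mod_cast h
  rcases le_total (piVal (⟨x, hx⟩ : ↥P) : ℝ) (piVal (⟨y, hy⟩ : ↥P)) with hle | hle
  · exact ⟨⟨y, hy⟩, by linarith⟩
  · exact ⟨⟨x, hx⟩, by linarith⟩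
end

section
/- For every d ≥ 1 there is a constant c_d, depending only on d, such that: every finite nonempty downward-closed subset (order ideal) P of ℕ^d that is not contained in any coordinate hyperplane {x ∈ ℕ^d : x_i = 0} satisfies π(P) ≥ (1 − 1/d)|P| − c_d. -/
open Finset

namespace OrderIdeal

variable {d : ℕ} {P : Finset (Fin d → ℕ)}

/-- The elements of `P` comparable to `x`. -/
noncomputable def comparables (P : Finset (Fin d → ℕ)) (x : Fin d → ℕ) : Finset (Fin d → ℕ) :=
  open scoped Classical in P.filter fun y => x ≤ y ∨ y ≤ x

/-- The largest value of the `i`-th coordinate on `P`. -/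
def axisLength (P : Finset (Fin d → ℕ)) (i : Fin d) : ℕ :=
  P.sup fun x => x i

/-- The map replacing by `0` all coordinates outside of `S`. -/
def restrict (S : Finset (Fin d)) (x : Fin d → ℕ) : Fin d → ℕ :=
  fun i => if i ∈ S then x i else 0

/-- The elements of `P` with the same coordinates in `S` as `s`, when `s` vanishes outside `S`. -/
def fiber (P : Finset (Fin d → ℕ)) (S : Finset (Fin d)) (s : Fin d → ℕ) :
    Finset (Fin d → ℕ) :=
  P.filter fun y => restrict S y = s

lemma piVal_add_card_comparables (x : ↥P) :
    piVal x + (comparables P x).card = P.card := by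
  classical
  have h : piVal x = (P.filter fun y => ¬ (x.1 ≤ y ∨ y ≤ x.1)).card := by
    rw [piVal, ← Nat.card_eq_finsetCard]
    exact Nat.card_congr
      { toFun := fun y => ⟨y.1.1, mem_filter.2 ⟨y.1.2, not_or.2 y.2⟩⟩
        invFun := fun y => ⟨⟨y.1, (mem_filter.1 y.2).1⟩, not_or.1 (mem_filter.1 y.2).2⟩
        left_inv := fun _ => rfl
        right_inv := fun _ => rfl }
  rw [h, add_comm]
  simp only [comparables]
  convert Finset.card_filter_add_card_filter_not (s := P) fun y => x.1 ≤ y ∨ y ≤ x.1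

lemma le_axisLength {x : Fin d → ℕ} (hx : x ∈ P) (i : Fin d) : x i ≤ axisLength P i :=
  Finset.le_sup (f := fun x : Fin d → ℕ => x i) hx

lemma single_mem (hne : P.Nonempty) (hP : IsLowerSet (P : Set (Fin d → ℕ))) {i : Fin d} {k : ℕ}
    (hk : k ≤ axisLength P i) : Pi.single i k ∈ P := by
  obtain ⟨x, hx, hxi⟩ := Finset.exists_mem_eq_sup P hne fun x => x i
  refine hP (a := x) (fun j => ?_) hx
  by_cases hj : j = i
  · subst hj
    rw [Pi.single_eq_same]
    exact hk.trans hxi.le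
  · simp [hj]

/-- Slices at the top of an axis are small, as `P` is downward closed. -/
lemma card_slice_mul_le (hP : IsLowerSet (P : Set (Fin d → ℕ))) (i : Fin d) (a : ℕ) :
    (a + 1) * (P.filter fun y => y i = a).card ≤ P.card := by
  rw [← Finset.card_range (a + 1), ← Finset.card_product]
  refine Finset.card_le_card_of_injOn (fun p => Function.update p.2 i p.1) ?_ ?_
  · rintro ⟨k, y⟩ h
    simp only [coe_product, Set.mem_prod, mem_coe, mem_range, mem_filter] at h
    exact hP (a := y) (update_le_iff.2 ⟨by lia, fun _ _ => le_rfl⟩) h.2.1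
  · rintro ⟨k, y⟩ h ⟨l, z⟩ h' heq
    simp only [coe_product, Set.mem_prod, mem_coe, mem_range, mem_filter] at h h' heq
    have hc := fun j => congrFun heq j
    have hkl : k = l := by simpa using hc i
    refine Prod.ext hkl (funext fun j => ?_)
    by_cases hj : j = i
    · subst hj
      exact h.2.2.trans h'.2.2.symm
    · simpa [hj] using hc j

lemma card_comparables_single_le (i : Fin d) :
    (comparables P (Pi.single i (axisLength P i))).card ≤
      (axisLength P i + 1) + (P.filter fun y => y i = axisLength P i).card := by
  classical
  have hsub : comparables P (Pi.single i (axisLength P i)) ⊆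
      (range (axisLength P i + 1)).image (fun k => Pi.single i k) ∪
        P.filter fun y => y i = axisLength P i := by
    intro y hy
    rw [comparables, mem_filter] at hy
    obtain ⟨hyP, hy | hy⟩ := hy
    · refine mem_union_right _ (mem_filter.2 ⟨hyP, le_antisymm (le_axisLength hyP i) ?_⟩)
      simpa using hy i
    · refine mem_union_left _ (mem_image.2 ⟨y i, ?_, funext fun j => ?_⟩)
      · exact mem_range.2 (Nat.lt_succ_of_le (le_axisLength hyP i))
      · by_cases hj : j = i
        · subst hj
          simp
        · have := hy j
          simp only [Pi.single_eq_of_ne hj] at this ⊢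
          lia
  refine (card_le_card hsub).trans ((card_union_le _ _).trans ?_)
  gcongr
  exact card_image_le.trans (card_range _).le

/-- If an axis of `P` is neither very short nor very long, its top has few comparable elements. -/
lemma card_comparables_single_mul_le (hP : IsLowerSet (P : Set (Fin d → ℕ))) {i : Fin d}
    (hd : d ≤ axisLength P i + 1) (hN : d * axisLength P i ≤ P.card) :
    d * (comparables P (Pi.single i (axisLength P i))).card ≤ P.card + (d + d ^ 2) := by
  have h1 := card_comparables_single_le (P := P) i
  have h2 := card_slice_mul_le hP i (axisLength P i)
  set a := axisLength P i
  set s := (P.filter fun y => y i = a).card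
  set C := (comparables P (Pi.single i a)).card
  suffices d * (a + 1 + s) ≤ P.card + (d + d ^ 2) from (Nat.mul_le_mul_left d h1).trans this
  refine Nat.le_of_mul_le_mul_left ?_ a.succ_pos
  obtain ⟨u, hu⟩ := Nat.exists_eq_add_of_le hd
  obtain ⟨v, hv⟩ := Nat.exists_eq_add_of_le hN
  have h3 : d * ((a + 1) * s) ≤ d * P.card := Nat.mul_le_mul_left d h2
  have h4 : 0 ≤ u * v := Nat.zero_le _
  zify at *
  have hu' : (u : ℤ) = a + 1 - d := by linarith
  have hv' : (v : ℤ) = P.card - d * a := by linarith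
  rw [hu', hv'] at h4
  nlinarith

/-- Disjoint pieces of `P`: the punctured axes outside `S`, and the fibers over the unit vectors
in direction `S`. -/
lemma sum_le_card (hne : P.Nonempty) (hP : IsLowerSet (P : Set (Fin d → ℕ)))
    (S : Finset (Fin d)) :
    ∑ i, (if i ∈ S then (fiber P S (Pi.single i 1)).card else axisLength P i) ≤ P.card := by
  classical
  let G : Fin d → Finset (Fin d → ℕ) := fun i => P.filter fun y =>
    y i ≠ 0 ∧ ∀ j, j ≠ i → (j ∈ S ∨ i ∉ S) → y j = 0
  have hG : (univ : Finset (Fin d)).biUnion G ⊆ P :=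
    biUnion_subset.2 fun i _ => filter_subset _ _
  have hdisj : ((univ : Finset (Fin d)) : Set (Fin d)).PairwiseDisjoint G := by
    intro i _ j _ hij
    refine Finset.disjoint_left.2 fun y hyi hyj => ?_
    simp only [G, mem_filter] at hyi hyj
    obtain ⟨-, hi, hi'⟩ := hyi
    obtain ⟨-, hj, hj'⟩ := hyj
    by_cases h : j ∈ S ∨ i ∉ S
    · exact hj (hi' j hij.symm h)
    · push Not at h
      exact hi (hj' i hij (Or.inl h.2))
  refine le_trans ?_ (card_le_card hG)
  rw [card_biUnion hdisj]
  refine sum_le_sum fun i _ => ?_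
  split_ifs with hi
  · refine card_le_card fun y hy => ?_
    obtain ⟨hyP, hy⟩ := mem_filter.1 hy
    have hc := fun j => congrFun hy j
    simp only [restrict] at hc
    refine mem_filter.2 ⟨hyP, ?_, fun j hj hS => ?_⟩
    · have := hc i
      simp [hi] at this
      lia
    · have := hc j
      simpa [hj, hS.resolve_right (not_not.2 hi)] using this
  · rw [← Nat.card_Ioc 0 (axisLength P i) |>.trans (Nat.sub_zero _)]
    refine card_le_card_of_injOn (fun k => (Pi.single i k : Fin d → ℕ)) (fun k hk => ?_)
      ((Pi.single_injective (M := fun _ : Fin d => ℕ) i).injOn)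
    have hk' := mem_Ioc.1 (mem_coe.1 hk)
    refine mem_coe.2 (mem_filter.2 ⟨single_mem hne hP hk'.2, ?_, fun j hj _ => ?_⟩)
    · simpa using hk'.1.ne'
    · simp [hj]

lemma restrict_mem (hP : IsLowerSet (P : Set (Fin d → ℕ))) (S : Finset (Fin d))
    {x : Fin d → ℕ} (hx : x ∈ P) : restrict S x ∈ P := by
  refine hP (a := x) (fun i => ?_) hx
  simp only [restrict]
  split_ifs
  · exact le_rfl
  · exact Nat.zero_le _

lemma card_fiber_anti (hP : IsLowerSet (P : Set (Fin d → ℕ))) (S : Finset (Fin d))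
    {s t : Fin d → ℕ} (ht : restrict S t = t) (hts : t ≤ s) :
    (fiber P S s).card ≤ (fiber P S t).card := by
  refine card_le_card_of_injOn (fun y i => if i ∈ S then t i else y i) (fun y hy => ?_) ?_
  · obtain ⟨hyP, hy⟩ := mem_filter.1 (mem_coe.1 hy)
    refine mem_coe.2 (mem_filter.2 ⟨hP (a := y) (fun i => ?_) hyP, ?_⟩)
    · by_cases hi : i ∈ S
      · have := congrFun hy i
        simp only [restrict, hi, if_true] at this ⊢
        exact (hts i).trans this.ge
      · simp [hi]
    · rw [← ht]
      funext i
      by_cases hi : i ∈ S <;> simp [restrict, hi]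
  · intro y hy z hz heq
    obtain ⟨-, hy⟩ := mem_filter.1 (mem_coe.1 hy)
    obtain ⟨-, hz⟩ := mem_filter.1 (mem_coe.1 hz)
    funext i
    by_cases hi : i ∈ S
    · simpa [restrict, hi] using congrFun (hy.trans hz.symm) i
    · simpa [hi] using congrFun heq i

/-- A maximal element among those supported on `S` is comparable only to its fiber and to the
elements below it. -/
lemma card_comparables_le_of_maximal {S : Finset (Fin d)} {s : Fin d → ℕ} {m : ℕ}
    (hs : Maximal (· ∈ P.image (restrict S)) s) (hm : ∀ i, s i < m) :
    (comparables P s).card ≤ (fiber P S s).card + m ^ d := by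
  classical
  obtain ⟨x, hx, hxs⟩ := mem_image.1 hs.prop
  have hsub : comparables P s ⊆ fiber P S s ∪ Fintype.piFinset fun _ : Fin d => range m := by
    intro y hy
    rw [comparables, mem_filter] at hy
    obtain ⟨hyP, hy | hy⟩ := hy
    · refine mem_union_left _ (mem_filter.2 ⟨hyP, ?_⟩)
      refine (hs.eq_of_le (mem_image_of_mem _ hyP) fun i => ?_).symm
      by_cases hi : i ∈ S
      · simpa [restrict, hi] using hy i
      · simp [← hxs, restrict, hi]
    · refine mem_union_right _ (Fintype.mem_piFinset.2 fun i => ?_)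
      exact mem_range.2 ((hy i).trans_lt (hm i))
  refine (card_le_card hsub).trans ((card_union_le _ _).trans ?_)
  simp

/-- Some maximal element among those supported on `S` has the smallest fiber. -/
lemma exists_maximal_card_fiber_le (hne : P.Nonempty) (hP : IsLowerSet (P : Set (Fin d → ℕ)))
    (S : Finset (Fin d)) :
    ∃ s, Maximal (· ∈ P.image (restrict S)) s ∧
      ∀ t ∈ P.image (restrict S), (fiber P S s).card ≤ (fiber P S t).card := by
  obtain ⟨r, hr, hmin⟩ :=
    exists_min_image (P.image (restrict S)) (fun t => (fiber P S t).card) (hne.image _)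
  obtain ⟨s, hrs, hs⟩ := Finset.exists_le_maximal (P.image (restrict S)) hr
  refine ⟨s, hs, fun t ht => (card_fiber_anti hP S ?_ hrs).trans (hmin t ht)⟩
  obtain ⟨x, -, rfl⟩ := mem_image.1 hr
  funext i
  by_cases hi : i ∈ S <;> simp [restrict, hi]

/-- If every axis of `P` is very short or very long, some maximal element supported on the short
axes has few comparable elements. -/
lemma exists_card_comparables_mul_le_of_forall (hd : 1 ≤ d) (hne : P.Nonempty)
    (hP : IsLowerSet (P : Set (Fin d → ℕ))) (hpos : ∀ i, 1 ≤ axisLength P i)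
    (h : ∀ i, d * axisLength P i ≤ P.card → axisLength P i + 1 < d) :
    ∃ x ∈ P, d * (comparables P x).card ≤ P.card + d * d ^ d := by
  classical
  let S : Finset (Fin d) := univ.filter fun i => d * axisLength P i ≤ P.card
  have hS : ∀ i, i ∈ S ↔ d * axisLength P i ≤ P.card := by simp [S]
  obtain ⟨s, hs, hmin⟩ := exists_maximal_card_fiber_le hne hP S
  obtain ⟨x, hx, hxs⟩ := mem_image.1 hs.prop
  have hsP : s ∈ P := hxs ▸ restrict_mem hP S hx
  have hsd : ∀ i, s i < d := fun i => by
    by_cases hi : i ∈ S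
    · have := h i ((hS i).1 hi)
      have := le_axisLength hsP i
      lia
    · simp only [← hxs, restrict, hi, if_false]
      exact hd
  refine ⟨s, hsP, ?_⟩
  have hfib : d * (fiber P S s).card ≤ P.card := by
    by_contra! hlt
    have hterm : ∀ i, P.card < d *
        (if i ∈ S then (fiber P S (Pi.single i 1)).card else axisLength P i) := by
      intro i
      split_ifs with hi
      · refine hlt.trans_le (Nat.mul_le_mul_left d (hmin _ (mem_image.2
          ⟨Pi.single i 1, single_mem hne hP (hpos i), funext fun j => ?_⟩)))
        by_cases hj : j = i
        · subst hj
          simp [restrict, hi]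
        · simp [restrict, hj]
      · exact not_le.1 fun hc => hi ((hS i).2 hc)
    have hsum := sum_lt_sum_of_nonempty (s := (univ : Finset (Fin d))) ⟨⟨0, hd⟩, mem_univ _⟩
      fun i _ => hterm i
    rw [← mul_sum] at hsum
    have := Nat.mul_le_mul_left d (sum_le_card hne hP S)
    simp at hsum
    lia
  calc d * (comparables P s).card ≤ d * ((fiber P S s).card + d ^ d) :=
        Nat.mul_le_mul_left d (card_comparables_le_of_maximal hs hsd)
    _ ≤ P.card + d * d ^ d := by rw [mul_add]; gcongr

lemma exists_card_comparables_mul_le (hd : 1 ≤ d) (hne : P.Nonempty)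
    (hP : IsLowerSet (P : Set (Fin d → ℕ))) (hpos : ∀ i, 1 ≤ axisLength P i) :
    ∃ x ∈ P, d * (comparables P x).card ≤ P.card + (d + d ^ 2 + d * d ^ d) := by
  by_cases h : ∀ i, d * axisLength P i ≤ P.card → axisLength P i + 1 < d
  · obtain ⟨x, hx, hc⟩ := exists_card_comparables_mul_le_of_forall hd hne hP hpos h
    exact ⟨x, hx, by lia⟩
  · push Not at h
    obtain ⟨i, hN, hi⟩ := h
    have := card_comparables_single_mul_le hP hi hN
    exact ⟨_, single_mem hne hP le_rfl, this.trans (by simp)⟩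

end OrderIdeal

open OrderIdeal

/-- for every `d ≥ 1` there is a constant `c_d` such that every finite nonempty
order ideal `P` of `ℕ^d` not contained in a coordinate hyperplane satisfies
`π(P) ≥ (1 - 1/d)|P| - c_d`. -/
theorem stmt_6 (d : ℕ) (hd : 1 ≤ d) :
    ∃ c : ℝ,
      ∀ P : Finset (Fin d → ℕ),
        P.Nonempty →
        (∀ x y : Fin d → ℕ, x ≤ y → y ∈ P → x ∈ P) →
        (∀ i : Fin d, ∃ x ∈ P, x i ≠ 0) →
        ∃ x : ↥P, (1 - 1 / (d : ℝ)) * (P.card : ℝ) - c ≤ (piVal x : ℝ) := by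
  refine ⟨((d + d ^ 2 + d * d ^ d : ℕ) : ℝ) / d, fun P hne hlow hcoord => ?_⟩
  have hP : IsLowerSet (P : Set (Fin d → ℕ)) := fun y x hxy hy => hlow x y hxy hy
  have hpos : ∀ i, 1 ≤ axisLength P i := fun i => by
    obtain ⟨x, hx, hxi⟩ := hcoord i
    exact (Nat.one_le_iff_ne_zero.2 hxi).trans (le_axisLength hx i)
  obtain ⟨x, hx, hc⟩ := exists_card_comparables_mul_le hd hne hP hpos
  refine ⟨⟨x, hx⟩, ?_⟩
  have hpi := piVal_add_card_comparables (⟨x, hx⟩ : ↥P)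
  generalize d + d ^ 2 + d * d ^ d = c at hc ⊢
  have hd' : (0 : ℝ) < d := by exact_mod_cast hd
  have hpi' : (piVal (⟨x, hx⟩ : ↥P) : ℝ) + (comparables P x).card = P.card := by
    exact_mod_cast hpi
  have hc' : ((comparables P x).card : ℝ) ≤ (P.card + c) / d := by
    rw [le_div_iff₀' hd']
    exact_mod_cast hc
  have hsplit : (1 - 1 / (d : ℝ)) * P.card - c / d = P.card - (P.card + c) / d := by ring
  linarith
end

section
/- (Shepp's XYZ inequality, iterated form.) For every finite poset P, every x ∈ P and every subset Y ⊆ P \ {x}: ℙ(y ≺ x for all y ∈ Y) ≥ ∏_{y∈Y} ℙ(y ≺ x). -/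
open Finset

open Filter Topology Asymptotics

/-- The coordinates in which Shepp's distributive lattice structure on maps `β → ℤ` is the product
order: the value at `x`, with the order reversed, and the differences to that value. -/
def sheppCoords {β : Type*} (x : β) {N : ℕ} (w : β → Fin N) : ℤᵒᵈ × (β → ℤ) :=
  (OrderDual.toDual (w x : ℤ), fun i => (w i : ℤ) - w x)

lemma sheppCoords_injective {β : Type*} (x : β) (N : ℕ) :
    Function.Injective (sheppCoords x : (β → Fin N) → ℤᵒᵈ × (β → ℤ)) := by
  intro w w' h
  have h1 : (w x : ℤ) = w' x := congrArg (fun p => OrderDual.ofDual p.1) h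
  funext i
  have h2 : (w i : ℤ) - w x = w' i - w' x := congrFun (congrArg Prod.snd h) i
  exact Fin.ext (by omega)

section StrictMaps
variable {β : Type*} [Fintype β] [PartialOrder β]

open Classical in
/-- The strictly monotone maps `β → Fin N` that send every element of `Y` strictly below the
image of `x`. -/
noncomputable def strictMaps (x : β) (Y : Finset β) (N : ℕ) : Finset (β → Fin N) :=
  {w | (∀ i j, i < j → w i < w j) ∧ ∀ y ∈ Y, w y < w x}

lemma mem_strictMaps {x : β} {Y : Finset β} {N : ℕ} {w : β → Fin N} :
    w ∈ strictMaps x Y N ↔ (∀ i j, i < j → w i < w j) ∧ ∀ y ∈ Y, w y < w x := by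
  simp [strictMaps]

lemma exists_sheppCoords_eq_inf {x : β} [DecidableEq β] {Y Z : Finset β} {N : ℕ}
    {w w' : β → Fin N} (hw : w ∈ strictMaps x Y N) (hw' : w' ∈ strictMaps x Z N) :
    ∃ v ∈ strictMaps x (Y ∪ Z) N, sheppCoords x v = sheppCoords x w ⊓ sheppCoords x w' := by
  rw [mem_strictMaps] at hw hw'
  set g : β → ℤ := fun i => max (w x : ℤ) (w' x) + min ((w i : ℤ) - w x) ((w' i : ℤ) - w' x)
    with hg
  have hg0 (i : β) : 0 ≤ g i ∧ g i < N := by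
    have := (w i).2; have := (w' i).2; have := (w x).2; have := (w' x).2
    simp only [hg]; omega
  refine ⟨fun i => ⟨(g i).toNat, by have := hg0 i; omega⟩, ?_, ?_⟩
  · rw [mem_strictMaps]
    constructor
    · intro i j hij
      have h1 := hw.1 i j hij
      have h2 := hw'.1 i j hij
      have := hg0 i; have := hg0 j
      rw [Fin.lt_def] at *
      simp only [hg] at *
      omega
    · intro y hy
      have := hg0 y; have := hg0 x
      rcases Finset.mem_union.1 hy with hy | hy
      · have h1 := hw.2 y hy
        rw [Fin.lt_def] at *
        simp only [hg] at *
        omega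
      · have h1 := hw'.2 y hy
        rw [Fin.lt_def] at *
        simp only [hg] at *
        omega
  · have hx := hg0 x
    refine Prod.ext ?_ (funext fun i => ?_)
    · change (((g x).toNat : ℕ) : ℤ) = max (w x : ℤ) (w' x)
      simp only [hg] at *
      omega
    · have := hg0 i
      change (((g i).toNat : ℕ) : ℤ) - ((g x).toNat : ℕ) =
        min ((w i : ℤ) - w x) ((w' i : ℤ) - w' x)
      simp only [hg] at *
      omega

lemma exists_sheppCoords_eq_sup {x : β} {Y Z : Finset β} {N : ℕ}
    {w w' : β → Fin N} (hw : w ∈ strictMaps x Y N) (hw' : w' ∈ strictMaps x Z N) :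
    ∃ v ∈ strictMaps x ∅ N, sheppCoords x v = sheppCoords x w ⊔ sheppCoords x w' := by
  rw [mem_strictMaps] at hw hw'
  set g : β → ℤ := fun i => min (w x : ℤ) (w' x) + max ((w i : ℤ) - w x) ((w' i : ℤ) - w' x)
    with hg
  have hg0 (i : β) : 0 ≤ g i ∧ g i < N := by
    have := (w i).2; have := (w' i).2; have := (w x).2; have := (w' x).2
    simp only [hg]; omega
  refine ⟨fun i => ⟨(g i).toNat, by have := hg0 i; omega⟩, ?_, ?_⟩
  · rw [mem_strictMaps]
    refine ⟨fun i j hij => ?_, by simp⟩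
    have h1 := hw.1 i j hij
    have h2 := hw'.1 i j hij
    have := hg0 i; have := hg0 j
    rw [Fin.lt_def] at *
    simp only [hg] at *
    omega
  · have hx := hg0 x
    refine Prod.ext ?_ (funext fun i => ?_)
    · change (((g x).toNat : ℕ) : ℤ) = min (w x : ℤ) (w' x)
      simp only [hg] at *
      omega
    · have := hg0 i
      change (((g i).toNat : ℕ) : ℤ) - ((g x).toNat : ℕ) =
        max ((w i : ℤ) - w x) ((w' i : ℤ) - w' x)
      simp only [hg] at *
      omega

lemma card_strictMaps_mul_le (x : β) [DecidableEq β] (Y Z : Finset β) (N : ℕ) :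
    #(strictMaps x Y N) * #(strictMaps x Z N) ≤
      #(strictMaps x (Y ∪ Z) N) * #(strictMaps x ∅ N) := by
  have hinj := sheppCoords_injective x N
  have key := Finset.le_card_infs_mul_card_sups ((strictMaps x Y N).image (sheppCoords x))
    ((strictMaps x Z N).image (sheppCoords x))
  rw [Finset.card_image_of_injective _ hinj, Finset.card_image_of_injective _ hinj] at key
  refine key.trans (Nat.mul_le_mul ?_ ?_)
  · rw [← Finset.card_image_of_injective (strictMaps x (Y ∪ Z) N) hinj]
    refine Finset.card_le_card fun p hp => ?_
    obtain ⟨a, ha, b, hb, rfl⟩ := Finset.mem_infs.1 hp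
    obtain ⟨w, hw, rfl⟩ := Finset.mem_image.1 ha
    obtain ⟨w', hw', rfl⟩ := Finset.mem_image.1 hb
    exact Finset.mem_image.2 (exists_sheppCoords_eq_inf hw hw')
  · rw [← Finset.card_image_of_injective (strictMaps x ∅ N) hinj]
    refine Finset.card_le_card fun p hp => ?_
    obtain ⟨a, ha, b, hb, rfl⟩ := Finset.mem_sups.1 hp
    obtain ⟨w, hw, rfl⟩ := Finset.mem_image.1 ha
    obtain ⟨w', hw', rfl⟩ := Finset.mem_image.1 hb
    exact Finset.mem_image.2 (exists_sheppCoords_eq_sup hw hw')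

/-- The number of linear extensions that put every element of `Y` below `x`. -/
noncomputable def cardBelow (x : β) (Y : Finset β) : ℕ :=
  Nat.card {f : LinExt β // ∀ y ∈ Y, val f y < val f x}

lemma val_lt_val_iff {f : LinExt β} {y x : β} : val f y < val f x ↔ f.1 y < f.1 x := by
  rw [_root_.val, _root_.val, Nat.add_lt_add_iff_right, Fin.val_fin_lt]

open Classical in
lemma card_filter_injective_strictMaps (x : β) (Y : Finset β) (N : ℕ) :
    #{w ∈ strictMaps x Y N | Function.Injective w} =
      cardBelow x Y * N.choose (Fintype.card β) := by
  have hchoose : Nat.card (Fin (Fintype.card β) ↪o Fin N) = N.choose (Fintype.card β) := by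
    rw [Nat.card_congr Set.powersetCard.ofFinEmbEquiv, Set.powersetCard.card, Nat.card_fin]
  rw [cardBelow, ← hchoose, ← Nat.card_prod, ← Nat.card_eq_finsetCard]
  symm
  refine Nat.card_eq_of_bijective (fun p => ⟨fun i => p.2 (p.1.1.1 i), ?_⟩) ⟨?_, ?_⟩
  · rw [Finset.mem_filter, mem_strictMaps]
    refine ⟨⟨fun i j hij => p.2.lt_iff_lt.2 (p.1.1.2 i j hij),
      fun y hy => p.2.lt_iff_lt.2 (val_lt_val_iff.1 (p.1.2 y hy))⟩,
      p.2.injective.comp p.1.1.1.injective⟩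
  · rintro ⟨⟨f, hf⟩, g⟩ ⟨⟨f', hf'⟩, g'⟩ h
    have h' : ⇑g ∘ f.1 = ⇑g' ∘ f'.1 := congrArg Subtype.val h
    have hr : Set.range g = Set.range g' := by
      rw [← f.1.surjective.range_comp g, ← f'.1.surjective.range_comp g', h']
    obtain rfl : g = g' := OrderEmbedding.range_inj.1 hr
    obtain rfl : f = f' :=
      Subtype.ext (Equiv.ext fun i => g.injective (congrFun h' i))
    rfl
  · rintro ⟨w, hw⟩
    rw [Finset.mem_filter, mem_strictMaps] at hw
    obtain ⟨⟨hmono, hY⟩, hinj⟩ := hw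
    have hc : #(Finset.univ.image w) = Fintype.card β := by
      rw [Finset.card_image_of_injective _ hinj, Finset.card_univ]
    set e := (Finset.univ.image w).orderIsoOfFin hc
    have hbij : Function.Bijective
        (fun i => e.symm ⟨w i, Finset.mem_image_of_mem w (Finset.mem_univ i)⟩) := by
      rw [Fintype.bijective_iff_injective_and_card]
      refine ⟨fun i j hij => hinj ?_, by simp⟩
      simpa using hij
    refine ⟨⟨⟨⟨Equiv.ofBijective _ hbij, fun i j hij => ?_⟩, fun y hy => ?_⟩,
      (Finset.univ.image w).orderEmbOfFin hc⟩, ?_⟩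
    · simpa using hmono i j hij
    · refine val_lt_val_iff.2 ?_
      simpa using hY y hy
    · refine Subtype.ext (funext fun i => ?_)
      simp [e, ← Finset.coe_orderIsoOfFin_apply]

open Classical in
lemma card_filter_not_injective_le (x : β) (Y : Finset β) (N : ℕ) :
    #{w ∈ strictMaps x Y N | ¬ Function.Injective w} + N.descFactorial (Fintype.card β) ≤
      N ^ Fintype.card β := by
  have h1 : #{w : β → Fin N | Function.Injective w} = N.descFactorial (Fintype.card β) := by
    rw [← Fintype.card_subtype,
      Fintype.card_congr (Equiv.subtypeInjectiveEquivEmbedding β (Fin N)),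
      Fintype.card_embedding_eq, Fintype.card_fin]
  have h2 := Finset.card_filter_add_card_filter_not (s := (Finset.univ : Finset (β → Fin N)))
    (fun w => Function.Injective w)
  have h3 : #{w ∈ strictMaps x Y N | ¬ Function.Injective w} ≤
      #{w : β → Fin N | ¬ Function.Injective w} :=
    Finset.card_le_card (Finset.filter_subset_filter _ (Finset.subset_univ _))
  rw [Finset.card_univ, Fintype.card_fun, Fintype.card_fin] at h2
  omega

lemma tendsto_card_strictMaps_div (x : β) (Y : Finset β) :
    Tendsto (fun N : ℕ => (#(strictMaps x Y N) : ℝ) / (N : ℝ) ^ Fintype.card β) atTop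
      (𝓝 (cardBelow x Y / (Fintype.card β).factorial)) := by
  classical
  set n := Fintype.card β
  have hz : ∀ᶠ N : ℕ in atTop, (N : ℝ) ^ n ≠ 0 := by
    filter_upwards [eventually_gt_atTop 0] with N hN
    positivity
  have hdesc : Tendsto (fun N : ℕ => (N.descFactorial n : ℝ) / (N : ℝ) ^ n) atTop (𝓝 1) :=
    (isEquivalent_iff_tendsto_one hz).1 (isEquivalent_descFactorial n)
  have hchoose (N : ℕ) : (N.choose n : ℝ) = N.descFactorial n / n.factorial := by
    rw [Nat.descFactorial_eq_factorial_mul_choose]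
    push_cast
    field_simp
  have hlow : Tendsto (fun N : ℕ => (cardBelow x Y : ℝ) / n.factorial *
      ((N.descFactorial n : ℝ) / (N : ℝ) ^ n)) atTop (𝓝 (cardBelow x Y / n.factorial)) := by
    simpa using hdesc.const_mul ((cardBelow x Y : ℝ) / n.factorial)
  have hup : Tendsto (fun N : ℕ => (cardBelow x Y : ℝ) / n.factorial *
      ((N.descFactorial n : ℝ) / (N : ℝ) ^ n) + (1 - (N.descFactorial n : ℝ) / (N : ℝ) ^ n))
      atTop (𝓝 (cardBelow x Y / n.factorial)) := by
    simpa using hlow.add (hdesc.const_sub 1)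
  have hsplit (N : ℕ) : (#(strictMaps x Y N) : ℝ) =
      cardBelow x Y / n.factorial * N.descFactorial n +
        #{w ∈ strictMaps x Y N | ¬ Function.Injective w} := by
    rw [← Finset.card_filter_add_card_filter_not (s := strictMaps x Y N)
      (fun w => Function.Injective w), card_filter_injective_strictMaps]
    push_cast
    rw [hchoose]
    ring
  refine tendsto_of_tendsto_of_tendsto_of_le_of_le' hlow hup ?_ ?_
  · filter_upwards with N
    rw [hsplit, ← mul_div_assoc]
    gcongr
    simp
  · filter_upwards [hz] with N hN
    have h := card_filter_not_injective_le x Y N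
    have h' : (#{w ∈ strictMaps x Y N | ¬ Function.Injective w} : ℝ) ≤
        (N : ℝ) ^ n - N.descFactorial n := by
      rw [le_sub_iff_add_le]
      exact_mod_cast h
    rw [hsplit, ← mul_div_assoc, ← div_self hN, ← sub_div, ← add_div]
    gcongr

lemma cardBelow_mul_le (x : β) [DecidableEq β] (Y Z : Finset β) :
    (cardBelow x Y : ℝ) * cardBelow x Z ≤ cardBelow x (Y ∪ Z) * cardBelow x ∅ := by
  have h := le_of_tendsto_of_tendsto'
    ((tendsto_card_strictMaps_div x Y).mul (tendsto_card_strictMaps_div x Z))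
    ((tendsto_card_strictMaps_div x (Y ∪ Z)).mul (tendsto_card_strictMaps_div x ∅))
    fun N => by
      rw [div_mul_div_comm, div_mul_div_comm]
      exact div_le_div_of_nonneg_right (mod_cast card_strictMaps_mul_le x Y Z N) (by positivity)
  rw [div_mul_div_comm, div_mul_div_comm] at h
  exact (div_le_div_iff_of_pos_right (by positivity)).1 h

end StrictMaps

instance {β : Type*} [Fintype β] [PartialOrder β] : Nonempty (LinExt β) := by
  classical
  let : Fintype (LinearExtension β) := ‹Fintype β›
  let e : Fin (Fintype.card β) ≃o LinearExtension β := Fintype.orderIsoFinOfCardEq _ rfl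
  refine ⟨⟨e.symm.toEquiv, fun a b hab => ?_⟩⟩
  have h : toLinearExtension a < toLinearExtension b :=
    lt_of_le_of_ne (toLinearExtension.monotone hab.le) hab.ne
  exact e.symm.strictMono h

/-- Shepp's XYZ inequality, iterated form:
`ℙ(y ≺ x for all y ∈ Y) ≥ ∏_{y ∈ Y} ℙ(y ≺ x)`. -/
theorem stmt_7 (β : Type) [Fintype β] [PartialOrder β] (x : β) (Y : Finset β)
    (hx : x ∉ Y) :
    ∏ y ∈ Y, prLT y x ≤ Pr (fun f => ∀ y ∈ Y, val f y < val f x) := by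
  classical
  have hpos : (0 : ℝ) < Nat.card (LinExt β) := by exact_mod_cast Nat.card_pos
  have hempty : cardBelow x ∅ = Nat.card (LinExt β) := by
    rw [cardBelow]
    exact Nat.card_congr (Equiv.subtypeUnivEquiv (by simp))
  have hsingle (y : β) : prLT y x = cardBelow x {y} / Nat.card (LinExt β) := by
    simp [prLT, Pr, cardBelow]
  change _ ≤ (cardBelow x Y : ℝ) / Nat.card (LinExt β)
  clear hx
  induction Y using Finset.induction_on with
  | empty => simp [hempty]
  | insert y Y hy ih =>
    rw [Finset.prod_insert hy, hsingle]
    have h := cardBelow_mul_le x {y} Y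
    rw [hempty, ← Finset.insert_eq] at h
    calc _ ≤ (cardBelow x {y} : ℝ) / Nat.card (LinExt β) *
          (cardBelow x Y / Nat.card (LinExt β)) := by gcongr
      _ = (cardBelow x {y} : ℝ) * cardBelow x Y / Nat.card (LinExt β) / Nat.card (LinExt β) := by
        ring
      _ ≤ _ := by
        gcongr
        rwa [div_le_iff₀ hpos]
end
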